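/- Let 21 ∈ S_2 denote the inversion pattern. Then: (i) for every ℓ ∈ [0,1], μ_ℓ is CNC with respect to 21, t_{21}(μ_ℓ) = (2−ℓ)/4 and α_{21}(μ_ℓ) = 1; (ii) for ℓ = 0 (so μ₀ = λ), the set 𝒪(𝒢(21,μ₀,δ)) := {𝒪(ν) : ν ∈ 𝒢(21,μ₀,δ)} has exactly one element for every δ ∈ [1/2,1); (iii) for every ℓ ∈ [0,1] there exists δ_c(ℓ) > (2−ℓ)/4 such that 𝒪(𝒢(21,μ_ℓ,δ)) has exactly one element for every δ ∈ [(2−ℓ)/4, δ_c(ℓ)); and (iv) there exists ℓ_c < 1 such that for every ℓ ∈ (ℓ_c,1] there exists δ′_c(ℓ) < 1 such that 𝒪(𝒢(21,μ_ℓ,δ)) has at least two elements for every δ ∈ (δ′_c(ℓ),1). -/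

import Mathlib

open MeasureTheory Filter Topology
open scoped ENNReal

noncomputable section

/-- The plane `ℝ²`, carrier for measures on the unit square. -/
abbrev Ω2 : Type := ℝ × ℝ

/-- The unit square `[0,1]² ⊆ ℝ²`. -/
def unitSq : Set Ω2 := Set.Icc (0 : ℝ) 1 ×ˢ Set.Icc (0 : ℝ) 1

/-- Lebesgue measure on the unit square. -/
def lebSq : Measure Ω2 := volume.restrict unitSq

/-- `𝒫`: Borel probability measures concentrated on the unit square. -/
def Pcal : Set (ProbabilityMeasure Ω2) := {μ | (μ : Measure Ω2) unitSq = 1}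

/-- `ℳ`: members of `𝒫` whose two coordinate marginals are atomless
(equivalently, have continuous CDFs). -/
def Mcal : Set (ProbabilityMeasure Ω2) :=
  {μ | μ ∈ Pcal ∧ (∀ x : ℝ, (μ : Measure Ω2).map Prod.fst {x} = 0) ∧
      ∀ y : ℝ, (μ : Measure Ω2).map Prod.snd {y} = 0}

/-- The uniform distribution on `[0,1]`. -/
def unif01 : Measure ℝ := volume.restrict (Set.Icc (0 : ℝ) 1)

/-- `ℳ̃`: permutons, i.e. members of `𝒫` with both marginals uniform on `[0,1]`. -/
def Mtilde : Set (ProbabilityMeasure Ω2) :=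
  {μ | μ ∈ Pcal ∧ (μ : Measure Ω2).map Prod.fst = unif01 ∧
      (μ : Measure Ω2).map Prod.snd = unif01}

open scoped Classical in
/-- `h_σ`: indicator that the `k` points induce the pattern `σ`. -/
def hPat {k : ℕ} (σ : Equiv.Perm (Fin k)) (z : Fin k → Ω2) : ℝ :=
  if ∃ τ : Equiv.Perm (Fin k),
      StrictMono (fun i => (z (τ i)).1) ∧ StrictMono (fun i => (z (τ (σ⁻¹ i))).2)
  then 1 else 0

/-- Pattern density `t_σ(ν) = ∫ h_σ dν^{⊗k}`. -/
def tPat {k : ℕ} (σ : Equiv.Perm (Fin k)) (ν : Measure Ω2) : ℝ :=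
  ∫ z, hPat σ z ∂(Measure.pi fun _ : Fin k => ν)

open scoped Classical in
/-- The permutation induced by `n` labelled points of `ℝ²` (junk value `1` if the
coordinates are not in generic position). -/
def inducedPerm {n : ℕ} (z : Fin n → Ω2) : Equiv.Perm (Fin n) :=
  if h : ∃ σ : Equiv.Perm (Fin n), hPat σ z = 1 then h.choose else 1

/-- Empirical measure `Em(π) = (1/n) ∑ δ_{(i/n, π(i)/n)}` of a permutation, as a measure. -/
def EmM {n : ℕ} (π : Equiv.Perm (Fin n)) : Measure Ω2 :=
  (n : ℝ≥0∞)⁻¹ • ∑ i : Fin n, Measure.dirac ((((i : ℕ) + 1 : ℝ)) / n, (((π i : ℕ) + 1 : ℝ)) / n)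

open scoped Classical in
/-- Empirical measure of a permutation as a probability measure (junk value for `n = 0`). -/
def EmP {n : ℕ} (π : Equiv.Perm (Fin n)) : ProbabilityMeasure Ω2 :=
  if h : IsProbabilityMeasure (EmM π) then ⟨EmM π, h⟩
  else ⟨Measure.dirac 0, by infer_instance⟩

/-- `t_σ(π) := t_σ(Em(π))`. -/
def tPerm {k n : ℕ} (σ : Equiv.Perm (Fin k)) (π : Equiv.Perm (Fin n)) : ℝ := tPat σ (EmM π)

open scoped Classical in
/-- Kullback–Leibler divergence `D(ν|μ) ∈ [0,∞]`; for probability measures with `ν ≪ μ`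
it equals `∫ log(dν/dμ) dν`, written here through the nonnegative integrand
`g log g + 1 - g` of the density `g = dν/dμ` (the correction `∫ (1-g) dμ = 0`). -/
def KL (ν μ : Measure Ω2) : ℝ≥0∞ :=
  if ν ≪ μ then
    ∫⁻ z, ENNReal.ofReal ((ν.rnDeriv μ z).toReal * Real.log ((ν.rnDeriv μ z).toReal)
      + 1 - (ν.rnDeriv μ z).toReal) ∂μ
  else ∞

/-- CDF of the first marginal. -/
def cdfX (μ : Measure Ω2) (x : ℝ) : ℝ := (μ {p : Ω2 | p.1 ≤ x}).toReal

/-- CDF of the second marginal. -/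
def cdfY (μ : Measure Ω2) (y : ℝ) : ℝ := (μ {p : Ω2 | p.2 ≤ y}).toReal

/-- The map `𝒪`: pushforward of `μ` under `(x,y) ↦ (F₁(x), F₂(y))`. -/
def Omap (μ : Measure Ω2) : Measure Ω2 := μ.map fun p => (cdfX μ p.1, cdfY μ p.2)

/-- The product measure `μ^{⊗n}` governing `n` i.i.d. samples. -/
def pmeas (μ : Measure Ω2) (n : ℕ) : Measure (Fin n → Ω2) := Measure.pi fun _ => μ

/-- Log-partition function `F_n(σ,μ,θ) = log E[exp(nθ t_σ(π_{n,μ}))]`. -/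
def Fn {k : ℕ} (σ : Equiv.Perm (Fin k)) (μ : Measure Ω2) (θ : ℝ) (n : ℕ) : ℝ :=
  Real.log (∫ z, Real.exp (n * θ * tPerm σ (inducedPerm z)) ∂pmeas μ n)

/-- The Gibbs measure `Q_{n,σ,μ,θ}` on `([0,1]²)ⁿ`. -/
def Qgibbs {k : ℕ} (σ : Equiv.Perm (Fin k)) (μ : Measure Ω2) (θ : ℝ) (n : ℕ) :
    Measure (Fin n → Ω2) :=
  (pmeas μ n).withDensity fun z =>
    ENNReal.ofReal (Real.exp (n * θ * tPerm σ (inducedPerm z) - Fn σ μ θ n))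

/-- `F(σ,μ,θ) = sup_{ν ∈ ℳ} { θ t_σ(ν) − D(ν|μ) }`, valued in `EReal`. -/
def Fsup {k : ℕ} (σ : Equiv.Perm (Fin k)) (μ : Measure Ω2) (θ : ℝ) : EReal :=
  ⨆ ν ∈ Mcal, (((θ * tPat σ (ν : Measure Ω2) : ℝ) : EReal) - ((KL (↑ν) μ : ℝ≥0∞) : EReal))

/-- `ℱ(σ,μ,θ)`: the set of maximizers of `ν ↦ θ t_σ(ν) − D(ν|μ)` over `ℳ`. -/
def Fset {k : ℕ} (σ : Equiv.Perm (Fin k)) (μ : Measure Ω2) (θ : ℝ) :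
    Set (ProbabilityMeasure Ω2) :=
  {ν | ν ∈ Mcal ∧
    (((θ * tPat σ (ν : Measure Ω2) : ℝ) : EReal) - ((KL (↑ν) μ : ℝ≥0∞) : EReal)) = Fsup σ μ θ}

/-- `G(σ,μ,δ) = inf { D(ν|μ) : ν ∈ ℳ, t_σ(ν) ≥ δ }`. -/
def Gfun {k : ℕ} (σ : Equiv.Perm (Fin k)) (μ : Measure Ω2) (δ : ℝ) : ℝ≥0∞ :=
  ⨅ ν ∈ {ν : ProbabilityMeasure Ω2 | ν ∈ Mcal ∧ δ ≤ tPat σ (ν : Measure Ω2)}, KL (↑ν) μ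

/-- `𝒢(σ,μ,δ)`: the set of minimizers in the definition of `G(σ,μ,δ)`. -/
def Gset {k : ℕ} (σ : Equiv.Perm (Fin k)) (μ : Measure Ω2) (δ : ℝ) :
    Set (ProbabilityMeasure Ω2) :=
  {ν | (ν ∈ Mcal ∧ δ ≤ tPat σ (ν : Measure Ω2)) ∧ KL (↑ν) μ = Gfun σ μ δ}

/-- `α_σ(μ) = inf {δ : G(σ,μ,δ) = ∞}`. -/
def alphaSig {k : ℕ} (σ : Equiv.Perm (Fin k)) (μ : Measure Ω2) : ℝ :=
  sInf {δ : ℝ | Gfun σ μ δ = ∞}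

/-- `μ` is conditionally constant (CC) with respect to a pattern `σ` of size `k+1`:
the conditional probability `P(π_{X,Y} = σ | (X₁,Y₁))`, which for i.i.d. samples equals
`z ↦ ∫ h_σ(z, w) dμ^{⊗k}(w)`, is `μ`-a.s. equal to a constant `c ∈ [0,1]`. -/
def IsCC {k : ℕ} (σ : Equiv.Perm (Fin (k + 1))) (μ : Measure Ω2) : Prop :=
  ∃ c ∈ Set.Icc (0 : ℝ) 1, ∀ᵐ z ∂μ,
    (∫ w : Fin k → Ω2, hPat σ (Fin.cons z w) ∂pmeas μ k) = c

/-- The inversion pattern `21 ∈ S₂`. -/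
def inv2 : Equiv.Perm (Fin 2) := Equiv.swap 0 1

/-- Lévy–Prokhorov (extended) distance between measures on `ℝ²`. -/
def dLPE (μ ν : Measure Ω2) : ℝ≥0∞ := levyProkhorovEDist μ ν

/-- The topological support of a measure: the points whose every open neighbourhood
has positive measure. -/
def msupport (μ : Measure Ω2) : Set Ω2 :=
  {z | ∀ U : Set Ω2, IsOpen U → z ∈ U → 0 < μ U}


/-- The permuton `μ₁`: density `2` on `[0,1/2]² ∪ [1/2,1]²`. -/
def mu1M : Measure Ω2 :=
  (2 : ℝ≥0∞) • volume.restrict (Set.Icc (0 : ℝ) (1/2) ×ˢ Set.Icc (0 : ℝ) (1/2)) +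
  (2 : ℝ≥0∞) • volume.restrict (Set.Icc (1/2 : ℝ) 1 ×ˢ Set.Icc (1/2 : ℝ) 1)

/-- The interpolation `μ_ℓ = (1−ℓ)λ + ℓμ₁`. -/
def muL (ℓ : ℝ) : Measure Ω2 := ENNReal.ofReal (1 - ℓ) • lebSq + ENNReal.ofReal ℓ • mu1M

open InformationTheory

/-! ### Kullback–Leibler divergence -/

section KLTools

variable {α : Type*} [MeasurableSpace α]

lemma KL_eq_klDiv (ν μ : Measure Ω2) [IsFiniteMeasure ν] [IsFiniteMeasure μ] :
    KL ν μ = klDiv ν μ := by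
  rw [klDiv_eq_lintegral_klFun, KL]
  rfl

lemma integrable_of_abs_le {μ : Measure α} [IsFiniteMeasure μ] {f : α → ℝ} {B : ℝ}
    (hf : Measurable f) (hB : ∀ x, |f x| ≤ B) : Integrable f μ :=
  Integrable.of_bound hf.aestronglyMeasurable B (ae_of_all _ hB)

lemma integrable_exp_of_abs_le {μ : Measure α} [IsFiniteMeasure μ] {f : α → ℝ} {B : ℝ}
    (hf : Measurable f) (hB : ∀ x, |f x| ≤ B) : Integrable (fun x => Real.exp (f x)) μ := by
  refine Integrable.of_bound (C := Real.exp B) (by fun_prop) (ae_of_all _ fun x => ?_)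
  rw [Real.norm_eq_abs, abs_of_pos (Real.exp_pos _), Real.exp_le_exp]
  exact (le_abs_self _).trans (hB x)

lemma toReal_klDiv_prob {ρ μ : Measure α} [IsProbabilityMeasure ρ] [IsProbabilityMeasure μ]
    (h : klDiv ρ μ ≠ ∞) : (klDiv ρ μ).toReal = ∫ x, llr ρ μ x ∂ρ :=
  toReal_klDiv_of_measure_eq (klDiv_ne_top_iff.1 h).1 (by simp)

lemma isProbabilityMeasure_tilted_of_abs_le {μ : Measure α} [IsProbabilityMeasure μ] {f : α → ℝ}
    {B : ℝ} (hf : Measurable f) (hB : ∀ x, |f x| ≤ B) : IsProbabilityMeasure (μ.tilted f) :=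
  isProbabilityMeasure_tilted (integrable_exp_of_abs_le hf hB)

lemma klDiv_tilted_right {ρ μ : Measure α} [IsProbabilityMeasure ρ] [IsProbabilityMeasure μ]
    {f : α → ℝ} {B : ℝ} (hf : Measurable f) (hB : ∀ x, |f x| ≤ B) (h : klDiv ρ μ ≠ ∞) :
    klDiv ρ (μ.tilted f) ≠ ∞ ∧ (klDiv ρ μ).toReal =
      (klDiv ρ (μ.tilted f)).toReal + ∫ x, f x ∂ρ - Real.log (∫ x, Real.exp (f x) ∂μ) := by
  have := isProbabilityMeasure_tilted_of_abs_le (μ := μ) hf hB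
  obtain ⟨hac, hint⟩ := klDiv_ne_top_iff.1 h
  have hfρ : Integrable f ρ := integrable_of_abs_le hf hB
  have hfμ := integrable_exp_of_abs_le (μ := μ) hf hB
  have hne : klDiv ρ (μ.tilted f) ≠ ∞ :=
    klDiv_ne_top (hac.trans (absolutelyContinuous_tilted hfμ))
      (integrable_llr_tilted_right hac hfρ hint hfμ)
  refine ⟨hne, ?_⟩
  rw [toReal_klDiv_prob h, toReal_klDiv_prob hne, integral_llr_tilted_right hac hfρ hfμ hint]
  ring

lemma klDiv_tilted_left_self {μ : Measure α} [IsProbabilityMeasure μ]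
    {f : α → ℝ} {B : ℝ} (hf : Measurable f) (hB : ∀ x, |f x| ≤ B) :
    klDiv (μ.tilted f) μ ≠ ∞ ∧ (klDiv (μ.tilted f) μ).toReal =
      ∫ x, f x ∂(μ.tilted f) - Real.log (∫ x, Real.exp (f x) ∂μ) := by
  have := isProbabilityMeasure_tilted_of_abs_le (μ := μ) hf hB
  have hfμ := integrable_exp_of_abs_le (μ := μ) hf hB
  have hac : μ.tilted f ≪ μ := tilted_absolutelyContinuous μ f
  have hllr : llr (μ.tilted f) μ =ᵐ[μ.tilted f]
      fun x => f x - Real.log (∫ x, Real.exp (f x) ∂μ) := by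
    filter_upwards [hac.ae_le (log_rnDeriv_tilted_left_self hfμ)] with x hx
    rw [llr, hx]
  have hfi : Integrable f (μ.tilted f) := integrable_of_abs_le hf hB
  have hne : klDiv (μ.tilted f) μ ≠ ∞ := by
    refine klDiv_ne_top hac ?_
    rw [integrable_congr hllr]
    exact hfi.sub (integrable_const _)
  refine ⟨hne, ?_⟩
  rw [toReal_klDiv_prob hne, integral_congr_ae hllr, integral_sub hfi (integrable_const _)]
  simp

/-- The easy half of the Donsker–Varadhan formula. -/
lemma integral_sub_log_le_klDiv {ρ μ : Measure α} [IsProbabilityMeasure ρ]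
    [IsProbabilityMeasure μ] {f : α → ℝ} {B : ℝ} (hf : Measurable f) (hB : ∀ x, |f x| ≤ B)
    (h : klDiv ρ μ ≠ ∞) :
    ∫ x, f x ∂ρ - Real.log (∫ x, Real.exp (f x) ∂μ) ≤ (klDiv ρ μ).toReal := by
  rw [(klDiv_tilted_right hf hB h).2]
  linarith [ENNReal.toReal_nonneg (a := klDiv ρ (μ.tilted f))]

lemma sq_sqrt_sub_one_le_klFun {x : ℝ} (hx : 0 ≤ x) : (√x - 1) ^ 2 ≤ klFun x := by
  obtain ⟨y, hy, rfl⟩ : ∃ y : ℝ, 0 ≤ y ∧ x = y ^ 2 := ⟨√x, Real.sqrt_nonneg _, (Real.sq_sqrt hx).symm⟩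
  rw [Real.sqrt_sq hy, klFun_apply, Real.log_pow]
  have := klFun_nonneg hy
  rw [klFun_apply] at this
  push_cast
  nlinarith [mul_nonneg hy this]

lemma abs_sub_le_sqrt_sub_sq {a b ε : ℝ} (ha : 0 ≤ a) (hb : 0 ≤ b) (hε : 0 < ε) :
    |a - b| ≤ (√a - √b) ^ 2 / (2 * ε) + ε * (a + b) := by
  obtain ⟨x, hx, rfl⟩ : ∃ y : ℝ, 0 ≤ y ∧ a = y ^ 2 := ⟨√a, Real.sqrt_nonneg _, (Real.sq_sqrt ha).symm⟩
  obtain ⟨y, hy, rfl⟩ : ∃ y : ℝ, 0 ≤ y ∧ b = y ^ 2 := ⟨√b, Real.sqrt_nonneg _, (Real.sq_sqrt hb).symm⟩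
  rw [Real.sqrt_sq hx, Real.sqrt_sq hy]
  have h1 : |x ^ 2 - y ^ 2| = |x - y| * (x + y) := by
    rw [show x ^ 2 - y ^ 2 = (x - y) * (x + y) by ring, abs_mul, abs_of_nonneg (add_nonneg hx hy)]
  rw [h1, ← sq_abs (x - y)]
  set d := |x - y|
  rw [← sub_nonneg]
  have : d ^ 2 / (2 * ε) + ε * (x ^ 2 + y ^ 2) - d * (x + y)
      = ((d - ε * (x + y)) ^ 2 + ε ^ 2 * (x - y) ^ 2) / (2 * ε) := by
    field_simp; ring
  rw [this]; positivity

/-- A form of Pinsker's inequality (with a non-optimal constant). -/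
lemma abs_integral_sub_le_sqrt_klDiv {ρ μ : Measure α} [IsProbabilityMeasure ρ]
    [IsProbabilityMeasure μ] {g : α → ℝ} {B : ℝ} (hg : Measurable g) (hB : ∀ x, |g x| ≤ B)
    (h : klDiv ρ μ ≠ ∞) :
    |∫ x, g x ∂ρ - ∫ x, g x ∂μ| ≤ B * (2 * √(klDiv ρ μ).toReal) := by
  obtain ⟨hac, hint⟩ := klDiv_ne_top_iff.1 h
  set f : α → ℝ := fun x => (ρ.rnDeriv μ x).toReal with hf
  have hf0 : ∀ x, 0 ≤ f x := fun x => ENNReal.toReal_nonneg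
  have hfi : Integrable f μ := Measure.integrable_toReal_rnDeriv
  have hf1 : ∫ x, f x ∂μ = 1 := by
    rw [Measure.integral_toReal_rnDeriv hac]; simp
  have hki : Integrable (fun x => klFun (f x)) μ := (integrable_klFun_rnDeriv_iff hac).2 hint
  have hD : (klDiv ρ μ).toReal = ∫ x, klFun (f x) ∂μ := toReal_klDiv_eq_integral_klFun hac
  set D := (klDiv ρ μ).toReal
  have hD0 : 0 ≤ D := ENNReal.toReal_nonneg
  obtain ⟨x0⟩ : Nonempty α := by
    by_contra hα
    rw [not_nonempty_iff] at hα
    have := IsProbabilityMeasure.ne_zero μ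
    exact this (Subsingleton.elim _ _)
  have hB0 : 0 ≤ B := (abs_nonneg _).trans (hB x0)
  have hX : ∀ ε : ℝ, 0 < ε → ∫ x, |f x - 1| ∂μ ≤ D / (2 * ε) + ε * 2 := by
    intro ε hε
    calc ∫ x, |f x - 1| ∂μ ≤ ∫ x, (klFun (f x) / (2 * ε) + ε * (f x + 1)) ∂μ := by
          refine integral_mono (hfi.sub (integrable_const _)).abs
            ((hki.div_const _).add ((hfi.add (integrable_const _)).const_mul _)) fun x => ?_
          have h1 := abs_sub_le_sqrt_sub_sq (hf0 x) zero_le_one hε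
          have h2 := sq_sqrt_sub_one_le_klFun (hf0 x)
          rw [Real.sqrt_one] at h1
          have : (√(f x) - 1) ^ 2 / (2 * ε) ≤ klFun (f x) / (2 * ε) := by gcongr
          simp only
          linarith
      _ = D / (2 * ε) + ε * 2 := by
          have hadd : Integrable (fun x => f x + 1) μ := hfi.add (integrable_const _)
          rw [integral_add (hki.div_const _) (hadd.const_mul _),
            integral_div, integral_const_mul, integral_add hfi (integrable_const _), hf1, ← hD]
          simp; norm_num
  have hX2 : ∫ x, |f x - 1| ∂μ ≤ 2 * √D := by
    rcases hD0.eq_or_lt with h0 | hpos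
    · rw [← h0, Real.sqrt_zero, mul_zero]
      refine le_of_forall_pos_le_add fun ε hε => ?_
      have := hX (ε / 2) (by positivity)
      rw [← h0, zero_div] at this
      linarith [this]
    · have hs : 0 < √D := Real.sqrt_pos.2 hpos
      have := hX (√D / 2) (by positivity)
      have e : D / (2 * (√D / 2)) = √D := by
        field_simp
        rw [Real.sq_sqrt hD0]
      rw [e] at this
      linarith
  have hgi : Integrable g μ := integrable_of_abs_le hg hB
  have hfg : Integrable (fun x => f x * g x) μ :=
    hfi.mul_bdd hg.aestronglyMeasurable (ae_of_all _ hB)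
  have e1 : ∫ x, g x ∂ρ = ∫ x, f x * g x ∂μ := (integral_rnDeriv_smul hac).symm
  rw [e1, ← integral_sub hfg hgi]
  calc |∫ x, (f x * g x - g x) ∂μ| ≤ ∫ x, |f x * g x - g x| ∂μ := abs_integral_le_integral_abs
    _ ≤ ∫ x, B * |f x - 1| ∂μ := by
        refine integral_mono (hfg.sub hgi).abs
          ((hfi.sub (integrable_const _)).abs.const_mul _) fun x => ?_
        have : f x * g x - g x = g x * (f x - 1) := by ring
        simp only [this, abs_mul]
        exact mul_le_mul_of_nonneg_right (hB x) (abs_nonneg _)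
    _ = B * ∫ x, |f x - 1| ∂μ := integral_const_mul _ _
    _ ≤ _ := mul_le_mul_of_nonneg_left hX2 hB0

lemma klDiv_mix_le {ν ρ μ : Measure α} [IsFiniteMeasure ν] [IsFiniteMeasure ρ]
    [IsFiniteMeasure μ] (hν : ν ≪ μ) (hρ : ρ ≪ μ) {s : ℝ} (h0 : 0 ≤ s) (h1 : s ≤ 1) :
    klDiv (ENNReal.ofReal (1 - s) • ν + ENNReal.ofReal s • ρ) μ ≤
      ENNReal.ofReal (1 - s) * klDiv ν μ + ENNReal.ofReal s * klDiv ρ μ := by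
  have i1 : IsFiniteMeasure (ENNReal.ofReal (1 - s) • ν) := Measure.smul_finite _ (by simp)
  have i2 : IsFiniteMeasure (ENNReal.ofReal s • ρ) := Measure.smul_finite _ (by simp)
  have hac : ENNReal.ofReal (1 - s) • ν + ENNReal.ofReal s • ρ ≪ μ := by
    refine Measure.AbsolutelyContinuous.add_left ?_ ?_
    · exact hν.smul_left _
    · exact hρ.smul_left _
  rw [klDiv_eq_lintegral_klFun_of_ac hac, klDiv_eq_lintegral_klFun_of_ac hν,
    klDiv_eq_lintegral_klFun_of_ac hρ, ← lintegral_const_mul', ← lintegral_const_mul',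
    ← lintegral_add_left]
  · refine lintegral_mono_ae ?_
    filter_upwards [Measure.rnDeriv_add' (ENNReal.ofReal (1 - s) • ν) (ENNReal.ofReal s • ρ) μ,
      Measure.rnDeriv_smul_left_of_ne_top' ν μ (r := ENNReal.ofReal (1 - s)) (by simp),
      Measure.rnDeriv_smul_left_of_ne_top' ρ μ (r := ENNReal.ofReal s) (by simp),
      Measure.rnDeriv_lt_top ν μ, Measure.rnDeriv_lt_top ρ μ] with x e1 e2 e3 e4 e5
    rw [e1, Pi.add_apply, e2, e3, Pi.smul_apply, Pi.smul_apply, smul_eq_mul, smul_eq_mul,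
      ENNReal.toReal_add (ENNReal.mul_ne_top (by simp) e4.ne) (ENNReal.mul_ne_top (by simp) e5.ne),
      ENNReal.toReal_mul, ENNReal.toReal_mul, ENNReal.toReal_ofReal (sub_nonneg.2 h1),
      ENNReal.toReal_ofReal h0, ← ENNReal.ofReal_mul (sub_nonneg.2 h1), ← ENNReal.ofReal_mul h0,
      ← ENNReal.ofReal_add]
    · refine ENNReal.ofReal_le_ofReal ?_
      exact convexOn_klFun.2 (Set.mem_Ici.2 ENNReal.toReal_nonneg)
        (Set.mem_Ici.2 ENNReal.toReal_nonneg) (sub_nonneg.2 h1) h0 (by ring)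
    · exact mul_nonneg (sub_nonneg.2 h1) (klFun_nonneg ENNReal.toReal_nonneg)
    · exact mul_nonneg h0 (klFun_nonneg ENNReal.toReal_nonneg)
  · have := measurable_klFun
    have := Measure.measurable_rnDeriv ν μ
    fun_prop
  · simp
  · simp

/-- Changing the reference measure to a dominating one costs at most the logarithm of the
domination constant. -/
lemma klDiv_le_of_le_smul {ν μ' μ : Measure α} [IsProbabilityMeasure ν]
    [IsProbabilityMeasure μ'] [IsProbabilityMeasure μ] {C : ℝ} (hC : 0 < C)
    (hle : μ' ≤ ENNReal.ofReal C • μ) (h : klDiv ν μ' ≠ ∞) :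
    klDiv ν μ ≠ ∞ ∧ (klDiv ν μ).toReal ≤ (klDiv ν μ').toReal + Real.log C := by
  obtain ⟨hac, hint⟩ := klDiv_ne_top_iff.1 h
  have hac' : μ' ≪ μ := (Measure.absolutelyContinuous_of_le hle).trans
    (Measure.smul_absolutelyContinuous)
  have hνμ := hac.trans hac'
  have hd : ∀ᵐ x ∂μ, μ'.rnDeriv μ x ≤ ENNReal.ofReal C := by
    refine ae_le_of_forall_setLIntegral_le_of_sigmaFinite (Measure.measurable_rnDeriv _ _)
      fun s hs _ => ?_
    rw [setLIntegral_const, Measure.setLIntegral_rnDeriv hac']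
    exact hle s
  have hpt : ∀ᵐ x ∂ν, llr ν μ x ≤ llr ν μ' x + Real.log C := by
    filter_upwards [hνμ.ae_le hd, hνμ.ae_le (Measure.rnDeriv_mul_rnDeriv (κ := μ) hac),
      Measure.rnDeriv_pos hνμ, hac.ae_le (Measure.rnDeriv_lt_top ν μ'),
      Measure.rnDeriv_pos hac, hac.ae_le (Measure.rnDeriv_pos hac')] with x h1 h2 h3 h4 h5 h6
    have h7 : 0 < (μ'.rnDeriv μ x).toReal :=
      ENNReal.toReal_pos h6.ne' (h1.trans_lt ENNReal.ofReal_lt_top).ne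
    rw [llr, llr, ← h2, Pi.mul_apply, ENNReal.toReal_mul,
      Real.log_mul (ENNReal.toReal_pos h5.ne' h4.ne).ne' h7.ne']
    gcongr
    exact ENNReal.toReal_le_of_le_ofReal hC.le h1
  have hfin : klDiv ν μ ≠ ∞ := by
    refine klDiv_ne_top hνμ ?_
    have hneg : Integrable (fun x => klFun ((ν.rnDeriv μ x).toReal)) μ := by
      have hub : ∫⁻ x, ENNReal.ofReal (klFun (ν.rnDeriv μ x).toReal) ∂μ ≠ ∞ := by
        -- the positive part of `llr` is integrable, the negative part always is
        have hpos : Integrable (fun x => max (llr ν μ x) 0) ν := by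
          refine Integrable.mono' ((hint.add (integrable_const (Real.log C))).abs)
            ((measurable_llr ν μ).max measurable_const).aestronglyMeasurable ?_
          filter_upwards [hpt] with x hx
          rw [Real.norm_eq_abs, abs_of_nonneg (le_max_right _ _)]
          exact max_le (hx.trans (le_abs_self _)) (abs_nonneg _)
        have hpos' : Integrable (fun x => (ν.rnDeriv μ x).toReal • max (llr ν μ x) 0) μ :=
          (integrable_rnDeriv_smul_iff hνμ).2 hpos
        have hkey : Integrable (fun x => (ν.rnDeriv μ x).toReal • max (llr ν μ x) 0 + 1) μ :=
          hpos'.add (integrable_const _)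
        refine ((lintegral_mono fun x => ENNReal.ofReal_le_ofReal ?_).trans_lt
          hkey.lintegral_lt_top).ne
        rw [klFun_apply, smul_eq_mul]
        have := mul_le_mul_of_nonneg_left (le_max_left (llr ν μ x) 0)
          (ENNReal.toReal_nonneg (a := ν.rnDeriv μ x))
        rw [llr] at *
        linarith [ENNReal.toReal_nonneg (a := ν.rnDeriv μ x)]
      refine ⟨(measurable_klFun.comp (Measure.measurable_rnDeriv ν μ).ennreal_toReal).aestronglyMeasurable, ?_⟩
      rw [hasFiniteIntegral_iff_ofReal (ae_of_all _ fun x => klFun_nonneg ENNReal.toReal_nonneg)]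
      exact hub.lt_top
    exact (integrable_klFun_rnDeriv_iff hνμ).1 hneg
  refine ⟨hfin, ?_⟩
  rw [toReal_klDiv_prob hfin, toReal_klDiv_prob h]
  have : ∫ x, llr ν μ' x ∂ν + Real.log C = ∫ x, (llr ν μ' x + Real.log C) ∂ν := by
    rw [integral_add hint (integrable_const _)]; simp
  rw [this]
  exact integral_mono_ae (klDiv_ne_top_iff.1 hfin).2 (hint.add (integrable_const _)) hpt

lemma klDiv_ne_top_of_le_smul {ν μ : Measure α} [IsProbabilityMeasure ν]
    [IsProbabilityMeasure μ] {C : ℝ} (hC : 0 < C) (hle : ν ≤ ENNReal.ofReal C • μ) :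
    klDiv ν μ ≠ ∞ :=
  (klDiv_le_of_le_smul hC hle (by simp)).1

/-- Measures of bounded divergence are uniformly absolutely continuous. -/
lemma exists_measureReal_lt_of_klDiv_le (μ : Measure α) [IsProbabilityMeasure μ] {M ε : ℝ}
    (hε : 0 < ε) : ∃ η : ℝ, 0 < η ∧ ∀ ρ : Measure α, IsProbabilityMeasure ρ →
      klDiv ρ μ ≠ ∞ → (klDiv ρ μ).toReal ≤ M → ∀ A : Set α, MeasurableSet A →
        μ.real A < η → ρ.real A < ε := by
  set K : ℝ := (|M| + 1) / ε with hK
  have hK0 : 0 < K := by positivity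
  have he : 1 < Real.exp K := Real.one_lt_exp_iff.2 hK0
  refine ⟨1 / (Real.exp K), by positivity, fun ρ _ hne hM A hA hμA => ?_⟩
  have hm : Measurable (fun x => A.indicator (fun _ => K) x) := measurable_const.indicator hA
  have h := integral_sub_log_le_klDiv (ρ := ρ) (μ := μ) (B := K) hm (fun x => by
    by_cases hx : x ∈ A <;> simp [hx, abs_of_pos hK0, hK0.le]) hne
  rw [integral_indicator_const _ hA] at h
  have e : ∫ x, Real.exp (A.indicator (fun _ => K) x) ∂μ = 1 + μ.real A * (Real.exp K - 1) := by
    have : ∀ x, Real.exp (A.indicator (fun _ => K) x)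
        = 1 + A.indicator (fun _ => Real.exp K - 1) x := fun x => by
      by_cases hx : x ∈ A <;> simp [hx]
    simp_rw [this]
    rw [integral_add (integrable_const _) ((integrable_const _).indicator hA),
      integral_indicator_const _ hA]
    simp
  rw [e] at h
  have h1 : μ.real A * (Real.exp K - 1) < 1 := by
    calc μ.real A * (Real.exp K - 1) ≤ 1 / Real.exp K * (Real.exp K - 1) := by
          gcongr
      _ < 1 := by
          rw [div_mul_eq_mul_div, div_lt_one (Real.exp_pos _)]; linarith
  have h2 : Real.log (1 + μ.real A * (Real.exp K - 1)) < 1 := by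
    have h3 := Real.log_le_sub_one_of_pos (x := 1 + μ.real A * (Real.exp K - 1))
      (by have : 0 ≤ μ.real A * (Real.exp K - 1) :=
            mul_nonneg measureReal_nonneg (by linarith)
          linarith)
    linarith
  have h4 : ρ.real A * K < |M| + 1 := by
    rw [smul_eq_mul] at h
    linarith [le_abs_self M]
  have h5 : |M| + 1 = ε * K := by rw [hK]; field_simp
  rw [h5] at h4
  exact lt_of_mul_lt_mul_right h4 hK0.le

end KLTools

/-! ### A compactness principle for densities of bounded entropy -/

section Compactness

variable {α : Type*} [MeasurableSpace α]

lemma quarter_sq_sqrt_sub_le_klFun {a b : ℝ} (ha : 0 ≤ a) (hb : 0 ≤ b) :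
    (√a - √b) ^ 2 / 4 ≤ klFun a / 2 + klFun b / 2 - klFun ((a + b) / 2) := by
  have hm : 0 ≤ (a + b) / 2 := by positivity
  obtain ⟨x, hx, hxa⟩ : ∃ y : ℝ, 0 ≤ y ∧ a = y ^ 2 := ⟨√a, Real.sqrt_nonneg _, (Real.sq_sqrt ha).symm⟩
  obtain ⟨y, hy, hyb⟩ : ∃ y : ℝ, 0 ≤ y ∧ b = y ^ 2 := ⟨√b, Real.sqrt_nonneg _, (Real.sq_sqrt hb).symm⟩
  obtain ⟨z, hz, hzm⟩ : ∃ y : ℝ, 0 ≤ y ∧ (a + b) / 2 = y ^ 2 :=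
    ⟨√((a + b) / 2), Real.sqrt_nonneg _, (Real.sq_sqrt hm).symm⟩
  have key : ∀ u : ℝ, 0 ≤ u → u ^ 2 ≤ 2 * z ^ 2 →
      2 * u ^ 2 - 2 * u * z ≤ u ^ 2 * (Real.log (u ^ 2) - Real.log (z ^ 2)) := by
    intro u hu huz
    rcases hu.eq_or_lt with rfl | hu'
    · simp
    have hz' : 0 < z := by
      rcases hz.eq_or_lt with rfl | h
      · nlinarith
      · exact h
    have h1 := Real.one_sub_inv_le_log_of_pos (x := u / z) (by positivity)
    rw [Real.log_div hu'.ne' hz'.ne', inv_div] at h1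
    rw [Real.log_pow, Real.log_pow]
    push_cast
    have h2 : u ^ 2 * (1 - z / u) = u ^ 2 - u * z := by field_simp
    have h3 := mul_le_mul_of_nonneg_left h1 (sq_nonneg u)
    linarith
  have kx := key x hx (by nlinarith [sq_nonneg y])
  have ky := key y hy (by nlinarith [sq_nonneg x])
  rw [klFun_apply, klFun_apply, klFun_apply, hzm, hxa, hyb, Real.sqrt_sq hx, Real.sqrt_sq hy]
  have e : z ^ 2 = (x ^ 2 + y ^ 2) / 2 := by rw [← hzm, hxa, hyb]
  have e2 : z ^ 2 * Real.log (z ^ 2) = (x ^ 2 + y ^ 2) / 2 * Real.log (z ^ 2) := by rw [← e]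
  nlinarith [sq_nonneg (x + y - 2 * z)]

/-- A family of densities used as constraints in entropy minimization. -/
structure IsEntropyDensity (μ : Measure α) (f : α → ℝ) : Prop where
  meas : Measurable f
  nonneg : ∀ x, 0 ≤ f x
  integrable : Integrable f μ
  integral_eq : ∫ x, f x ∂μ = 1
  integrable_klFun : Integrable (fun x => klFun (f x)) μ

lemma IsEntropyDensity.integral_abs_sub_le {μ : Measure α} {f g : α → ℝ}
    (hf : IsEntropyDensity μ f) (hg : IsEntropyDensity μ g)
    (hm : IsEntropyDensity μ fun x => (f x + g x) / 2) {ε : ℝ} (hε : 0 < ε) :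
    ∫ x, |f x - g x| ∂μ ≤ (2 / ε) * ((∫ x, klFun (f x) ∂μ) / 2 + (∫ x, klFun (g x) ∂μ) / 2 -
      ∫ x, klFun ((f x + g x) / 2) ∂μ) + ε * 2 := by
  have i1 := (hf.integrable_klFun.div_const 2).add (hg.integrable_klFun.div_const 2)
  have i2 := i1.sub hm.integrable_klFun
  have i3 : Integrable (fun x => f x + g x) μ := hf.integrable.add hg.integrable
  calc ∫ x, |f x - g x| ∂μ
      ≤ ∫ x, ((2 / ε) * (klFun (f x) / 2 + klFun (g x) / 2 - klFun ((f x + g x) / 2))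
          + ε * (f x + g x)) ∂μ := by
        refine integral_mono (hf.integrable.sub hg.integrable).abs
          ((i2.const_mul _).add (i3.const_mul _)) fun x => ?_
        have h1 := abs_sub_le_sqrt_sub_sq (hf.nonneg x) (hg.nonneg x) hε
        have h2 := quarter_sq_sqrt_sub_le_klFun (hf.nonneg x) (hg.nonneg x)
        have h3 : (√(f x) - √(g x)) ^ 2 / (2 * ε) = (2 / ε) * ((√(f x) - √(g x)) ^ 2 / 4) := by
          field_simp; norm_num
        have h4 := mul_le_mul_of_nonneg_left h2 (by positivity : 0 ≤ 2 / ε)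
        simp only
        linarith
    _ = _ := by
        have e1 := integral_add (i2.const_mul (2 / ε)) (i3.const_mul ε)
        have e2 := integral_sub i1 hm.integrable_klFun
        have e3 := integral_add (hf.integrable_klFun.div_const 2) (hg.integrable_klFun.div_const 2)
        have e4 := integral_add hf.integrable hg.integrable
        simp only [integral_const_mul, Pi.sub_apply, Pi.add_apply, integral_div] at e1 e2 e3 e4 ⊢
        rw [e1, e2, e3, e4, hf.integral_eq, hg.integral_eq]
        norm_num

/-- In a decreasing sequence of midpoint-convex sets of densities with entropies tending to at
most `M`, one can choose elements converging in `L¹` to a density of entropy at most `M`. -/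
lemma exists_tendsto_of_antitone_midpoint {μ : Measure α} [IsProbabilityMeasure μ]
    {S : ℕ → Set (α → ℝ)} {M : ℝ} (hanti : Antitone S) (hne : ∀ n, (S n).Nonempty)
    (hmid : ∀ n, ∀ f ∈ S n, ∀ g ∈ S n, (fun x => (f x + g x) / 2) ∈ S n)
    (hS : ∀ n, ∀ f ∈ S n, IsEntropyDensity μ f)
    (hM : ∀ n, ∀ f ∈ S n, ∫ x, klFun (f x) ∂μ ≤ M + 1 / ((n : ℝ) + 1)) :
    ∃ (F : ℕ → α → ℝ) (f : α → ℝ), (∀ n, F n ∈ S n) ∧ IsEntropyDensity μ f ∧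
      Tendsto (fun n => ∫ x, |F n x - f x| ∂μ) atTop (𝓝 0) ∧ ∫ x, klFun (f x) ∂μ ≤ M := by
  set J : (α → ℝ) → ℝ := fun f => ∫ x, klFun (f x) ∂μ with hJ
  have hJ0 : ∀ n, ∀ f ∈ S n, 0 ≤ J f := fun n f hf =>
    integral_nonneg fun x => klFun_nonneg ((hS n f hf).nonneg x)
  have hbdd : ∀ n, BddBelow (J '' S n) := fun n => ⟨0, by rintro _ ⟨f, hf, rfl⟩; exact hJ0 n f hf⟩
  set I : ℕ → ℝ := fun n => sInf (J '' S n) with hI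
  have hIle : ∀ n, ∀ f ∈ S n, I n ≤ J f := fun n f hf => csInf_le (hbdd n) ⟨f, hf, rfl⟩
  have hImono : Monotone I := fun m n hmn =>
    csInf_le_csInf (hbdd m) ((hne n).image J) (Set.image_mono (hanti hmn))
  have hIbdd : BddAbove (Set.range I) := by
    refine ⟨M + 1, ?_⟩
    rintro _ ⟨n, rfl⟩
    obtain ⟨f, hf⟩ := hne n
    refine (hIle n f hf).trans ((hM n f hf).trans ?_)
    have : 1 / ((n : ℝ) + 1) ≤ 1 := by
      rw [div_le_one (by positivity)]; linarith [n.cast_nonneg (α := ℝ)]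
    linarith
  have hIlim := tendsto_atTop_ciSup hImono hIbdd
  have hch : ∀ n : ℕ, ∃ f ∈ S n, J f < I n + 1 / ((n : ℝ) + 1) := by
    intro n
    obtain ⟨_, ⟨f, hf, rfl⟩, hlt⟩ := exists_lt_of_csInf_lt ((hne n).image J)
      (show sInf (J '' S n) < I n + 1 / ((n : ℝ) + 1) by
        have : 0 < 1 / ((n : ℝ) + 1) := by positivity
        simp only [hI]; linarith)
    exact ⟨f, hf, hlt⟩
  choose F hFS hFJ using hch
  have hF := fun n => hS n (F n) (hFS n)
  have hdist : ∀ ε : ℝ, 0 < ε → ∃ N, ∀ n ≥ N, ∀ m ≥ n, ∫ x, |F n x - F m x| ∂μ < ε := by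
    intro ε hε
    have ht : Tendsto (fun n : ℕ => (2 / (ε / 4)) * (((⨆ i, I i) - I n) / 2 + 1 / ((n : ℝ) + 1))
        + (ε / 4) * 2) atTop (𝓝 ((2 / (ε / 4)) * (((⨆ i, I i) - ⨆ i, I i) / 2 + 0) + (ε / 4) * 2)) :=
      ((((tendsto_const_nhds.sub hIlim).div_const 2).add
        tendsto_one_div_add_atTop_nhds_zero_nat).const_mul _).add tendsto_const_nhds
    have hlt : (2 / (ε / 4)) * (((⨆ i, I i) - ⨆ i, I i) / 2 + 0) + (ε / 4) * 2 < ε := by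
      simp only [sub_self, zero_div, add_zero, mul_zero, zero_add]; linarith
    obtain ⟨N, hN⟩ := eventually_atTop.1 (ht.eventually (gt_mem_nhds hlt))
    refine ⟨N, fun n hn m hm => (lt_of_le_of_lt ?_ (hN n hn))⟩
    have hFm := hanti hm (hFS m)
    have hmd := hmid n _ (hFS n) _ hFm
    refine ((hF n).integral_abs_sub_le (hF m) (hS n _ hmd) (ε := ε / 4) (by positivity)).trans ?_
    have h1 := hIle n _ hmd
    have h2 := hFJ n
    have h3 := hFJ m
    have h4 : I m ≤ ⨆ i, I i := le_ciSup hIbdd m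
    have h5 : 1 / ((m : ℝ) + 1) ≤ 1 / ((n : ℝ) + 1) := by
      have : (n : ℝ) ≤ m := by exact_mod_cast hm
      gcongr
    simp only [hJ] at h1 h2 h3
    gcongr
    linarith
  have hcau : CauchySeq fun n => (hF n).integrable.toL1 (F n) := by
    refine Metric.cauchySeq_iff'.2 fun ε hε => ?_
    obtain ⟨N, hN⟩ := hdist ε hε
    refine ⟨N, fun n hn => ?_⟩
    rw [dist_comm, dist_eq_norm, ← Integrable.toL1_sub, L1.norm_of_fun_eq_integral_norm]
    exact hN N le_rfl n hn
  obtain ⟨f0, hf0⟩ := cauchySeq_tendsto_of_complete hcau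
  have hf0i : Integrable f0 μ := L1.integrable_coeFn f0
  have hlim0 : Tendsto (fun n => ∫ x, |F n x - f0 x| ∂μ) atTop (𝓝 0) := by
    rw [tendsto_iff_dist_tendsto_zero] at hf0
    refine hf0.congr fun n => ?_
    rw [dist_eq_norm, L1.norm_eq_integral_norm]
    refine integral_congr_ae ?_
    filter_upwards [Lp.coeFn_sub ((hF n).integrable.toL1 (F n)) f0,
      (hF n).integrable.coeFn_toL1] with x h1 h2
    rw [h1, Pi.sub_apply, h2, Real.norm_eq_abs]
  set g := hf0i.aestronglyMeasurable.mk f0 with hg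
  have hgm : Measurable g := hf0i.aestronglyMeasurable.measurable_mk
  have hgae : f0 =ᵐ[μ] g := hf0i.aestronglyMeasurable.ae_eq_mk
  set f : α → ℝ := fun x => max (g x) 0 with hf
  have hgi : Integrable g μ := hf0i.congr hgae
  have hfi : Integrable f μ := hgi.sup (integrable_const 0)
  have hlim : Tendsto (fun n => ∫ x, |F n x - f x| ∂μ) atTop (𝓝 0) := by
    refine squeeze_zero (fun n => integral_nonneg fun x => abs_nonneg _) (fun n => ?_) hlim0
    refine integral_mono_ae ((hF n).integrable.sub hfi).abs ((hF n).integrable.sub hf0i).abs ?_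
    filter_upwards [hgae] with x hx
    simp only [hf]
    rw [hx]
    have := (hF n).nonneg x
    rcases le_total (g x) 0 with h | h
    · rw [max_eq_right h, sub_zero, abs_of_nonneg this, abs_of_nonneg] <;> linarith
    · rw [max_eq_left h]
  have hint1 : ∫ x, f x ∂μ = 1 := by
    have h1 : ∀ n, |1 - ∫ x, f x ∂μ| ≤ ∫ x, |F n x - f x| ∂μ := fun n => by
      rw [← (hF n).integral_eq, ← integral_sub (hF n).integrable hfi]
      exact abs_integral_le_integral_abs
    have h2 := ge_of_tendsto' hlim h1
    have := abs_nonpos_iff.1 h2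
    linarith
  -- a.e. convergence along a subsequence
  have hae : ∃ ns : ℕ → ℕ, StrictMono ns ∧ ∀ᵐ x ∂μ, Tendsto (fun i => F (ns i) x) atTop (𝓝 (f x)) := by
    have hL : Tendsto (fun n => eLpNorm (F n - f) 1 μ) atTop (𝓝 0) := by
      have : ∀ n, eLpNorm (F n - f) 1 μ = ENNReal.ofReal (∫ x, |F n x - f x| ∂μ) := fun n => by
        rw [eLpNorm_one_eq_lintegral_enorm, ← ofReal_integral_norm_eq_lintegral_enorm
          ((hF n).integrable.sub hfi)]
        rfl
      simp_rw [this]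
      simpa using ENNReal.tendsto_ofReal hlim
    exact (tendstoInMeasure_of_tendsto_eLpNorm one_ne_zero
      (fun n => (hF n).meas.aestronglyMeasurable) hfi.aestronglyMeasurable hL).exists_seq_tendsto_ae
  obtain ⟨ns, hns, hnae⟩ := hae
  have hfat : ∫⁻ x, ENNReal.ofReal (klFun (f x)) ∂μ ≤ ENNReal.ofReal M := by
    have h1 : ∫⁻ x, ENNReal.ofReal (klFun (f x)) ∂μ
        ≤ liminf (fun i => ∫⁻ x, ENNReal.ofReal (klFun (F (ns i) x)) ∂μ) atTop := by
      refine le_trans (lintegral_mono_ae ?_) (lintegral_liminf_le fun i =>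
        (measurable_klFun.comp (hF (ns i)).meas).ennreal_ofReal)
      filter_upwards [hnae] with x hx
      exact (ENNReal.tendsto_ofReal ((continuous_klFun.tendsto _).comp hx)).liminf_eq.ge
    refine h1.trans ?_
    have h2 : ∀ i, ∫⁻ x, ENNReal.ofReal (klFun (F (ns i) x)) ∂μ
        ≤ ENNReal.ofReal (M + 1 / ((ns i : ℝ) + 1)) := fun i => by
      rw [← ofReal_integral_eq_lintegral_ofReal (hF (ns i)).integrable_klFun
        (ae_of_all _ fun x => klFun_nonneg ((hF (ns i)).nonneg x))]
      exact ENNReal.ofReal_le_ofReal (hM _ _ (hFS _))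
    have h3 : Tendsto (fun i => ENNReal.ofReal (M + 1 / ((ns i : ℝ) + 1))) atTop
        (𝓝 (ENNReal.ofReal M)) := by
      refine ENNReal.tendsto_ofReal ?_
      simpa using tendsto_const_nhds (x := M).add
        (tendsto_one_div_add_atTop_nhds_zero_nat.comp hns.tendsto_atTop)
    exact (liminf_le_liminf (Eventually.of_forall h2)).trans h3.liminf_eq.le
  have hkf : Integrable (fun x => klFun (f x)) μ := by
    have hfm : Measurable f := hgm.max measurable_const
    refine ⟨(measurable_klFun.comp hfm).aestronglyMeasurable, ?_⟩
    rw [hasFiniteIntegral_iff_ofReal (ae_of_all _ fun x => klFun_nonneg (le_max_right _ _))]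
    exact hfat.trans_lt ENNReal.ofReal_lt_top
  have hM0 : 0 ≤ M := by
    refine ge_of_tendsto' (f := fun n : ℕ => M + 1 / ((n : ℝ) + 1)) (x := atTop) ?_
      (fun n => (hJ0 n _ (hFS n)).trans (hM n _ (hFS n)))
    simpa using tendsto_const_nhds (x := M).add tendsto_one_div_add_atTop_nhds_zero_nat
  refine ⟨F, f, hFS, ⟨hgm.max measurable_const, fun x => le_max_right _ _, hfi, hint1, hkf⟩,
    hlim, ?_⟩
  rw [← ofReal_integral_eq_lintegral_ofReal hkf
    (ae_of_all _ fun x => klFun_nonneg (le_max_right _ _))] at hfat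
  exact (ENNReal.ofReal_le_ofReal_iff hM0).1 hfat

end Compactness

/-! ### Inversion densities -/

section Inversions

/-- The points forming an inversion with `z`. -/
def discordant (z : Ω2) : Set Ω2 := {w | (z.1 < w.1 ∧ w.2 < z.2) ∨ (w.1 < z.1 ∧ z.2 < w.2)}

/-- The mass of the set of points forming an inversion with `z`. -/
def discMass (ν : Measure Ω2) (z : Ω2) : ℝ := ν.real (discordant z)

/-- The probability that independent points with laws `ν` and `ρ` form an inversion. -/
def discPair (ν ρ : Measure Ω2) : ℝ := ∫ z, discMass ν z ∂ρ

lemma mem_discordant_comm {z w : Ω2} : w ∈ discordant z ↔ z ∈ discordant w := by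
  simp only [discordant, Set.mem_ofPred_eq]
  tauto

lemma measurableSet_discordantPairs : MeasurableSet {p : Ω2 × Ω2 | p.2 ∈ discordant p.1} := by
  have h : ∀ f g : Ω2 × Ω2 → ℝ, Measurable f → Measurable g → MeasurableSet {p | f p < g p} :=
    fun f g hf hg => measurableSet_lt hf hg
  exact ((h (fun p => p.1.1) (fun p => p.2.1) (by fun_prop) (by fun_prop)).inter
    (h (fun p => p.2.2) (fun p => p.1.2) (by fun_prop) (by fun_prop))).union
    ((h (fun p => p.2.1) (fun p => p.1.1) (by fun_prop) (by fun_prop)).inter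
    (h (fun p => p.1.2) (fun p => p.2.2) (by fun_prop) (by fun_prop)))

lemma measurableSet_discordant (z : Ω2) : MeasurableSet (discordant z) :=
  measurable_prodMk_left measurableSet_discordantPairs

lemma measurable_discMass (ν : Measure Ω2) [SFinite ν] : Measurable (discMass ν) :=
  (measurable_measure_prodMk_left (ν := ν) measurableSet_discordantPairs).ennreal_toReal

lemma discMass_nonneg (ν : Measure Ω2) (z : Ω2) : 0 ≤ discMass ν z := measureReal_nonneg

lemma discMass_le_one (ν : Measure Ω2) [IsProbabilityMeasure ν] (z : Ω2) : discMass ν z ≤ 1 :=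
  measureReal_le_one

lemma abs_discMass_le_one (ν : Measure Ω2) [IsProbabilityMeasure ν] (z : Ω2) :
    |discMass ν z| ≤ 1 := by
  rw [abs_of_nonneg (discMass_nonneg _ _)]; exact discMass_le_one ν z

lemma integrable_discMass (ν ρ : Measure Ω2) [IsProbabilityMeasure ν] [IsFiniteMeasure ρ] :
    Integrable (discMass ν) ρ :=
  integrable_of_abs_le (measurable_discMass ν) (abs_discMass_le_one ν)

lemma discPair_eq_prod (ν ρ : Measure Ω2) [IsProbabilityMeasure ν] [IsProbabilityMeasure ρ] :
    discPair ν ρ = (ρ.prod ν).real {p : Ω2 × Ω2 | p.2 ∈ discordant p.1} := by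
  rw [Measure.real, Measure.prod_apply measurableSet_discordantPairs, discPair]
  simp only [discMass, Measure.real]
  rw [integral_toReal]
  · rfl
  · exact (measurable_measure_prodMk_left (ν := ν) measurableSet_discordantPairs).aemeasurable
  · exact ae_of_all _ fun z => measure_lt_top _ _

lemma discPair_comm (ν ρ : Measure Ω2) [IsProbabilityMeasure ν] [IsProbabilityMeasure ρ] :
    discPair ν ρ = discPair ρ ν := by
  rw [discPair_eq_prod, discPair_eq_prod, ← Measure.prod_swap, Measure.real, Measure.real,
    Measure.map_apply measurable_swap measurableSet_discordantPairs]
  congr 2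
  ext p
  simp only [Set.mem_preimage, Set.mem_ofPred_eq, Prod.fst_swap, Prod.snd_swap]
  exact mem_discordant_comm

lemma discPair_nonneg (ν ρ : Measure Ω2) : 0 ≤ discPair ν ρ :=
  integral_nonneg fun z => discMass_nonneg ν z

lemma discPair_le_one (ν ρ : Measure Ω2) [IsProbabilityMeasure ν] [IsProbabilityMeasure ρ] :
    discPair ν ρ ≤ 1 := by
  rw [discPair_eq_prod]; exact measureReal_le_one

lemma hPat_inv2 (z : Fin 2 → Ω2) :
    hPat inv2 z = (discordant (z 0)).indicator (fun _ => (1 : ℝ)) (z 1) := by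
  classical
  have key : (∃ τ : Equiv.Perm (Fin 2),
      StrictMono (fun i => (z (τ i)).1) ∧ StrictMono (fun i => (z (τ (inv2⁻¹ i))).2)) ↔
      z 1 ∈ discordant (z 0) := by
    simp only [Fin.strictMono_iff_lt_succ, discordant, Set.mem_ofPred_eq]
    constructor
    · rintro ⟨τ, h1, h2⟩
      have h1 := h1 0
      have h2 := h2 0
      rcases (by decide : ∀ τ : Equiv.Perm (Fin 2), τ = 1 ∨ τ = Equiv.swap 0 1) τ with rfl | rfl <;> simp [inv2] at h1 h2 <;> tauto
    · rintro (⟨h1, h2⟩ | ⟨h1, h2⟩)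
      · refine ⟨1, fun i => ?_, fun i => ?_⟩ <;> fin_cases i <;> simpa [inv2]
      · refine ⟨Equiv.swap 0 1, fun i => ?_, fun i => ?_⟩ <;> fin_cases i <;> simpa [inv2]
  rw [hPat, Set.indicator_apply]
  simp only [key]

lemma tPat_inv2 (ν : Measure Ω2) [IsProbabilityMeasure ν] : tPat inv2 ν = discPair ν ν := by
  rw [tPat, discPair_eq_prod, ← integral_indicator_one measurableSet_discordantPairs,
    ← (measurePreserving_finTwoArrow ν).integral_comp (MeasurableEquiv.measurableEmbedding _)]
  refine integral_congr_ae (ae_of_all _ fun z => ?_)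
  simp only [hPat_inv2]
  simp [MeasurableEquiv.finTwoArrow]
  rfl

lemma integral_hPat_inv2_cons (μ : Measure Ω2) [IsProbabilityMeasure μ] (z : Ω2) :
    ∫ w : Fin 1 → Ω2, hPat inv2 (Fin.cons z w : Fin 2 → Ω2) ∂pmeas μ 1 = discMass μ z := by
  rw [pmeas, discMass, ← integral_indicator_one (measurableSet_discordant z),
    ← (measurePreserving_funUnique μ (Fin 1)).integral_comp (MeasurableEquiv.measurableEmbedding _)]
  refine integral_congr_ae (ae_of_all _ fun w => ?_)
  simp only [hPat_inv2]
  simp [MeasurableEquiv.funUnique]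
  rfl

lemma isCC_inv2_iff (μ : Measure Ω2) [IsProbabilityMeasure μ] :
    IsCC (k := 1) inv2 μ ↔ ∃ c ∈ Set.Icc (0 : ℝ) 1, ∀ᵐ z ∂μ, discMass μ z = c := by
  simp only [IsCC, integral_hPat_inv2_cons]

/-- The convex combination `(1 - s) ν + s ρ`. -/
def mixM (s : ℝ) (ν ρ : Measure Ω2) : Measure Ω2 :=
  ENNReal.ofReal (1 - s) • ν + ENNReal.ofReal s • ρ

section Mix

variable {s : ℝ} (ν ρ : Measure Ω2)

lemma integral_mixM (h0 : 0 ≤ s) (h1 : s ≤ 1) {f : Ω2 → ℝ} (hν : Integrable f ν)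
    (hρ : Integrable f ρ) :
    ∫ x, f x ∂(mixM s ν ρ) = (1 - s) * ∫ x, f x ∂ν + s * ∫ x, f x ∂ρ := by
  rw [mixM, integral_add_measure (hν.smul_measure (by simp)) (hρ.smul_measure (by simp)),
    integral_smul_measure, integral_smul_measure, ENNReal.toReal_ofReal (by linarith),
    ENNReal.toReal_ofReal h0]
  rfl

variable [IsProbabilityMeasure ν] [IsProbabilityMeasure ρ]

lemma isProbabilityMeasure_mixM (h0 : 0 ≤ s) (h1 : s ≤ 1) : IsProbabilityMeasure (mixM s ν ρ) := by
  refine ⟨?_⟩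
  simp only [mixM, Measure.add_apply, Measure.smul_apply, measure_univ, smul_eq_mul, mul_one]
  rw [← ENNReal.ofReal_add (by linarith) h0]
  simp

lemma discPair_mixM (h0 : 0 ≤ s) (h1 : s ≤ 1) :
    discPair (mixM s ν ρ) (mixM s ν ρ) =
      (1 - s) ^ 2 * discPair ν ν + 2 * s * (1 - s) * discPair ν ρ + s ^ 2 * discPair ρ ρ := by
  have := isProbabilityMeasure_mixM ν ρ h0 h1
  have h : ∀ τ : Measure Ω2, IsProbabilityMeasure τ →
      discPair τ (mixM s ν ρ) = (1 - s) * discPair τ ν + s * discPair τ ρ := fun τ _ =>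
    integral_mixM ν ρ h0 h1 (integrable_discMass _ _) (integrable_discMass _ _)
  rw [h _ this, discPair_comm _ ν, discPair_comm _ ρ, h _ ‹_›, h _ ‹_›, discPair_comm ρ ν]
  ring

lemma klDiv_mixM {μ : Measure Ω2} [IsProbabilityMeasure μ] (h0 : 0 ≤ s) (h1 : s ≤ 1)
    (hν : klDiv ν μ ≠ ∞) (hρ : klDiv ρ μ ≠ ∞) :
    klDiv (mixM s ν ρ) μ ≠ ∞ ∧ (klDiv (mixM s ν ρ) μ).toReal ≤
      (1 - s) * (klDiv ν μ).toReal + s * (klDiv ρ μ).toReal := by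
  have h := klDiv_mix_le (klDiv_ne_top_iff.1 hν).1 (klDiv_ne_top_iff.1 hρ).1 h0 h1
  have a1 : ENNReal.ofReal (1 - s) * klDiv ν μ ≠ ∞ := ENNReal.mul_ne_top (by simp) hν
  have a2 : ENNReal.ofReal s * klDiv ρ μ ≠ ∞ := ENNReal.mul_ne_top (by simp) hρ
  refine ⟨(h.trans_lt (ENNReal.add_lt_top.2 ⟨a1.lt_top, a2.lt_top⟩)).ne, ?_⟩
  have h' := ENNReal.toReal_mono (ENNReal.add_ne_top.2 ⟨a1, a2⟩) h
  rwa [ENNReal.toReal_add a1 a2, ENNReal.toReal_mul, ENNReal.toReal_mul,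
    ENNReal.toReal_ofReal (by linarith), ENNReal.toReal_ofReal h0] at h'

end Mix

/-- Reference measures on the unit square with marginals dominated by Lebesgue measure. -/
structure IsBase (μ : Measure Ω2) : Prop where
  prob : IsProbabilityMeasure μ
  supp : μ unitSqᶜ = 0
  stripX : ∀ a b : ℝ, μ {p | a ≤ p.1 ∧ p.1 ≤ b} ≤ ENNReal.ofReal (b - a)
  stripY : ∀ a b : ℝ, μ {p | a ≤ p.2 ∧ p.2 ≤ b} ≤ ENNReal.ofReal (b - a)

lemma measurableSet_unitSq : MeasurableSet unitSq := measurableSet_Icc.prod measurableSet_Icc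

lemma IsBase.mem_Mcal {μ : Measure Ω2} (hμ : IsBase μ) (ν : ProbabilityMeasure Ω2)
    (h : (ν : Measure Ω2) ≪ μ) : ν ∈ Mcal := by
  refine ⟨?_, fun x => ?_, fun y => ?_⟩
  · exact (prob_compl_eq_zero_iff measurableSet_unitSq).1 (h hμ.supp)
  · rw [Measure.map_apply measurable_fst (measurableSet_singleton _)]
    refine h (le_antisymm ((measure_mono ?_).trans ((hμ.stripX x x).trans (by simp))) zero_le)
    rintro p rfl
    exact ⟨le_rfl, le_rfl⟩
  · rw [Measure.map_apply measurable_snd (measurableSet_singleton _)]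
    refine h (le_antisymm ((measure_mono ?_).trans ((hμ.stripY y y).trans (by simp))) zero_le)
    rintro p rfl
    exact ⟨le_rfl, le_rfl⟩

/-- `ν` minimizes the divergence from `μ` among measures of inversion density at least `δ`. -/
structure IsMinimizer (μ : Measure Ω2) (δ : ℝ) (ν : Measure Ω2) : Prop where
  prob : IsProbabilityMeasure ν
  ne_top : klDiv ν μ ≠ ∞
  le : δ ≤ discPair ν ν
  min : ∀ ρ : Measure Ω2, IsProbabilityMeasure ρ → klDiv ρ μ ≠ ∞ → δ ≤ discPair ρ ρ →
    (klDiv ν μ).toReal ≤ (klDiv ρ μ).toReal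

lemma IsBase.Gfun_ne_top_of {μ : Measure Ω2} (hμ : IsBase μ) {δ : ℝ} {ρ : Measure Ω2}
    [IsProbabilityMeasure ρ] (h : klDiv ρ μ ≠ ∞) (hδ : δ ≤ discPair ρ ρ) :
    Gfun inv2 μ δ ≠ ∞ := by
  have := hμ.prob
  have hle : Gfun inv2 μ δ ≤ klDiv ρ μ := by
    rw [← KL_eq_klDiv]
    exact iInf₂_le (⟨ρ, ‹_›⟩ : ProbabilityMeasure Ω2)
      ⟨hμ.mem_Mcal _ (klDiv_ne_top_iff.1 h).1, by rwa [ProbabilityMeasure.coe_mk, tPat_inv2]⟩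
  exact (hle.trans_lt h.lt_top).ne

lemma IsBase.mem_Gset_iff {μ : Measure Ω2} (hμ : IsBase μ) {δ : ℝ} (hfin : Gfun inv2 μ δ ≠ ∞)
    (ν : ProbabilityMeasure Ω2) : ν ∈ Gset inv2 μ δ ↔ IsMinimizer μ δ (ν : Measure Ω2) := by
  have := hμ.prob
  constructor
  · rintro ⟨⟨-, h2⟩, h3⟩
    rw [KL_eq_klDiv] at h3
    rw [tPat_inv2] at h2
    refine ⟨inferInstance, h3 ▸ hfin, h2, fun ρ hρ h h' => ?_⟩
    refine ENNReal.toReal_mono h ?_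
    rw [h3, ← KL_eq_klDiv]
    exact iInf₂_le (⟨ρ, ‹_›⟩ : ProbabilityMeasure Ω2)
      ⟨hμ.mem_Mcal _ (klDiv_ne_top_iff.1 h).1, by rwa [ProbabilityMeasure.coe_mk, tPat_inv2]⟩
  · intro h
    have hm := hμ.mem_Mcal ν (klDiv_ne_top_iff.1 h.ne_top).1
    have ht : δ ≤ tPat inv2 (ν : Measure Ω2) := by rw [tPat_inv2]; exact h.le
    refine ⟨⟨hm, ht⟩, le_antisymm ?_ (iInf₂_le ν ⟨hm, ht⟩)⟩
    refine le_iInf₂ fun ρ hρ => ?_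
    rw [KL_eq_klDiv, KL_eq_klDiv]
    by_cases hne : klDiv (ρ : Measure Ω2) μ = ∞
    · rw [hne]; exact le_top
    · refine (ENNReal.toReal_le_toReal h.ne_top hne).1 (h.min _ inferInstance hne ?_)
      rw [← tPat_inv2]; exact hρ.2

lemma IsMinimizer.mem_Gset {μ : Measure Ω2} (hμ : IsBase μ) {δ : ℝ} {ν : Measure Ω2}
    (h : IsMinimizer μ δ ν) : (⟨ν, h.prob⟩ : ProbabilityMeasure Ω2) ∈ Gset inv2 μ δ := by
  have := h.prob
  exact (hμ.mem_Gset_iff (hμ.Gfun_ne_top_of h.ne_top h.le) _).2 h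

end Inversions

/-! ### Existence of minimizers -/

section Existence

lemma IsEntropyDensity.withDensity {α : Type*} [MeasurableSpace α] {μ : Measure α}
    [IsProbabilityMeasure μ] {f : α → ℝ} (hf : IsEntropyDensity μ f) :
    IsProbabilityMeasure (μ.withDensity fun x => ENNReal.ofReal (f x)) ∧
    klDiv (μ.withDensity fun x => ENNReal.ofReal (f x)) μ ≠ ∞ ∧
    (klDiv (μ.withDensity fun x => ENNReal.ofReal (f x)) μ).toReal = ∫ x, klFun (f x) ∂μ ∧
    ∀ A, MeasurableSet A →
      (μ.withDensity fun x => ENNReal.ofReal (f x)).real A = ∫ x in A, f x ∂μ := by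
  set ν := μ.withDensity fun x => ENNReal.ofReal (f x) with hν
  have hreal : ∀ A, MeasurableSet A → ν A = ENNReal.ofReal (∫ x in A, f x ∂μ) := fun A hA => by
    rw [hν, withDensity_apply _ hA, ofReal_integral_eq_lintegral_ofReal hf.integrable.integrableOn
      (ae_of_all _ hf.nonneg)]
  have hp : IsProbabilityMeasure ν := ⟨by
    rw [hreal _ MeasurableSet.univ, setIntegral_univ, hf.integral_eq, ENNReal.ofReal_one]⟩
  have hac : ν ≪ μ := withDensity_absolutelyContinuous _ _
  have hrn : (fun x => klFun (ν.rnDeriv μ x).toReal) =ᵐ[μ] fun x => klFun (f x) := by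
    filter_upwards [Measure.rnDeriv_withDensity μ hf.meas.ennreal_ofReal] with x hx
    rw [hν, hx, ENNReal.toReal_ofReal (hf.nonneg x)]
  refine ⟨hp, ?_, ?_, fun A hA => ?_⟩
  · refine klDiv_ne_top hac ((integrable_klFun_rnDeriv_iff hac).1 ?_)
    exact (integrable_congr hrn).2 hf.integrable_klFun
  · rw [toReal_klDiv_eq_integral_klFun hac, integral_congr_ae hrn]
  · rw [Measure.real, hreal A hA, ENNReal.toReal_ofReal (integral_nonneg hf.nonneg)]

lemma isEntropyDensity_rnDeriv {α : Type*} [MeasurableSpace α] {μ ν : Measure α}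
    [IsProbabilityMeasure μ] [IsProbabilityMeasure ν] (h : klDiv ν μ ≠ ∞) :
    IsEntropyDensity μ (fun x => (ν.rnDeriv μ x).toReal) ∧
    (klDiv ν μ).toReal = ∫ x, klFun ((ν.rnDeriv μ x).toReal) ∂μ ∧
    ∀ A, ν.real A = ∫ x in A, (ν.rnDeriv μ x).toReal ∂μ := by
  obtain ⟨hac, hint⟩ := klDiv_ne_top_iff.1 h
  refine ⟨⟨(Measure.measurable_rnDeriv _ _).ennreal_toReal, fun x => ENNReal.toReal_nonneg,
    Measure.integrable_toReal_rnDeriv, ?_, (integrable_klFun_rnDeriv_iff hac).2 hint⟩,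
    toReal_klDiv_eq_integral_klFun hac, fun A => (Measure.setIntegral_toReal_rnDeriv hac A).symm⟩
  rw [Measure.integral_toReal_rnDeriv hac]; simp

lemma IsEntropyDensity.midpoint {α : Type*} [MeasurableSpace α] {μ : Measure α} {f g : α → ℝ}
    (hf : IsEntropyDensity μ f) (hg : IsEntropyDensity μ g) :
    IsEntropyDensity μ (fun x => (f x + g x) / 2) ∧
    ∫ x, klFun ((f x + g x) / 2) ∂μ ≤ ((∫ x, klFun (f x) ∂μ) + ∫ x, klFun (g x) ∂μ) / 2 := by
  have hle : ∀ x, klFun ((f x + g x) / 2) ≤ (klFun (f x) + klFun (g x)) / 2 := fun x => by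
    have := quarter_sq_sqrt_sub_le_klFun (hf.nonneg x) (hg.nonneg x)
    nlinarith [sq_nonneg (√(f x) - √(g x))]
  have hi : Integrable (fun x => (klFun (f x) + klFun (g x)) / 2) μ :=
    (hf.integrable_klFun.add hg.integrable_klFun).div_const 2
  have h0 : ∀ x, 0 ≤ (f x + g x) / 2 := fun x => by
    have := hf.nonneg x; have := hg.nonneg x; positivity
  have hm : Measurable (fun x => (f x + g x) / 2) := (hf.meas.add hg.meas).div_const 2
  have hmk : Integrable (fun x => klFun ((f x + g x) / 2)) μ := by
    refine hi.mono' (measurable_klFun.comp hm).aestronglyMeasurable (ae_of_all _ fun x => ?_)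
    rw [Real.norm_eq_abs, abs_of_nonneg (klFun_nonneg (h0 x))]
    exact hle x
  refine ⟨⟨hm, h0, (hf.integrable.add hg.integrable).div_const 2, ?_, hmk⟩, ?_⟩
  · rw [integral_div, integral_add hf.integrable hg.integrable, hf.integral_eq, hg.integral_eq]
    norm_num
  · refine (integral_mono hmk hi hle).trans_eq ?_
    rw [integral_div, integral_add hf.integrable_klFun hg.integrable_klFun]

lemma abs_discMass_sub_le (ν : Measure Ω2) [IsProbabilityMeasure ν] (z z' : Ω2) :
    |discMass ν z - discMass ν z'| ≤
      ν.real {p | min z.1 z'.1 ≤ p.1 ∧ p.1 ≤ max z.1 z'.1} +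
      ν.real {p | min z.2 z'.2 ≤ p.2 ∧ p.2 ≤ max z.2 z'.2} := by
  have key : ∀ u v : Ω2, discordant u ⊆ discordant v ∪
      ({p | min u.1 v.1 ≤ p.1 ∧ p.1 ≤ max u.1 v.1} ∪
        {p | min u.2 v.2 ≤ p.2 ∧ p.2 ≤ max u.2 v.2}) := by
    intro u v w hw
    by_contra hcon
    simp only [discordant, Set.mem_union, Set.mem_ofPred_eq, min_le_iff, le_max_iff, not_or,
      not_and, not_lt, not_le] at hw hcon
    grind
  have h2 : ∀ u v : Ω2, discMass ν u ≤ discMass ν v +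
      (ν.real {p | min u.1 v.1 ≤ p.1 ∧ p.1 ≤ max u.1 v.1} +
      ν.real {p | min u.2 v.2 ≤ p.2 ∧ p.2 ≤ max u.2 v.2}) := fun u v =>
    (measureReal_mono (key u v)).trans
      ((measureReal_union_le _ _).trans (add_le_add le_rfl (measureReal_union_le _ _)))
  have a := h2 z z'
  have b := h2 z' z
  rw [min_comm z'.1, max_comm z'.1, min_comm z'.2, max_comm z'.2] at b
  rw [abs_le]
  constructor <;> linarith

lemma IsBase.stripX_real {μ : Measure Ω2} (hμ : IsBase μ) (a b : ℝ) :
    μ.real {p | min a b ≤ p.1 ∧ p.1 ≤ max a b} ≤ |a - b| := by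
  rw [Measure.real, abs_sub_comm, ← max_sub_min_eq_abs]
  exact ENNReal.toReal_le_of_le_ofReal (sub_nonneg.2 min_le_max) (hμ.stripX _ _)

lemma IsBase.stripY_real {μ : Measure Ω2} (hμ : IsBase μ) (a b : ℝ) :
    μ.real {p | min a b ≤ p.2 ∧ p.2 ≤ max a b} ≤ |a - b| := by
  rw [Measure.real, abs_sub_comm, ← max_sub_min_eq_abs]
  exact ENNReal.toReal_le_of_le_ofReal (sub_nonneg.2 min_le_max) (hμ.stripY _ _)

lemma measurableSet_stripX (a b : ℝ) : MeasurableSet {p : Ω2 | a ≤ p.1 ∧ p.1 ≤ b} :=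
  (measurableSet_Icc (a := a) (b := b)).preimage measurable_fst

lemma measurableSet_stripY (a b : ℝ) : MeasurableSet {p : Ω2 | a ≤ p.2 ∧ p.2 ≤ b} :=
  (measurableSet_Icc (a := a) (b := b)).preimage measurable_snd

/-- The functions `discMass ρ` are equicontinuous for `ρ` of bounded divergence. -/
lemma IsBase.exists_modulus {μ : Measure Ω2} (hμ : IsBase μ) (M : ℝ) {ε : ℝ} (hε : 0 < ε) :
    ∃ η : ℝ, 0 < η ∧ ∀ ρ : Measure Ω2, IsProbabilityMeasure ρ → klDiv ρ μ ≠ ∞ →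
      (klDiv ρ μ).toReal ≤ M → ∀ z z' : Ω2, dist z z' < η →
        |discMass ρ z - discMass ρ z'| < ε := by
  have := hμ.prob
  obtain ⟨η, hη, h⟩ := exists_measureReal_lt_of_klDiv_le μ (M := M) (half_pos hε)
  refine ⟨η, hη, fun ρ hρ hne hM z z' hz => (abs_discMass_sub_le ρ z z').trans_lt ?_⟩
  rw [Prod.dist_eq, max_lt_iff, Real.dist_eq, Real.dist_eq] at hz
  have h1 := h ρ hρ hne hM _ (measurableSet_stripX (min z.1 z'.1) (max z.1 z'.1))
    ((hμ.stripX_real _ _).trans_lt hz.1)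
  have h2 := h ρ hρ hne hM _ (measurableSet_stripY (min z.2 z'.2) (max z.2 z'.2))
    ((hμ.stripY_real _ _).trans_lt hz.2)
  linarith

lemma IsBase.continuous_discMass {μ : Measure Ω2} (hμ : IsBase μ) {ρ : Measure Ω2}
    [IsProbabilityMeasure ρ] (h : klDiv ρ μ ≠ ∞) : Continuous (discMass ρ) := by
  rw [Metric.continuous_iff]
  intro z ε hε
  obtain ⟨η, hη, h'⟩ := hμ.exists_modulus (klDiv ρ μ).toReal hε
  exact ⟨η, hη, fun a ha => h' ρ ‹_› h le_rfl a z ha⟩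

/-- Pointwise convergence of `discMass`, with bounded divergences, implies convergence of the
inversion densities. -/
lemma tendsto_discPair_self {μ : Measure Ω2} [IsProbabilityMeasure μ] {ν : ℕ → Measure Ω2}
    {ρ : Measure Ω2} (hν : ∀ n, IsProbabilityMeasure (ν n)) [IsProbabilityMeasure ρ] {M : ℝ}
    (hne : ∀ n, klDiv (ν n) μ ≠ ∞) (hM : ∀ n, (klDiv (ν n) μ).toReal ≤ M)
    (hlim : ∀ z, Tendsto (fun n => discMass (ν n) z) atTop (𝓝 (discMass ρ z))) :
    Tendsto (fun n => discPair (ν n) (ν n)) atTop (𝓝 (discPair ρ ρ)) := by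
  have h1 : Tendsto (fun n => discPair ρ (ν n)) atTop (𝓝 (discPair ρ ρ)) := by
    have : ∀ n, discPair ρ (ν n) = ∫ z, discMass (ν n) z ∂ρ := fun n => discPair_comm _ _
    simp_rw [this]
    exact tendsto_integral_of_dominated_convergence (fun _ => 1)
      (fun n => (measurable_discMass _).aestronglyMeasurable) (integrable_const _)
      (fun n => ae_of_all _ (abs_discMass_le_one _)) (ae_of_all _ hlim)
  set g : ℕ → Ω2 → ℝ := fun n z => |discMass (ν n) z - discMass ρ z| with hg
  have hgm : ∀ n, Measurable (g n) := fun n =>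
    ((measurable_discMass _).sub (measurable_discMass _)).abs
  have hg1 : ∀ n z, g n z ≤ 1 := fun n z => by
    simp only [hg]
    rw [abs_le]
    constructor <;> linarith [discMass_nonneg (ν n) z, discMass_nonneg ρ z,
      discMass_le_one (ν n) z, discMass_le_one ρ z]
  have hg0 : ∀ n z, 0 ≤ g n z := fun n z => abs_nonneg _
  have h2 : Tendsto (fun n => ∫ z, g n z ∂(ν n)) atTop (𝓝 0) := by
    have hM0 : 0 ≤ M := ENNReal.toReal_nonneg.trans (hM 0)
    rw [Metric.tendsto_atTop]
    intro ε hε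
    set K := (M + 1) / ε with hK
    have hK0 : 0 < K := by positivity
    have hb : ∀ n z, |K * g n z| ≤ K := fun n z => by
      rw [abs_of_nonneg (mul_nonneg hK0.le (hg0 n z))]
      exact mul_le_of_le_one_right hK0.le (hg1 n z)
    have hexp : Tendsto (fun n => ∫ z, Real.exp (K * g n z) ∂μ) atTop (𝓝 (∫ z, (1 : ℝ) ∂μ)) := by
      refine tendsto_integral_of_dominated_convergence (fun _ => Real.exp K)
        (fun n => ((hgm n).const_mul K).exp.aestronglyMeasurable) (integrable_const _)
        (fun n => ae_of_all _ fun z => ?_) (ae_of_all _ fun z => ?_)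
      · rw [Real.norm_eq_abs, abs_of_pos (Real.exp_pos _), Real.exp_le_exp]
        exact (le_abs_self _).trans (hb n z)
      · have : Tendsto (fun n => g n z) atTop (𝓝 0) := by
          simpa [hg] using ((hlim z).sub_const (discMass ρ z)).abs
        have h := (Real.continuous_exp.tendsto _).comp (this.const_mul K)
        rw [mul_zero, Real.exp_zero] at h
        exact h
    have hlog : Tendsto (fun n => Real.log (∫ z, Real.exp (K * g n z) ∂μ)) atTop (𝓝 0) := by
      have := hexp.log (by simp)
      simpa using this
    obtain ⟨N, hN⟩ := eventually_atTop.1 (hlog.eventually (gt_mem_nhds one_pos))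
    refine ⟨N, fun n hn => ?_⟩
    rw [Real.dist_eq, sub_zero, abs_of_nonneg (integral_nonneg (hg0 n))]
    have := integral_sub_log_le_klDiv ((hgm n).const_mul K) (hb n) (hne n)
    rw [integral_const_mul] at this
    have h3 := hM n
    have h4 := hN n hn
    have h5 : K * ∫ z, g n z ∂(ν n) < K * ε := by
      have : K * ε = M + 1 := by rw [hK]; field_simp
      linarith
    exact lt_of_mul_lt_mul_left h5 hK0.le
  have h3 : Tendsto (fun n => discPair (ν n) (ν n) - discPair ρ (ν n)) atTop (𝓝 0) := by
    refine squeeze_zero_norm (fun n => ?_) h2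
    rw [discPair, discPair, ← integral_sub (integrable_discMass _ _) (integrable_discMass _ _)]
    exact norm_integral_le_integral_norm _
  simpa using h3.add h1

theorem IsBase.exists_isMinimizer {μ : Measure Ω2} (hμ : IsBase μ) {δ : ℝ} {ρ₀ : Measure Ω2}
    (hρ₀ : IsProbabilityMeasure ρ₀) (h₀ : klDiv ρ₀ μ ≠ ∞) (hδ₀ : δ ≤ discPair ρ₀ ρ₀) :
    ∃ ν, IsMinimizer μ δ ν := by
  have := hμ.prob
  set A : Set ℝ := {r | ∃ ρ : Measure Ω2, IsProbabilityMeasure ρ ∧ klDiv ρ μ ≠ ∞ ∧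
    δ ≤ discPair ρ ρ ∧ (klDiv ρ μ).toReal = r} with hA
  have hAne : A.Nonempty := ⟨_, ρ₀, hρ₀, h₀, hδ₀, rfl⟩
  have hAb : BddBelow A := ⟨0, by rintro _ ⟨ρ, -, -, -, rfl⟩; exact ENNReal.toReal_nonneg⟩
  set M := sInf A with hMdef
  have hch : ∀ n : ℕ, ∃ ρ : Measure Ω2, IsProbabilityMeasure ρ ∧ klDiv ρ μ ≠ ∞ ∧
      δ ≤ discPair ρ ρ ∧ (klDiv ρ μ).toReal < M + 1 / ((n : ℝ) + 1) := fun n => by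
    obtain ⟨_, ⟨ρ, h1, h2, h3, rfl⟩, hlt⟩ := exists_lt_of_csInf_lt hAne
      (show sInf A < M + 1 / ((n : ℝ) + 1) by
        have : 0 < 1 / ((n : ℝ) + 1) := by positivity
        linarith)
    exact ⟨ρ, h1, h2, h3, hlt⟩
  choose ν hνp hνne hνδ hνM using hch
  set q := TopologicalSpace.denseSeq Ω2
  obtain ⟨L, -, φ, hφ, hL⟩ := (isCompact_univ_pi fun _ : ℕ => isCompact_Icc (a := (0 : ℝ)) (b := 1)).tendsto_subseq
    (x := fun n i => discMass (ν n) (q i))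
    (fun n i _ => ⟨discMass_nonneg _ _, by have := hνp n; exact discMass_le_one _ _⟩)
  rw [tendsto_pi_nhds] at hL
  set S : ℕ → Set (Ω2 → ℝ) := fun n => {f | IsEntropyDensity μ f ∧
    ∫ x, klFun (f x) ∂μ ≤ M + 1 / ((n : ℝ) + 1) ∧
    ∀ i < n, |(∫ x in discordant (q i), f x ∂μ) - L i| ≤ 1 / ((n : ℝ) + 1)} with hS
  have hone : ∀ m n : ℕ, m ≤ n → 1 / ((n : ℝ) + 1) ≤ 1 / ((m : ℝ) + 1) := fun m n hmn => by
    have : (m : ℝ) ≤ n := by exact_mod_cast hmn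
    gcongr
  have hanti : Antitone S := by
    intro m n hmn f hf
    exact ⟨hf.1, hf.2.1.trans (add_le_add le_rfl (hone m n hmn)), fun i hi =>
      (hf.2.2 i (hi.trans_le hmn)).trans (hone m n hmn)⟩
  have hne : ∀ n, (S n).Nonempty := by
    intro n
    have hev : ∀ᶠ m in atTop, ∀ i < n, |discMass (ν (φ m)) (q i) - L i| ≤ 1 / ((n : ℝ) + 1) := by
      refine (Set.finite_lt_nat n).eventually_all.2 fun i _ => ?_
      have := ((hL i).sub_const (L i)).abs
      rw [sub_self, abs_zero] at this
      filter_upwards [this.eventually (gt_mem_nhds (show (0 : ℝ) < 1 / ((n : ℝ) + 1) by positivity))]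
        with m hm using hm.le
    obtain ⟨m, hm, hmn⟩ := (hev.and (eventually_ge_atTop n)).exists
    have := hνp (φ m)
    obtain ⟨e1, e2, e3⟩ := isEntropyDensity_rnDeriv (hνne (φ m))
    refine ⟨_, e1, ?_, fun i hi => ?_⟩
    · rw [← e2]
      exact (hνM _).le.trans (add_le_add le_rfl (hone _ _ (hmn.trans (hφ.id_le m))))
    · rw [← e3]; exact hm i hi
  obtain ⟨F, f, hFS, hf, hlim, hfM⟩ := exists_tendsto_of_antitone_midpoint hanti hne
    (fun n f hf g hg => by
      obtain ⟨m1, m2⟩ := hf.1.midpoint hg.1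
      refine ⟨m1, by linarith [hf.2.1, hg.2.1], fun i hi => ?_⟩
      rw [integral_div, integral_add hf.1.integrable.integrableOn hg.1.integrable.integrableOn]
      have a := abs_le.1 (hf.2.2 i hi)
      have b := abs_le.1 (hg.2.2 i hi)
      rw [abs_le]
      constructor <;> linarith) (fun n f hf => hf.1) (fun n f hf => hf.2.1)
  obtain ⟨hp, hk, hkM, hreal⟩ := hf.withDensity
  set ρ := μ.withDensity fun x => ENNReal.ofReal (f x)
  have hρq : ∀ i, discMass ρ (q i) = L i := by
    intro i
    rw [discMass, hreal _ (measurableSet_discordant _)]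
    have h1 : Tendsto (fun n => ∫ x in discordant (q i), F n x ∂μ) atTop
        (𝓝 (∫ x in discordant (q i), f x ∂μ)) := by
      rw [tendsto_iff_dist_tendsto_zero]
      refine squeeze_zero (fun n => dist_nonneg) (fun n => ?_) hlim
      rw [Real.dist_eq, ← integral_sub (hFS n).1.integrable.integrableOn hf.integrable.integrableOn]
      exact abs_integral_le_integral_abs.trans (setIntegral_le_integral
        ((hFS n).1.integrable.sub hf.integrable).abs (ae_of_all _ fun x => abs_nonneg _))
    have h2 : Tendsto (fun n => ∫ x in discordant (q i), F n x ∂μ) atTop (𝓝 (L i)) := by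
      rw [tendsto_iff_dist_tendsto_zero]
      refine squeeze_zero' (Eventually.of_forall fun n => dist_nonneg) ?_
        tendsto_one_div_add_atTop_nhds_zero_nat
      filter_upwards [eventually_gt_atTop i] with n hn
      exact (hFS n).2.2 i hn
    exact tendsto_nhds_unique h1 h2
  have hpt : ∀ z, Tendsto (fun m => discMass (ν (φ m)) z) atTop (𝓝 (discMass ρ z)) := by
    intro z
    rw [Metric.tendsto_atTop]
    intro ε hε
    obtain ⟨η, hη, hmod⟩ := hμ.exists_modulus (M + 1) (show 0 < ε / 3 by positivity)
    obtain ⟨i, hi⟩ := (TopologicalSpace.denseRange_denseSeq Ω2).exists_dist_lt z hη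
    obtain ⟨N, hN⟩ := Metric.tendsto_atTop.1 (hL i) (ε / 3) (by positivity)
    refine ⟨N, fun m hm => ?_⟩
    have h1 := hmod _ (hνp (φ m)) (hνne _) ((hνM (φ m)).le.trans (by
      have := hone 0 (φ m) (Nat.zero_le _)
      simp only [Nat.cast_zero, zero_add, div_one] at this
      linarith)) z (q i) hi
    have h2 := hmod ρ hp hk (by linarith) z (q i) hi
    have h3 := hN m hm
    rw [Real.dist_eq] at h3 ⊢
    simp only [Function.comp] at h3
    rw [hρq] at h2
    rw [abs_lt] at h1 h2 h3 ⊢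
    constructor <;> linarith
  have hT := tendsto_discPair_self (fun n => hνp (φ n)) (fun n => hνne (φ n))
    (fun n => (hνM (φ n)).le.trans (add_le_add le_rfl (hone 0 _ (Nat.zero_le _)))) hpt
  refine ⟨ρ, hp, hk, ge_of_tendsto' hT fun n => hνδ _, fun τ hτ hτk hτδ => ?_⟩
  rw [hkM]
  exact hfM.trans (csInf_le hAb ⟨τ, hτ, hτk, hτδ, rfl⟩)

end Existence

/-! ### The Euler–Lagrange equation and uniqueness criteria -/

section EulerLagrange

variable {μ ν : Measure Ω2} {δ : ℝ}

lemma IsMinimizer.toReal_klDiv_eq {ν' : Measure Ω2} (h : IsMinimizer μ δ ν)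
    (h' : IsMinimizer μ δ ν') : (klDiv ν μ).toReal = (klDiv ν' μ).toReal :=
  le_antisymm (h.min _ h'.prob h'.ne_top h'.le) (h'.min _ h.prob h.ne_top h.le)

lemma eq_of_toReal_klDiv_nonpos {ρ : Measure Ω2} [IsProbabilityMeasure ν] [IsProbabilityMeasure ρ]
    (hne : klDiv ρ ν ≠ ∞) (h : (klDiv ρ ν).toReal ≤ 0) : ρ = ν := by
  have h0 := le_antisymm h ENNReal.toReal_nonneg
  rw [ENNReal.toReal_eq_zero_iff, or_iff_left hne] at h0
  exact klDiv_eq_zero_iff.1 h0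

lemma IsMinimizer.discPair_self_eq [IsProbabilityMeasure μ] (h : IsMinimizer μ δ ν)
    (hδ : discPair μ μ < δ) : discPair ν ν = δ := by
  have := h.prob
  refine le_antisymm ?_ h.le
  by_contra! hlt
  have hδ0 : 0 < δ := (discPair_nonneg μ μ).trans_lt hδ
  have ht1 := discPair_le_one ν ν
  set s := (discPair ν ν - δ) / 2 with hs
  have hs0 : 0 < s := by rw [hs]; linarith
  have hs1 : s ≤ 1 := by rw [hs]; linarith
  obtain ⟨k1, k2⟩ := klDiv_mixM ν μ hs0.le hs1 h.ne_top (by simp)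
  have hm := isProbabilityMeasure_mixM ν μ hs0.le hs1
  have hd : δ ≤ discPair (mixM s ν μ) (mixM s ν μ) := by
    rw [discPair_mixM ν μ hs0.le hs1]
    have a1 : 0 ≤ 2 * s * (1 - s) * discPair ν μ :=
      mul_nonneg (mul_nonneg (by positivity) (by linarith)) (discPair_nonneg _ _)
    have a2 : 0 ≤ s ^ 2 * discPair μ μ := mul_nonneg (sq_nonneg _) (discPair_nonneg _ _)
    have a3 : δ ≤ (1 - s) ^ 2 * discPair ν ν := by
      have : δ = discPair ν ν - 2 * s := by rw [hs]; ring
      nlinarith [mul_nonneg (sq_nonneg s) (discPair_nonneg ν ν)]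
    linarith
  have hmin := h.min _ hm k1 hd
  rw [klDiv_self, ENNReal.toReal_zero, mul_zero, add_zero] at k2
  have h0 : (klDiv ν μ).toReal ≤ 0 := by
    by_contra! hc
    nlinarith
  rw [eq_of_toReal_klDiv_nonpos h.ne_top h0] at hlt
  linarith

lemma IsMinimizer.klDiv_le_of_lt [IsProbabilityMeasure μ] (h : IsMinimizer μ δ ν)
    {ρ : Measure Ω2} [IsProbabilityMeasure ρ] (hne : klDiv ρ μ ≠ ∞)
    (hρ : discPair ν ν < discPair ν ρ) : (klDiv ν μ).toReal ≤ (klDiv ρ μ).toReal := by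
  have := h.prob
  have ht0 := discPair_nonneg ν ν
  have hT1 := discPair_le_one ν ρ
  set s := discPair ν ρ - discPair ν ν with hs
  have hs0 : 0 < s := by rw [hs]; linarith
  have hs1 : s ≤ 1 := by rw [hs]; linarith
  obtain ⟨k1, k2⟩ := klDiv_mixM ν ρ hs0.le hs1 h.ne_top hne
  have hm := isProbabilityMeasure_mixM ν ρ hs0.le hs1
  have hd : δ ≤ discPair (mixM s ν ρ) (mixM s ν ρ) := by
    rw [discPair_mixM ν ρ hs0.le hs1]
    have a2 : 0 ≤ s ^ 2 * discPair ρ ρ := mul_nonneg (sq_nonneg _) (discPair_nonneg _ _)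
    have a3 : discPair ν ρ = discPair ν ν + s := by rw [hs]; ring
    have a4 : 0 ≤ s * (2 * s - 2 * s * discPair ν ρ + s * discPair ν ν) := by
      have : 2 * s * discPair ν ρ ≤ 2 * s := by nlinarith
      exact mul_nonneg hs0.le (by nlinarith)
    have := h.le
    nlinarith
  have hmin := h.min _ hm k1 hd
  by_contra! hc
  nlinarith

lemma IsMinimizer.klDiv_le_of_le [IsProbabilityMeasure μ] (h : IsMinimizer μ δ ν)
    {ρ₀ ρ : Measure Ω2} [IsProbabilityMeasure ρ₀] (hne₀ : klDiv ρ₀ μ ≠ ∞)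
    (hρ₀ : discPair ν ν < discPair ν ρ₀) [IsProbabilityMeasure ρ] (hne : klDiv ρ μ ≠ ∞)
    (hρ : discPair ν ν ≤ discPair ν ρ) : (klDiv ν μ).toReal ≤ (klDiv ρ μ).toReal := by
  have := h.prob
  have key : ∀ s : ℝ, 0 < s → s ≤ 1 →
      (klDiv ν μ).toReal ≤ (1 - s) * (klDiv ρ μ).toReal + s * (klDiv ρ₀ μ).toReal := by
    intro s h0 h1
    obtain ⟨k1, k2⟩ := klDiv_mixM ρ ρ₀ h0.le h1 hne hne₀
    have hm := isProbabilityMeasure_mixM ρ ρ₀ h0.le h1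
    refine (h.klDiv_le_of_lt k1 ?_).trans k2
    have : discPair ν (mixM s ρ ρ₀) = (1 - s) * discPair ν ρ + s * discPair ν ρ₀ :=
      integral_mixM ρ ρ₀ h0.le h1 (integrable_discMass _ _) (integrable_discMass _ _)
    rw [this]
    nlinarith
  have hlim : Tendsto (fun s : ℝ => (1 - s) * (klDiv ρ μ).toReal + s * (klDiv ρ₀ μ).toReal)
      (𝓝[>] 0) (𝓝 ((1 - 0) * (klDiv ρ μ).toReal + 0 * (klDiv ρ₀ μ).toReal)) := by
    have hc : Continuous (fun s : ℝ => (1 - s) * (klDiv ρ μ).toReal + s * (klDiv ρ₀ μ).toReal) := by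
      fun_prop
    exact (hc.tendsto 0).mono_left nhdsWithin_le_nhds
  rw [sub_zero, one_mul, zero_mul, add_zero] at hlim
  refine ge_of_tendsto hlim ?_
  filter_upwards [Ioo_mem_nhdsGT (zero_lt_one' ℝ)] with s hs using key s hs.1 hs.2.le

lemma continuousOn_integral_tilted [IsProbabilityMeasure μ] {k : Ω2 → ℝ} (hk : Measurable k)
    (hk1 : ∀ z, |k z| ≤ 1) (Θ : ℝ) :
    ContinuousOn (fun θ : ℝ => ∫ z, k z ∂(μ.tilted fun z => θ * k z)) (Set.Icc 0 Θ) := by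
  have e : ∀ θ : ℝ, ∫ z, k z ∂(μ.tilted fun z => θ * k z) =
      (∫ z, Real.exp (θ * k z) * k z ∂μ) / ∫ z, Real.exp (θ * k z) ∂μ := fun θ => by
    rw [integral_tilted, ← integral_div]
    refine integral_congr_ae (ae_of_all _ fun z => ?_)
    simp only [smul_eq_mul]; ring
  have hb : ∀ θ ∈ Set.Icc (0 : ℝ) Θ, ∀ z, Real.exp (θ * k z) ≤ Real.exp Θ := fun θ hθ z => by
    rw [Real.exp_le_exp]
    have h1 := (abs_le.1 (hk1 z)).2
    nlinarith [hθ.1, hθ.2]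
  simp_rw [e]
  refine ContinuousOn.div ?_ ?_ ?_
  · refine continuousOn_of_dominated (bound := fun _ => Real.exp Θ)
      (fun θ _ => by fun_prop) (fun θ hθ => ae_of_all _ fun z => ?_) (integrable_const _)
      (ae_of_all _ fun z => by fun_prop)
    rw [norm_mul, Real.norm_eq_abs, Real.norm_eq_abs, abs_of_pos (Real.exp_pos _)]
    exact (mul_le_of_le_one_right (Real.exp_pos _).le (hk1 z)).trans (hb θ hθ z)
  · refine continuousOn_of_dominated (bound := fun _ => Real.exp Θ)
      (fun θ _ => by fun_prop) (fun θ hθ => ae_of_all _ fun z => ?_) (integrable_const _)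
      (ae_of_all _ fun z => by fun_prop)
    rw [Real.norm_eq_abs, abs_of_pos (Real.exp_pos _)]
    exact hb θ hθ z
  · intro θ _
    exact (integral_exp_pos (integrable_exp_of_abs_le (B := |θ|) (hk.const_mul θ) fun z => by
      rw [abs_mul]; exact mul_le_of_le_one_right (abs_nonneg _) (hk1 z))).ne'

lemma abs_mul_discMass_le (ν : Measure Ω2) [IsProbabilityMeasure ν] (θ : ℝ) (z : Ω2) :
    |θ * discMass ν z| ≤ |θ| := by
  rw [abs_mul]; exact mul_le_of_le_one_right (abs_nonneg _) (abs_discMass_le_one ν z)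

/-- The Euler–Lagrange equation: a minimizer is an exponential tilt of the reference measure,
as soon as some competitor shows that the constraint can be improved to first order. -/
theorem IsMinimizer.exists_tilted [IsProbabilityMeasure μ] (h : IsMinimizer μ δ ν)
    (hδ : discPair μ μ < δ) {ρ₀ : Measure Ω2} [IsProbabilityMeasure ρ₀] (hne₀ : klDiv ρ₀ μ ≠ ∞)
    (hρ₀ : δ < discPair ν ρ₀) :
    ∃ θ : ℝ, 0 < θ ∧ ν = μ.tilted (fun z => θ * discMass ν z) := by
  have := h.prob
  have hνμ : ν ≠ μ := by
    rintro rfl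
    exact absurd h.le (not_le.2 hδ)
  have ht := h.discPair_self_eq hδ
  rw [← ht] at hρ₀
  set k := discMass ν with hk
  have hkm : Measurable k := measurable_discMass ν
  set Θ := (klDiv ρ₀ μ).toReal / (discPair ν ρ₀ - discPair ν ν) + 1 with hΘ
  have hd : 0 < discPair ν ρ₀ - discPair ν ν := sub_pos.2 hρ₀
  have hΘ0 : 0 < Θ := by positivity
  have hm : ∀ θ : ℝ, Measurable fun z => θ * k z := fun θ => hkm.const_mul θ
  have hb : ∀ θ : ℝ, ∀ z, |θ * k z| ≤ |θ| := fun θ => abs_mul_discMass_le ν θ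
  have hlow : ∫ z, k z ∂(μ.tilted fun z => (0 : ℝ) * k z) ≤ discPair ν ν := by
    simp only [zero_mul, tilted_const]
    by_contra! hc
    have h1 := h.klDiv_le_of_lt (ρ := μ) (by simp) hc
    rw [klDiv_self, ENNReal.toReal_zero] at h1
    exact hνμ (eq_of_toReal_klDiv_nonpos h.ne_top h1)
  have hhigh : discPair ν ν ≤ ∫ z, k z ∂(μ.tilted fun z => Θ * k z) := by
    obtain ⟨-, e1⟩ := klDiv_tilted_left_self (μ := μ) (hm Θ) (hb Θ)
    have e2 := integral_sub_log_le_klDiv (hm Θ) (hb Θ) hne₀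
    rw [integral_const_mul] at e1 e2
    have e3 : Θ * discPair ν ν ≤ Θ * discPair ν ρ₀ - (klDiv ρ₀ μ).toReal := by
      have : Θ * (discPair ν ρ₀ - discPair ν ν)
          = (klDiv ρ₀ μ).toReal + (discPair ν ρ₀ - discPair ν ν) := by
        rw [hΘ]; field_simp
      linarith
    have e4 : Θ * discPair ν ν ≤ Θ * ∫ z, k z ∂(μ.tilted fun z => Θ * k z) := by
      have : 0 ≤ (klDiv (μ.tilted fun z => Θ * k z) μ).toReal := ENNReal.toReal_nonneg
      have e5 : ∫ z, k z ∂ρ₀ = discPair ν ρ₀ := rfl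
      rw [e5] at e2
      linarith
    exact le_of_mul_le_mul_left e4 hΘ0
  obtain ⟨θ, hθ, hθe⟩ := intermediate_value_Icc hΘ0.le
    (continuousOn_integral_tilted (μ := μ) hkm (abs_discMass_le_one ν) Θ) ⟨hlow, hhigh⟩
  simp only at hθe
  have hp := isProbabilityMeasure_tilted_of_abs_le (μ := μ) (hm θ) (hb θ)
  obtain ⟨l1, l2⟩ := klDiv_tilted_left_self (μ := μ) (hm θ) (hb θ)
  obtain ⟨r1, r2⟩ := klDiv_tilted_right (hm θ) (hb θ) h.ne_top
  have hle := h.klDiv_le_of_le hne₀ hρ₀ l1 hθe.ge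
  rw [integral_const_mul] at l2 r2
  rw [hθe] at l2
  have e5 : ∫ z, k z ∂ν = discPair ν ν := rfl
  rw [e5] at r2
  have heq : ν = μ.tilted (fun z => θ * k z) := eq_of_toReal_klDiv_nonpos r1 (by linarith)
  refine ⟨θ, hθ.1.lt_of_ne ?_, heq⟩
  rintro rfl
  simp only [zero_mul, tilted_const] at heq
  exact hνμ heq

/-- The competitor needed in the Euler–Lagrange equation can be a conditioned measure. -/
theorem IsMinimizer.exists_tilted_of_set [IsProbabilityMeasure μ] (h : IsMinimizer μ δ ν)
    (hδ : discPair μ μ < δ) {A : Set Ω2} (hA : MeasurableSet A) (hμA : μ A ≠ 0) {c : ℝ}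
    (hc : δ < c) (hAc : ∀ z ∈ A, c ≤ discMass ν z) :
    ∃ θ : ℝ, 0 < θ ∧ ν = μ.tilted (fun z => θ * discMass ν z) := by
  have := h.prob
  have hp := ProbabilityTheory.cond_isProbabilityMeasure hμA
  refine h.exists_tilted hδ (ρ₀ := ProbabilityTheory.cond μ A) ?_ ?_
  · refine klDiv_ne_top_of_le_smul (C := (μ A)⁻¹.toReal) ?_ ?_
    · exact ENNReal.toReal_pos (by simp) (by simpa using hμA)
    · rw [ENNReal.ofReal_toReal (by simpa using hμA), ProbabilityTheory.cond]
      intro s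
      simp only [Measure.smul_apply, smul_eq_mul]
      gcongr
      exact Measure.restrict_le_self
  · refine hc.trans_le ?_
    have hmem : ∀ᵐ z ∂(ProbabilityTheory.cond μ A), z ∈ A := ProbabilityTheory.ae_cond_mem hA
    calc c = ∫ _, c ∂(ProbabilityTheory.cond μ A) := by simp
      _ ≤ _ := integral_mono_ae (integrable_const _) (integrable_discMass _ _)
        (hmem.mono fun z hz => hAc z hz)

lemma klDiv_eq_of_eq_tilted [IsProbabilityMeasure μ] [IsProbabilityMeasure ν] {θ : ℝ}
    (hν : ν = μ.tilted (fun z => θ * discMass ν z)) (hne : klDiv ν μ ≠ ∞) {ρ : Measure Ω2}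
    [IsProbabilityMeasure ρ] (hρ : klDiv ρ μ ≠ ∞) :
    klDiv ρ ν ≠ ∞ ∧ (klDiv ρ μ).toReal =
      (klDiv ρ ν).toReal + θ * (discPair ν ρ - discPair ν ν) + (klDiv ν μ).toReal := by
  have hm : Measurable fun z => θ * discMass ν z := (measurable_discMass ν).const_mul θ
  obtain ⟨a1, a2⟩ := klDiv_tilted_right hm (abs_mul_discMass_le ν θ) hρ
  obtain ⟨b1, b2⟩ := klDiv_tilted_right hm (abs_mul_discMass_le ν θ) hne
  rw [← hν, integral_const_mul] at a2 b2
  rw [← hν] at a1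
  refine ⟨a1, ?_⟩
  rw [klDiv_self, ENNReal.toReal_zero] at b2
  simp only [discPair]
  linarith

lemma IsMinimizer.eq_of_discPair_ge [IsProbabilityMeasure μ] {ν' : Measure Ω2}
    (h : IsMinimizer μ δ ν) (h' : IsMinimizer μ δ ν') {θ : ℝ} (hθ : 0 ≤ θ)
    (hν : ν = μ.tilted (fun z => θ * discMass ν z)) (hT : discPair ν ν ≤ discPair ν ν') :
    ν' = ν := by
  have := h.prob
  have := h'.prob
  obtain ⟨a1, a2⟩ := klDiv_eq_of_eq_tilted hν h.ne_top h'.ne_top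
  rw [h.toReal_klDiv_eq h'] at a2
  refine eq_of_toReal_klDiv_nonpos a1 ?_
  have := mul_nonneg hθ (sub_nonneg.2 hT)
  linarith

/-- Minimizers whose discordance functions are ordered pointwise agree. -/
lemma IsMinimizer.eq_of_discMass_le [IsProbabilityMeasure μ] {ν' : Measure Ω2}
    (h : IsMinimizer μ δ ν) (h' : IsMinimizer μ δ ν') {θ : ℝ} (hθ : 0 ≤ θ)
    (hν : ν = μ.tilted (fun z => θ * discMass ν z))
    (hle : ∀ᵐ z ∂μ, discMass ν z ≤ discMass ν' z) : ν' = ν := by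
  have := h.prob
  have := h'.prob
  refine h.eq_of_discPair_ge h' hθ hν ?_
  rw [discPair_comm ν ν']
  exact integral_mono_ae (integrable_discMass _ _) (integrable_discMass _ _)
    ((klDiv_ne_top_iff.1 h.ne_top).1.ae_le hle)

/-- In the high-temperature regime the minimizer is unique. -/
lemma IsMinimizer.eq_of_theta_lt [IsProbabilityMeasure μ] {ν' : Measure Ω2}
    (hδ : discPair μ μ < δ)
    (h : IsMinimizer μ δ ν) (h' : IsMinimizer μ δ ν') {θ : ℝ} (hθ : 0 ≤ θ) (hθ2 : θ < 1 / 2)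
    (hν : ν = μ.tilted (fun z => θ * discMass ν z)) : ν' = ν := by
  have := h.prob
  have := h'.prob
  obtain ⟨a1, a2⟩ := klDiv_eq_of_eq_tilted hν h.ne_top h'.ne_top
  rw [h.toReal_klDiv_eq h', h.discPair_self_eq hδ] at a2
  set D := (klDiv ν' ν).toReal with hD
  have hD0 : 0 ≤ D := ENNReal.toReal_nonneg
  have hkk : ∀ z, |discMass ν' z - discMass ν z| ≤ 2 * √D := fun z => by
    have := abs_integral_sub_le_sqrt_klDiv (ρ := ν') (μ := ν)
      (g := (discordant z).indicator (fun _ => (1 : ℝ))) (B := 1)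
      (measurable_const.indicator (measurableSet_discordant z)) (fun x => by
        by_cases hx : x ∈ discordant z <;> simp [hx]) a1
    rw [integral_indicator_const _ (measurableSet_discordant z),
      integral_indicator_const _ (measurableSet_discordant z)] at this
    simpa [discMass] using this
  have h2 := abs_integral_sub_le_sqrt_klDiv (ρ := ν') (μ := ν)
    ((measurable_discMass ν').sub (measurable_discMass ν)) hkk a1
  simp only [Pi.sub_apply] at h2
  rw [integral_sub (integrable_discMass _ _) (integrable_discMass _ _),
    integral_sub (integrable_discMass _ _) (integrable_discMass _ _)] at h2
  have e1 : ∫ z, discMass ν' z ∂ν' = δ := h'.discPair_self_eq hδ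
  have e2 : ∫ z, discMass ν z ∂ν = δ := h.discPair_self_eq hδ
  have e3 : ∫ z, discMass ν z ∂ν' = discPair ν ν' := rfl
  have e4 : ∫ z, discMass ν' z ∂ν = discPair ν ν' := discPair_comm ν' ν
  rw [e1, e2, e3, e4] at h2
  have h3 := (abs_le.1 h2).2
  have h4 : 2 * √D * (2 * √D) = 4 * D := by
    have := Real.mul_self_sqrt hD0
    nlinarith
  refine eq_of_toReal_klDiv_nonpos a1 ?_
  nlinarith

lemma isMinimizer_self [IsProbabilityMeasure μ] (h : δ ≤ discPair μ μ) : IsMinimizer μ δ μ :=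
  ⟨inferInstance, by simp, h, fun ρ _ _ _ => by simp⟩

lemma IsMinimizer.eq_self [IsProbabilityMeasure μ] (hδ : δ ≤ discPair μ μ)
    (h : IsMinimizer μ δ ν) : ν = μ := by
  have := h.prob
  refine eq_of_toReal_klDiv_nonpos h.ne_top ?_
  rw [h.toReal_klDiv_eq (isMinimizer_self hδ)]
  simp

end EulerLagrange

section MuL

/-- The function equal to `1` on the lower half and `-1` on the upper half of the line. -/
def halfSign (x : ℝ) : ℝ := if x ≤ 1 / 2 then 1 else -1

lemma measurable_halfSign : Measurable halfSign :=
  Measurable.ite measurableSet_Iic measurable_const measurable_const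

lemma abs_halfSign (x : ℝ) : |halfSign x| = 1 := by
  unfold halfSign; split_ifs <;> simp

lemma halfSign_of_le {x : ℝ} (h : x ≤ 1 / 2) : halfSign x = 1 := if_pos h

lemma halfSign_of_lt {x : ℝ} (h : 1 / 2 < x) : halfSign x = -1 := if_neg (not_le.2 h)

/-- The Lebesgue density of `muL ℓ` on the unit square. -/
def muLDensity (ℓ : ℝ) (p : Ω2) : ℝ := 1 + ℓ * (halfSign p.1 * halfSign p.2)

lemma measurable_muLDensity (ℓ : ℝ) : Measurable (muLDensity ℓ) :=
  measurable_const.add (measurable_const.mul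
    ((measurable_halfSign.comp measurable_fst).mul (measurable_halfSign.comp measurable_snd)))

lemma muLDensity_mem {ℓ : ℝ} (h0 : 0 ≤ ℓ) (p : Ω2) :
    1 - ℓ ≤ muLDensity ℓ p ∧ muLDensity ℓ p ≤ 1 + ℓ := by
  unfold muLDensity halfSign; split_ifs <;> constructor <;> nlinarith

instance : IsProbabilityMeasure unif01 := ⟨by simp [unif01]⟩

lemma lebSq_eq_prod : lebSq = unif01.prod unif01 := by
  rw [lebSq, unitSq, unif01, Measure.prod_restrict]; rfl

instance : IsProbabilityMeasure lebSq := by rw [lebSq_eq_prod]; infer_instance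

lemma muL_eq_withDensity {ℓ : ℝ} (h0 : 0 ≤ ℓ) (h1 : ℓ ≤ 1) :
    muL ℓ = lebSq.withDensity fun p => ENNReal.ofReal (muLDensity ℓ p) := by
  set B1 : Set Ω2 := Set.Icc (0 : ℝ) (1/2) ×ˢ Set.Icc (0 : ℝ) (1/2) with hB1
  set B2 : Set Ω2 := Set.Ioc (1/2 : ℝ) 1 ×ˢ Set.Ioc (1/2 : ℝ) 1 with hB2
  have m1 : MeasurableSet B1 := measurableSet_Icc.prod measurableSet_Icc
  have m2 : MeasurableSet B2 := measurableSet_Ioc.prod measurableSet_Ioc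
  have e2 : volume.restrict (Set.Icc (1/2 : ℝ) 1 ×ˢ Set.Icc (1/2 : ℝ) 1) = lebSq.restrict B2 := by
    rw [lebSq, Measure.restrict_restrict m2, Set.inter_eq_left.2]
    · refine Measure.restrict_congr_set ?_
      exact Measure.set_prod_ae_eq Ioc_ae_eq_Icc.symm Ioc_ae_eq_Icc.symm
    · rintro p ⟨⟨a, b⟩, c, d⟩
      exact ⟨⟨by linarith, b⟩, by linarith, d⟩
  have e1 : volume.restrict B1 = lebSq.restrict B1 := by
    rw [lebSq, Measure.restrict_restrict m1, Set.inter_eq_left.2]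
    rintro p ⟨⟨a, b⟩, c, d⟩
    exact ⟨⟨a, by linarith⟩, c, by linarith⟩
  have e : muL ℓ = lebSq.withDensity ((fun _ => ENNReal.ofReal (1 - ℓ)) +
      (ENNReal.ofReal ℓ • (B1.indicator (fun _ => 2) + B2.indicator (fun _ => 2)))) := by
    rw [withDensity_add_left measurable_const, withDensity_const,
      withDensity_smul _ ((measurable_const.indicator m1).add (measurable_const.indicator m2)),
      withDensity_add_left (measurable_const.indicator m1), withDensity_indicator m1,
      withDensity_indicator m2, withDensity_const, withDensity_const, muL, mu1M, e2, ← hB1, e1]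
  rw [e]
  refine withDensity_congr_ae ?_
  have hmem : ∀ᵐ p ∂lebSq, p ∈ unitSq := ae_restrict_mem measurableSet_unitSq
  filter_upwards [hmem] with p hp
  obtain ⟨⟨a, b⟩, c, d⟩ := hp
  have two : ENNReal.ofReal ℓ * 2 = ENNReal.ofReal (ℓ * 2) := by
    rw [ENNReal.ofReal_mul h0]; simp
  simp only [Pi.add_apply, Pi.smul_apply, smul_eq_mul, Set.indicator, muLDensity, halfSign, hB1,
    hB2, Set.mem_prod, Set.mem_Icc, Set.mem_Ioc, a, b, c, d, true_and, and_true]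
  by_cases hx : p.1 ≤ 1/2 <;> by_cases hy : p.2 ≤ 1/2
  · rw [if_pos ⟨hx, hy⟩, if_neg (fun h => absurd h.1 (not_lt.2 hx)), if_pos hx, if_pos hy, add_zero,
      two, ← ENNReal.ofReal_add (by linarith) (by linarith)]
    congr 1; ring
  · rw [if_neg (fun h => hy h.2), if_neg (fun h => absurd h.1 (not_lt.2 hx)), if_pos hx, if_neg hy]
    simp [sub_eq_add_neg]
  · rw [if_neg (fun h => hx h.1), if_neg (fun h => absurd h.2 (not_lt.2 hy)), if_neg hx, if_pos hy]
    simp [sub_eq_add_neg]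
  · rw [if_neg (fun h => hx h.1), if_pos ⟨not_le.1 hx, not_le.1 hy⟩, if_neg hx, if_neg hy, zero_add,
      two, ← ENNReal.ofReal_add (by linarith) (by linarith)]
    congr 1; ring

lemma muLDensity_nonneg {ℓ : ℝ} (h0 : 0 ≤ ℓ) (h1 : ℓ ≤ 1) (p : Ω2) : 0 ≤ muLDensity ℓ p := by
  linarith [(muLDensity_mem h0 p).1]

lemma integral_muL {ℓ : ℝ} (h0 : 0 ≤ ℓ) (h1 : ℓ ≤ 1) (F : Ω2 → ℝ) : ∫ p, F p ∂muL ℓ = ∫ p, muLDensity ℓ p * F p ∂lebSq := by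
  rw [muL_eq_withDensity h0 h1, integral_withDensity_eq_integral_toReal_smul
    (measurable_muLDensity ℓ).ennreal_ofReal (ae_of_all _ fun _ => ENNReal.ofReal_lt_top)]
  simp only [ENNReal.toReal_ofReal (muLDensity_nonneg h0 h1 _), smul_eq_mul]

lemma integral_muL_mul {ℓ : ℝ} (h0 : 0 ≤ ℓ) (h1 : ℓ ≤ 1) {f g : ℝ → ℝ}
    (hf : Integrable f unif01) (hg : Integrable g unif01) :
    ∫ p, f p.1 * g p.2 ∂muL ℓ = (∫ x, f x ∂unif01) * (∫ x, g x ∂unif01) +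
      ℓ * ((∫ x, halfSign x * f x ∂unif01) * ∫ x, halfSign x * g x ∂unif01) := by
  have hs : ∀ {f : ℝ → ℝ}, Integrable f unif01 →
      Integrable (fun x => halfSign x * f x) unif01 := fun h =>
    h.bdd_mul measurable_halfSign.aestronglyMeasurable (c := 1)
      (ae_of_all _ fun x => (abs_halfSign x).le)
  rw [integral_muL h0 h1, ← integral_prod_mul, ← integral_prod_mul, ← lebSq_eq_prod,
    ← integral_const_mul, ← integral_add]
  · refine integral_congr_ae (ae_of_all _ fun p => ?_)
    simp only [muLDensity]
    ring
  · rw [lebSq_eq_prod]; exact hf.mul_prod hg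
  · rw [lebSq_eq_prod]; exact ((hs hf).mul_prod (hs hg)).const_mul ℓ

lemma integral_halfSign_of_subset {A : Set ℝ} (hA : A ⊆ Set.Iic (1 / 2)) (hm : MeasurableSet A) :
    ∫ x in A, halfSign x ∂unif01 = unif01.real A := by
  rw [setIntegral_congr_fun hm (g := fun _ => (1 : ℝ)) fun x hx => halfSign_of_le (hA hx)]
  simp

lemma integral_halfSign_of_subset' {A : Set ℝ} (hA : A ⊆ Set.Ioi (1 / 2)) (hm : MeasurableSet A) :
    ∫ x in A, halfSign x ∂unif01 = - unif01.real A := by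
  rw [setIntegral_congr_fun hm (g := fun _ => (-1 : ℝ)) fun x hx => halfSign_of_lt (hA hx)]
  simp

lemma integrable_halfSign (ρ : Measure ℝ) [IsFiniteMeasure ρ] : Integrable halfSign ρ :=
  integrable_of_abs_le measurable_halfSign fun x => (abs_halfSign x).le

lemma unif01_real_Iio {x : ℝ} (h0 : 0 ≤ x) (h1 : x ≤ 1) : unif01.real (Set.Iio x) = x := by
  have : Set.Iio x ∩ Set.Icc 0 1 = Set.Ico 0 x := by
    ext y; simp only [Set.mem_inter_iff, Set.mem_Iio, Set.mem_Icc, Set.mem_Ico]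
    constructor
    · rintro ⟨a, b, c⟩; exact ⟨b, a⟩
    · rintro ⟨a, b⟩; exact ⟨b, a, by linarith⟩
  rw [Measure.real, unif01, Measure.restrict_apply measurableSet_Iio, this, Real.volume_Ico]
  simp [h0]

instance : NullSingletonClass unif01 := by unfold unif01; infer_instance

lemma unif01_real_Iic {x : ℝ} (h0 : 0 ≤ x) (h1 : x ≤ 1) : unif01.real (Set.Iic x) = x := by
  exact (measureReal_congr Iio_ae_eq_Iic.symm).trans (unif01_real_Iio h0 h1)

lemma unif01_real_Ioi {x : ℝ} (h0 : 0 ≤ x) (h1 : x ≤ 1) : unif01.real (Set.Ioi x) = 1 - x := by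
  rw [← Set.compl_Iic, probReal_compl_eq_one_sub measurableSet_Iic, unif01_real_Iic h0 h1]

/-- The tent function `min x (1 - x)`. -/
def tent (x : ℝ) : ℝ := min x (1 - x)

lemma integral_halfSign_Iic {x : ℝ} (h0 : 0 ≤ x) (h1 : x ≤ 1) :
    ∫ t in Set.Iic x, halfSign t ∂unif01 = tent x := by
  rcases le_total x (1 / 2) with h | h
  · rw [integral_halfSign_of_subset (Set.Iic_subset_Iic.2 h) measurableSet_Iic,
      unif01_real_Iic h0 h1, tent, min_eq_left (by linarith)]
  · rw [← Set.Iic_union_Ioc_eq_Iic h, setIntegral_union (Set.Iic_disjoint_Ioc le_rfl)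
      measurableSet_Ioc (integrable_halfSign _) (integrable_halfSign _),
      integral_halfSign_of_subset le_rfl measurableSet_Iic,
      integral_halfSign_of_subset' (fun _ h => h.1) measurableSet_Ioc,
      unif01_real_Iic (by norm_num) (by norm_num), tent, min_eq_right (by linarith),
      ← Set.Iic_sdiff_Iic, measureReal_sdiff (Set.Iic_subset_Iic.2 h) measurableSet_Iic,
      unif01_real_Iic h0 h1, unif01_real_Iic (by norm_num) (by norm_num)]
    ring

lemma integral_halfSign : ∫ t, halfSign t ∂unif01 = 0 := by
  have h := integral_halfSign_Iic zero_le_one le_rfl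
  have e : ∫ t in Set.Iic (1 : ℝ), halfSign t ∂unif01 = ∫ t, halfSign t ∂unif01 := by
    rw [unif01, Measure.restrict_restrict measurableSet_Iic, Set.inter_eq_right.2]
    exact fun x hx => hx.2
  rw [← e, h]
  simp [tent]

lemma integral_halfSign_Iio {x : ℝ} (h0 : 0 ≤ x) (h1 : x ≤ 1) :
    ∫ t in Set.Iio x, halfSign t ∂unif01 = tent x := by
  rw [← integral_halfSign_Iic h0 h1]
  exact setIntegral_congr_set Iio_ae_eq_Iic

lemma integral_halfSign_Ioi {x : ℝ} (h0 : 0 ≤ x) (h1 : x ≤ 1) :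
    ∫ t in Set.Ioi x, halfSign t ∂unif01 = - tent x := by
  have h := integral_add_compl (s := Set.Iic x) measurableSet_Iic (integrable_halfSign unif01)
  rw [integral_halfSign, integral_halfSign_Iic h0 h1, Set.compl_Iic] at h
  linarith

lemma muL_le {ℓ : ℝ} (h0 : 0 ≤ ℓ) (h1 : ℓ ≤ 1) : muL ℓ ≤ ENNReal.ofReal (1 + ℓ) • lebSq := by
  rw [muL_eq_withDensity h0 h1, ← withDensity_const]
  exact withDensity_mono (ae_of_all _ fun p => ENNReal.ofReal_le_ofReal (muLDensity_mem h0 p).2)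

lemma isProbabilityMeasure_muL {ℓ : ℝ} (h0 : 0 ≤ ℓ) (h1 : ℓ ≤ 1) :
    IsProbabilityMeasure (muL ℓ) := by
  have hf : IsFiniteMeasure (muL ℓ) := by
    refine ⟨(muL_le h0 h1 Set.univ).trans_lt ?_⟩
    simp
  have h := integral_muL_mul h0 h1 (f := fun _ => 1) (g := fun _ => 1)
    (integrable_const _) (integrable_const _)
  simp only [mul_one, integral_halfSign, integral_const, smul_eq_mul, probReal_univ, mul_zero,
    add_zero] at h
  exact ⟨by rw [← ENNReal.toReal_eq_one_iff]; exact h⟩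

lemma muL_real_prod {ℓ : ℝ} (h0 : 0 ≤ ℓ) (h1 : ℓ ≤ 1) {A B : Set ℝ} (hA : MeasurableSet A)
    (hB : MeasurableSet B) :
    (muL ℓ).real (A ×ˢ B) = unif01.real A * unif01.real B +
      ℓ * ((∫ x in A, halfSign x ∂unif01) * ∫ x in B, halfSign x ∂unif01) := by
  have i : ∀ {A : Set ℝ}, MeasurableSet A → Integrable (A.indicator (fun _ => (1 : ℝ))) unif01 :=
    fun h => (integrable_const _).indicator h
  have h := integral_muL_mul h0 h1 (i hA) (i hB)
  have e : ∀ {A : Set ℝ}, MeasurableSet A → ∫ x, halfSign x * A.indicator (fun _ => (1 : ℝ)) x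
      ∂unif01 = ∫ x in A, halfSign x ∂unif01 := fun {A} h => by
    rw [← integral_indicator h]
    congr 1; ext x; by_cases hx : x ∈ A <;> simp [hx]
  have e' : ∀ {A : Set ℝ}, MeasurableSet A →
      ∫ x, A.indicator (fun _ => (1 : ℝ)) x ∂unif01 = unif01.real A := fun h =>
    integral_indicator_one h
  rw [e hA, e hB, e' hA, e' hB] at h
  rw [← h, ← integral_indicator_one (hA.prod hB)]
  congr 1; ext p
  by_cases h : p.1 ∈ A <;> by_cases h' : p.2 ∈ B <;> simp [Set.indicator, h, h']

lemma unif01_real_Icc_le {a b : ℝ} : unif01.real (Set.Icc a b) ≤ (ENNReal.ofReal (b - a)).toReal := by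
  rw [← Real.volume_Icc]
  exact ENNReal.toReal_mono (by simp) (Measure.restrict_apply_le _ _)

lemma isBase_muL {ℓ : ℝ} (h0 : 0 ≤ ℓ) (h1 : ℓ ≤ 1) : IsBase (muL ℓ) := by
  have := isProbabilityMeasure_muL h0 h1
  refine ⟨this, ?_, fun a b => ?_, fun a b => ?_⟩
  · refine le_antisymm ((muL_le h0 h1 _).trans ?_) zero_le
    simp [lebSq, Measure.restrict_apply measurableSet_unitSq.compl]
  · have e : {p : Ω2 | a ≤ p.1 ∧ p.1 ≤ b} = Set.Icc a b ×ˢ Set.univ := by ext; simp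
    rw [e, ← ENNReal.toReal_le_toReal (measure_ne_top _ _) (by simp)]
    change (muL ℓ).real _ ≤ _
    rw [muL_real_prod h0 h1 measurableSet_Icc MeasurableSet.univ]
    simpa [integral_halfSign] using unif01_real_Icc_le
  · have e : {p : Ω2 | a ≤ p.2 ∧ p.2 ≤ b} = Set.univ ×ˢ Set.Icc a b := by ext; simp
    rw [e, ← ENNReal.toReal_le_toReal (measure_ne_top _ _) (by simp)]
    change (muL ℓ).real _ ≤ _
    rw [muL_real_prod h0 h1 MeasurableSet.univ measurableSet_Icc]
    simpa [integral_halfSign] using unif01_real_Icc_le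

lemma discordant_eq (z : Ω2) :
    discordant z = Set.Ioi z.1 ×ˢ Set.Iio z.2 ∪ Set.Iio z.1 ×ˢ Set.Ioi z.2 := by
  ext w; simp [discordant]

lemma discMass_eq (ν : Measure Ω2) [IsFiniteMeasure ν] (z : Ω2) :
    discMass ν z = ν.real (Set.Ioi z.1 ×ˢ Set.Iio z.2) + ν.real (Set.Iio z.1 ×ˢ Set.Ioi z.2) := by
  rw [discMass, discordant_eq, measureReal_union _ (measurableSet_Iio.prod measurableSet_Ioi)]
  rw [Set.disjoint_left]
  rintro w ⟨h, -⟩ ⟨h', -⟩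
  exact lt_asymm (Set.mem_Ioi.1 h) h'

lemma discMass_muL {ℓ : ℝ} (h0 : 0 ≤ ℓ) (h1 : ℓ ≤ 1) {z : Ω2} (hz : z ∈ unitSq) :
    discMass (muL ℓ) z = z.1 + z.2 - 2 * (z.1 * z.2) - 2 * ℓ * (tent z.1 * tent z.2) := by
  have := isProbabilityMeasure_muL h0 h1
  obtain ⟨⟨a, b⟩, c, d⟩ := hz
  rw [discMass_eq, muL_real_prod h0 h1 measurableSet_Ioi measurableSet_Iio,
    muL_real_prod h0 h1 measurableSet_Iio measurableSet_Ioi, unif01_real_Ioi a b,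
    unif01_real_Ioi c d, unif01_real_Iio a b, unif01_real_Iio c d, integral_halfSign_Ioi a b,
    integral_halfSign_Ioi c d, integral_halfSign_Iio a b, integral_halfSign_Iio c d]
  ring

lemma ae_mem_unitSq {μ : Measure Ω2} (hμ : IsBase μ) : ∀ᵐ z ∂μ, z ∈ unitSq :=
  hμ.supp

lemma integral_unif01_eq {f g₁ g₂ : ℝ → ℝ} (h₁ : ∀ x, 0 ≤ x → x ≤ 1 / 2 → f x = g₁ x)
    (h₂ : ∀ x, 1 / 2 < x → x ≤ 1 → f x = g₂ x) (c₁ : Continuous g₁) (c₂ : Continuous g₂) :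
    ∫ x, f x ∂unif01 = (∫ x in (0 : ℝ)..(1 / 2), g₁ x) + ∫ x in (1 / 2 : ℝ)..1, g₂ x := by
  have e₁ : ∀ x ∈ Set.Ioc (0 : ℝ) (1/2), f x = g₁ x := fun x hx => h₁ x hx.1.le hx.2
  have e₂ : ∀ x ∈ Set.Ioc (1/2 : ℝ) 1, f x = g₂ x := fun x hx => h₂ x hx.1 hx.2
  rw [unif01, integral_Icc_eq_integral_Ioc, ← Set.Ioc_union_Ioc_eq_Ioc (b := (1 / 2 : ℝ))
    (by norm_num) (by norm_num), setIntegral_union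
    (Set.disjoint_left.2 fun x h h' => absurd h.2 (not_le.2 h'.1)) measurableSet_Ioc,
    setIntegral_congr_fun measurableSet_Ioc e₁, setIntegral_congr_fun measurableSet_Ioc e₂,
    intervalIntegral.integral_of_le (by norm_num), intervalIntegral.integral_of_le (by norm_num)]
  · exact ((c₁.integrableOn_Icc).mono_set Set.Ioc_subset_Icc_self).congr_fun
      (fun x hx => (e₁ x hx).symm) measurableSet_Ioc
  · exact ((c₂.integrableOn_Icc).mono_set Set.Ioc_subset_Icc_self).congr_fun
      (fun x hx => (e₂ x hx).symm) measurableSet_Ioc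

lemma continuous_tent : Continuous tent := by unfold tent; fun_prop

lemma integrable_unif01 {f : ℝ → ℝ} (hf : Continuous f) : Integrable f unif01 :=
  hf.integrableOn_Icc

lemma discPair_muL {ℓ : ℝ} (h0 : 0 ≤ ℓ) (h1 : ℓ ≤ 1) :
    discPair (muL ℓ) (muL ℓ) = (2 - ℓ) / 4 := by
  have hP := isProbabilityMeasure_muL h0 h1
  have i1 : ∫ x : ℝ, x ∂unif01 = 1 / 2 := by
    rw [integral_unif01_eq (g₁ := fun x => x) (g₂ := fun x => x) (fun _ _ _ => rfl)
      (fun _ _ _ => rfl) (by fun_prop) (by fun_prop), integral_id, integral_id]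
    norm_num
  have i2 : ∫ x, halfSign x * x ∂unif01 = -(1 / 4) := by
    rw [integral_unif01_eq (g₁ := fun x => x) (g₂ := fun x => -x)
      (fun x _ h => by rw [halfSign_of_le h, one_mul]) (fun x h _ => by rw [halfSign_of_lt h, neg_one_mul])
      (by fun_prop) (by fun_prop), intervalIntegral.integral_neg, integral_id, integral_id]
    norm_num
  have i3 : ∫ x, tent x ∂unif01 = 1 / 4 := by
    rw [integral_unif01_eq (g₁ := fun x => x) (g₂ := fun x => 1 - x)
      (fun x _ h => by rw [tent, min_eq_left (by linarith)])
      (fun x h _ => by rw [tent, min_eq_right (by linarith)])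
      (by fun_prop) (by fun_prop), intervalIntegral.integral_sub (by simp) (by simp), integral_id,
      integral_id]
    norm_num
  have i4 : ∫ x, halfSign x * tent x ∂unif01 = 0 := by
    rw [integral_unif01_eq (g₁ := fun x => x) (g₂ := fun x => x - 1)
      (fun x _ h => by simp only [halfSign, if_pos h, tent]; rw [min_eq_left (by linarith)]; ring)
      (fun x h _ => by
        simp only [halfSign, if_neg (not_le.2 h), tent]; rw [min_eq_right (by linarith)]; ring)
      (by fun_prop) (by fun_prop), intervalIntegral.integral_sub (by simp) (by simp), integral_id,
      integral_id]
    norm_num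
  have c1 : Integrable (fun _ : ℝ => (1 : ℝ)) unif01 := integrable_const _
  have cx : Integrable (fun x : ℝ => x) unif01 := integrable_unif01 continuous_id
  have ct := integrable_unif01 continuous_tent
  have P1 := integral_muL_mul h0 h1 cx c1
  have P2 := integral_muL_mul h0 h1 c1 cx
  have P3 := integral_muL_mul h0 h1 cx cx
  have P4 := integral_muL_mul h0 h1 ct ct
  simp only [i1, i2, i3, i4, mul_one, one_mul, integral_halfSign, integral_const, smul_eq_mul,
    probReal_univ, mul_zero, zero_mul, add_zero] at P1 P2 P3 P4
  have fin : ∀ {f : Ω2 → ℝ}, Continuous f → Integrable f (muL ℓ) := fun {f} hf => by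
    have : Integrable f lebSq := hf.continuousOn.integrableOn_compact (isCompact_Icc.prod isCompact_Icc)
    exact (this.smul_measure (by simp)).mono_measure (muL_le h0 h1)
  rw [discPair, integral_congr_ae ((ae_mem_unitSq (isBase_muL h0 h1)).mono fun z hz =>
    discMass_muL h0 h1 hz), integral_sub, integral_sub, integral_add, integral_const_mul,
    integral_const_mul, P1, P2, P3, P4]
  · ring
  all_goals refine fin ?_
  all_goals have := continuous_tent; fun_prop

lemma not_isCC_muL {ℓ : ℝ} (h0 : 0 ≤ ℓ) (h1 : ℓ ≤ 1) : ¬ IsCC (k := 1) inv2 (muL ℓ) := by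
  have hP := isProbabilityMeasure_muL h0 h1
  rw [isCC_inv2_iff]
  rintro ⟨c, -, hc⟩
  have pos : ∀ {a b a' b' : ℝ}, 0 ≤ a → a < b → b ≤ 1/2 → 0 ≤ a' → a' < b' → b' ≤ 1/2 →
      ∃ z : Ω2, (a < z.1 ∧ z.1 ≤ b) ∧ (a' < z.2 ∧ z.2 ≤ b') ∧ discMass (muL ℓ) z = c := by
    intro a b a' b' a1 a2 a3 b1 b2 b3
    by_contra! hcon
    have hz : muL ℓ (Set.Ioc a b ×ˢ Set.Ioc a' b') = 0 := by
      refine measure_mono_null (fun z hz => ?_) hc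
      exact hcon z hz.1 hz.2
    have m : ∀ {a b : ℝ}, 0 ≤ a → a < b → b ≤ 1/2 → unif01.real (Set.Ioc a b) = b - a := by
      intro a b a1 a2 a3
      rw [← Set.Iic_sdiff_Iic, measureReal_sdiff (Set.Iic_subset_Iic.2 a2.le) measurableSet_Iic,
        unif01_real_Iic (by linarith) (by linarith), unif01_real_Iic (by linarith) (by linarith)]
    have h := muL_real_prod h0 h1 (measurableSet_Ioc (a := a) (b := b))
      (measurableSet_Ioc (a := a') (b := b'))
    rw [Measure.real, hz, integral_halfSign_of_subset (fun x hx => hx.2.trans a3) measurableSet_Ioc,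
      integral_halfSign_of_subset (fun x hx => hx.2.trans b3) measurableSet_Ioc, m a1 a2 a3,
      m b1 b2 b3, ENNReal.toReal_zero] at h
    have h3 := mul_pos (sub_pos.2 a2) (sub_pos.2 b2)
    nlinarith
  obtain ⟨z, ⟨z1, z2⟩, ⟨z3, z4⟩, hz⟩ := pos (a := 0) (b := 1/8) (a' := 0) (b' := 1/8)
    (by norm_num) (by norm_num) (by norm_num) (by norm_num) (by norm_num) (by norm_num)
  obtain ⟨w, ⟨w1, w2⟩, ⟨w3, w4⟩, hw⟩ := pos (a := 0) (b := 1/16) (a' := 7/16) (b' := 1/2)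
    (by norm_num) (by norm_num) (by norm_num) (by norm_num) (by norm_num) (by norm_num)
  rw [discMass_muL h0 h1 ⟨⟨z1.le, by linarith⟩, z3.le, by linarith⟩, tent, tent,
    min_eq_left (by linarith), min_eq_left (by linarith)] at hz
  rw [discMass_muL h0 h1 ⟨⟨w1.le, by linarith⟩, by linarith, by linarith⟩, tent, tent,
    min_eq_left (by linarith), min_eq_left (by linarith)] at hw
  have a1 := mul_pos z1 z3
  have a2 := mul_nonneg h0 a1.le
  have b1 : w.1 * w.2 ≤ 1/16 * (1/2) := mul_le_mul w2 w4 (by linarith) (by norm_num)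
  have b2 : ℓ * (w.1 * w.2) ≤ 1 * (1/16 * (1/2)) := mul_le_mul h1 b1 (by positivity) (by norm_num)
  linarith

end MuL

section Affine

/-- The similarity `(x, y) ↦ (c x + a, c y + b)` of the plane. -/
def scaleMap (c a b : ℝ) (z : Ω2) : Ω2 := (c * z.1 + a, c * z.2 + b)

lemma measurable_scaleMap (c a b : ℝ) : Measurable (scaleMap c a b) := by
  unfold scaleMap; fun_prop

lemma preimage_discordant_scaleMap {c : ℝ} (hc : 0 < c) (a b : ℝ) (z : Ω2) :
    scaleMap c a b ⁻¹' discordant (scaleMap c a b z) = discordant z := by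
  ext w
  simp [discordant, scaleMap, hc]

lemma discMass_map_scaleMap {c : ℝ} (hc : 0 < c) (a b : ℝ) (ν : Measure Ω2) (z : Ω2) :
    discMass (ν.map (scaleMap c a b)) (scaleMap c a b z) = discMass ν z := by
  rw [discMass, map_measureReal_apply (measurable_scaleMap c a b) (measurableSet_discordant _),
    preimage_discordant_scaleMap hc, discMass]

lemma discPair_map (ν ρ : Measure Ω2) [IsProbabilityMeasure ν] {f : Ω2 → Ω2} (hf : Measurable f) :
    discPair ν (ρ.map f) = ∫ z, discMass ν (f z) ∂ρ :=
  integral_map hf.aemeasurable (measurable_discMass ν).aestronglyMeasurable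

lemma discPair_map_scaleMap {c : ℝ} (hc : 0 < c) (a b : ℝ) (ν ρ : Measure Ω2)
    [IsProbabilityMeasure ν] :
    discPair (ν.map (scaleMap c a b)) (ρ.map (scaleMap c a b)) = discPair ν ρ := by
  have := Measure.isProbabilityMeasure_map (μ := ν) (measurable_scaleMap c a b).aemeasurable
  rw [discPair_map _ _ (measurable_scaleMap c a b)]
  simp only [discMass_map_scaleMap hc, discPair]

lemma map_unif01 {c : ℝ} (hc : 0 < c) (a : ℝ) :
    unif01.map (fun x => c * x + a) =
      ENNReal.ofReal c⁻¹ • volume.restrict (Set.Icc a (c + a)) := by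
  have he : MeasurableEmbedding (fun x : ℝ => c * x + a) :=
    (measurableEmbedding_addRight a).comp (measurableEmbedding_mulLeft₀ hc.ne')
  have h := he.restrict_map volume (Set.Icc a (c + a))
  have hpre : (fun x : ℝ => c * x + a) ⁻¹' Set.Icc a (c + a) = Set.Icc 0 1 := by
    ext x
    simp only [Set.mem_preimage, Set.mem_Icc]
    constructor
    · rintro ⟨h1, h2⟩
      constructor <;> nlinarith
    · rintro ⟨h1, h2⟩
      constructor <;> nlinarith
  rw [hpre] at h
  rw [unif01, ← h, ← Measure.restrict_smul]
  congr 1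
  have : (fun x : ℝ => c * x + a) = (fun x => x + a) ∘ fun x => c * x := rfl
  rw [this, ← Measure.map_map (measurable_add_const a) (measurable_const_mul c),
    Real.map_volume_mul_left hc.ne', Measure.map_smul, map_add_right_eq_self,
    abs_of_pos (inv_pos.2 hc)]

lemma map_lebSq {c : ℝ} (hc : 0 < c) (a b : ℝ) :
    lebSq.map (scaleMap c a b) = ENNReal.ofReal (c⁻¹ * c⁻¹) •
      volume.restrict (Set.Icc a (c + a) ×ˢ Set.Icc b (c + b)) := by
  have h := Measure.map_prod_map unif01 unif01 (f := fun x => c * x + a) (g := fun x => c * x + b)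
    (by fun_prop) (by fun_prop)
  rw [← lebSq_eq_prod, map_unif01 hc, map_unif01 hc, Measure.prod_smul_left,
    Measure.prod_smul_right, smul_smul, Measure.prod_restrict,
    ← ENNReal.ofReal_mul (inv_pos.2 hc).le] at h
  exact h.symm

lemma measure_smul_mono (c : ℝ≥0∞) {μ ν : Measure Ω2} (h : μ ≤ ν) : c • μ ≤ c • ν :=
  Measure.le_iff'.2 fun s => by
    rw [Measure.smul_apply, Measure.smul_apply]
    exact mul_le_mul_right (h s) c

lemma map_lebSq_le {c : ℝ} (hc : 0 < c) {a b : ℝ} (ha : 0 ≤ a) (hb : 0 ≤ b) (ha' : c + a ≤ 1)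
    (hb' : c + b ≤ 1) : lebSq.map (scaleMap c a b) ≤ ENNReal.ofReal (c⁻¹ * c⁻¹) • lebSq := by
  rw [map_lebSq hc]
  refine measure_smul_mono _ ?_
  exact Measure.restrict_mono (Set.prod_mono (Set.Icc_subset_Icc ha ha')
    (Set.Icc_subset_Icc hb hb')) le_rfl

lemma map_lebSq_half_le {ℓ : ℝ} (h0 : 0 ≤ ℓ) (h1 : ℓ ≤ 1) :
    lebSq.map (scaleMap (1 / 2) 0 0) ≤ ENNReal.ofReal (4 / (1 + ℓ)) • muL ℓ := by
  rw [map_lebSq (by norm_num)]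
  set B : Set Ω2 := Set.Icc (0 : ℝ) (1/2) ×ˢ Set.Icc (0 : ℝ) (1/2) with hB
  have hle : volume.restrict B ≤ lebSq :=
    Measure.restrict_mono (Set.prod_mono (Set.Icc_subset_Icc le_rfl (by norm_num))
      (Set.Icc_subset_Icc le_rfl (by norm_num))) le_rfl
  have key : ENNReal.ofReal (1 + ℓ) • volume.restrict B ≤ muL ℓ := by
    have e : ENNReal.ofReal (1 + ℓ) = ENNReal.ofReal (1 - ℓ) + ENNReal.ofReal ℓ * 2 := by
      have : ENNReal.ofReal ℓ * 2 = ENNReal.ofReal (ℓ * 2) := by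
        rw [ENNReal.ofReal_mul h0]; simp
      rw [this, ← ENNReal.ofReal_add (by linarith) (by linarith)]
      congr 1; ring
    rw [e, add_smul, muL, mu1M, ← hB, mul_smul]
    exact add_le_add (measure_smul_mono _ hle) (measure_smul_mono _ (Measure.le_add_right le_rfl))
  have e : ENNReal.ofReal ((1 / 2 : ℝ)⁻¹ * (1 / 2)⁻¹) =
      ENNReal.ofReal (4 / (1 + ℓ)) * ENNReal.ofReal (1 + ℓ) := by
    rw [← ENNReal.ofReal_mul (by positivity)]
    congr 1
    field_simp
    norm_num
  rw [e, mul_smul, add_zero]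
  exact measure_smul_mono _ key

lemma map_le_smul {f : Ω2 → Ω2} (hf : Measurable f) {ν μ : Measure Ω2} {C : ℝ≥0∞} (h : ν ≤ C • μ) :
    ν.map f ≤ C • μ.map f := by
  rw [← Measure.map_smul]
  exact Measure.map_mono h hf

lemma muL_zero : muL 0 = lebSq := by simp [muL]

lemma lebSq_compl : lebSq unitSqᶜ = 0 := by
  rw [← muL_zero]; exact (isBase_muL le_rfl zero_le_one).supp

lemma exists_discPair_eq (n : ℕ) : ∃ ν : Measure Ω2, IsProbabilityMeasure ν ∧
    (∃ C : ℝ, 0 < C ∧ ν ≤ ENNReal.ofReal C • lebSq) ∧ discPair ν ν = 1 - (1 / 2) ^ (n + 1) := by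
  induction n with
  | zero =>
    refine ⟨lebSq, inferInstance, ⟨1, one_pos, by simp⟩, ?_⟩
    rw [← muL_zero, discPair_muL le_rfl zero_le_one]
    norm_num
  | succ n ih =>
    obtain ⟨ν, hν, ⟨C, hC, hle⟩, ht⟩ := ih
    have m1 := measurable_scaleMap (1 / 4) 0 (3 / 4)
    have m2 := measurable_scaleMap (1 / 4) (3 / 4) 0
    have p1 := Measure.isProbabilityMeasure_map (μ := ν) m1.aemeasurable
    have p2 := Measure.isProbabilityMeasure_map (μ := ν) m2.aemeasurable
    have hs : ∀ᵐ z ∂ν, z ∈ unitSq := by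
      refine le_antisymm ((hle _).trans ?_) zero_le
      change ENNReal.ofReal C * lebSq unitSqᶜ ≤ 0
      rw [lebSq_compl, mul_zero]
    have le1 : ∀ a b : ℝ, 0 ≤ a → 0 ≤ b → 1 / 4 + a ≤ 1 → 1 / 4 + b ≤ 1 →
        ν.map (scaleMap (1 / 4) a b) ≤ ENNReal.ofReal (C * 16) • lebSq := fun a b h1 h2 h3 h4 => by
      refine (map_le_smul (measurable_scaleMap _ _ _) hle).trans ?_
      rw [ENNReal.ofReal_mul hC.le, mul_smul]
      refine measure_smul_mono _ ((map_lebSq_le (by norm_num) h1 h2 h3 h4).trans_eq ?_)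
      norm_num
    refine ⟨mixM (1 / 2) (ν.map (scaleMap (1 / 4) 0 (3 / 4))) (ν.map (scaleMap (1 / 4) (3 / 4) 0)),
      isProbabilityMeasure_mixM _ _ (by norm_num) (by norm_num), ⟨C * 16, by positivity, ?_⟩, ?_⟩
    · rw [mixM]
      calc _ ≤ ENNReal.ofReal (1 - 1 / 2) • (ENNReal.ofReal (C * 16) • lebSq) +
            ENNReal.ofReal (1 / 2) • (ENNReal.ofReal (C * 16) • lebSq) :=
            add_le_add (measure_smul_mono _ (le1 _ _ (by norm_num) (by norm_num) (by norm_num)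
              (by norm_num))) (measure_smul_mono _ (le1 _ _ (by norm_num) (by norm_num)
              (by norm_num) (by norm_num)))
        _ = _ := by
            rw [← add_smul, ← ENNReal.ofReal_add (by norm_num) (by norm_num)]
            norm_num
    · have hone : discPair (ν.map (scaleMap (1 / 4) 0 (3 / 4)))
          (ν.map (scaleMap (1 / 4) (3 / 4) 0)) = 1 := by
        rw [discPair_map _ _ m2]
        have : ∀ᵐ z ∂ν, discMass (ν.map (scaleMap (1 / 4) 0 (3 / 4)))
            (scaleMap (1 / 4) (3 / 4) 0 z) = 1 := by
          filter_upwards [hs] with z hz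
          rw [discMass, map_measureReal_apply m1 (measurableSet_discordant _), Measure.real,
            (mem_ae_iff_prob_eq_one (m1 (measurableSet_discordant _))).1, ENNReal.toReal_one]
          filter_upwards [hs] with w hw
          obtain ⟨⟨a, b⟩, c, d⟩ := hz
          obtain ⟨⟨a', b'⟩, c', d'⟩ := hw
          refine Or.inr ⟨?_, ?_⟩ <;> simp only [scaleMap] <;> linarith
        rw [integral_congr_ae this]
        simp
      rw [discPair_mixM _ _ (by norm_num) (by norm_num), hone,
        discPair_map_scaleMap (by norm_num), discPair_map_scaleMap (by norm_num), ht]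
      ring

lemma exists_klDiv_ne_top {ℓ : ℝ} (h0 : 0 ≤ ℓ) (h1 : ℓ ≤ 1) {δ : ℝ} (hδ : δ < 1) :
    ∃ ρ : Measure Ω2, IsProbabilityMeasure ρ ∧ klDiv ρ (muL ℓ) ≠ ∞ ∧ δ < discPair ρ ρ := by
  have hP := isProbabilityMeasure_muL h0 h1
  obtain ⟨n, hn⟩ := exists_pow_lt_of_lt_one (sub_pos.2 hδ) (show (1 / 2 : ℝ) < 1 by norm_num)
  obtain ⟨ν, hν, ⟨C, hC, hle⟩, ht⟩ := exists_discPair_eq n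
  have m := measurable_scaleMap (1 / 2) 0 0
  have p := Measure.isProbabilityMeasure_map (μ := ν) m.aemeasurable
  refine ⟨ν.map (scaleMap (1 / 2) 0 0), p, ?_, ?_⟩
  · refine klDiv_ne_top_of_le_smul (C := C * (4 / (1 + ℓ))) (by positivity) ?_
    rw [ENNReal.ofReal_mul hC.le, mul_smul]
    exact (map_le_smul m hle).trans (measure_smul_mono _ (map_lebSq_half_le h0 h1))
  · rw [discPair_map_scaleMap (by norm_num), ht, pow_succ]
    have : (0 : ℝ) < (1 / 2) ^ n := by positivity
    linarith

lemma alphaSig_muL {ℓ : ℝ} (h0 : 0 ≤ ℓ) (h1 : ℓ ≤ 1) : alphaSig inv2 (muL ℓ) = 1 := by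
  have hB := isBase_muL h0 h1
  have hlt : ∀ δ, Gfun inv2 (muL ℓ) δ = ∞ → 1 ≤ δ := by
    intro δ h
    by_contra! hδ
    obtain ⟨ρ, hρ, hne, ht⟩ := exists_klDiv_ne_top h0 h1 hδ
    exact hB.Gfun_ne_top_of hne ht.le h
  have hgt : ∀ δ, 1 < δ → Gfun inv2 (muL ℓ) δ = ∞ := by
    intro δ h
    refine iInf₂_eq_top.2 fun ν hν => ?_
    have := hν.2
    rw [tPat_inv2] at this
    linarith [discPair_le_one (ν : Measure Ω2) (ν : Measure Ω2)]
  refine le_antisymm ?_ ?_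
  · refine le_of_forall_gt_imp_ge_of_dense fun δ h => ?_
    exact csInf_le ⟨1, fun δ h => hlt δ h⟩ (hgt δ h)
  · exact le_csInf ⟨2, hgt 2 (by norm_num)⟩ fun δ h => hlt δ h

end Affine

section NearTypical

lemma exists_integral_discMass_tilted_pos {μ : Measure Ω2} [IsProbabilityMeasure μ]
    (hcc : ¬ ∃ c ∈ Set.Icc (0 : ℝ) 1, ∀ᵐ z ∂μ, discMass μ z = c) {s : ℝ} (hs : 0 < s) :
    ∃ ρ : Measure Ω2, IsProbabilityMeasure ρ ∧ klDiv ρ μ ≠ ∞ ∧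
      0 < discPair μ ρ - discPair μ μ ∧
      (klDiv ρ μ).toReal ≤ s * (discPair μ ρ - discPair μ μ) := by
  have hm : Measurable fun z => s * discMass μ z := (measurable_discMass μ).const_mul s
  have hB := abs_mul_discMass_le μ s
  have hP := isProbabilityMeasure_tilted_of_abs_le (μ := μ) hm hB
  obtain ⟨hne, h1⟩ := klDiv_tilted_left_self (μ := μ) hm hB
  obtain ⟨-, h2⟩ := klDiv_tilted_right (ρ := μ) (μ := μ) hm hB (by simp)
  rw [integral_const_mul] at h1 h2
  rw [klDiv_self, ENNReal.toReal_zero] at h2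
  have hle : (klDiv (μ.tilted fun z => s * discMass μ z) μ).toReal ≤
      s * (discPair μ (μ.tilted fun z => s * discMass μ z) - discPair μ μ) := by
    rw [discPair, discPair]
    linarith [ENNReal.toReal_nonneg (a := klDiv μ (μ.tilted fun z => s * discMass μ z))]
  refine ⟨_, hP, hne, ?_, hle⟩
  by_contra! hcon
  have heq := eq_of_toReal_klDiv_nonpos hne (hle.trans (mul_nonpos_of_nonneg_of_nonpos hs.le hcon))
  have e1 := rnDeriv_tilted_left_self hm.aemeasurable (μ := μ)
  rw [heq] at e1
  have hae : ∀ᵐ z ∂μ, discMass μ z = Real.log (∫ x, Real.exp (s * discMass μ x) ∂μ) / s := by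
    filter_upwards [e1, Measure.rnDeriv_self μ] with z h h'
    rw [h', eq_comm, ENNReal.ofReal_eq_one, div_eq_one_iff_eq] at h
    · rw [← h, Real.log_exp]
      field_simp
    · intro h0
      rw [h0] at h
      simp at h
  obtain ⟨z, hz⟩ := hae.exists
  refine hcc ⟨_, ?_, hae⟩
  rw [← hz]
  exact ⟨discMass_nonneg _ _, discMass_le_one _ _⟩

theorem IsBase.exists_unique_isMinimizer_near {μ : Measure Ω2} (hμ : IsBase μ)
    (hcc : ¬ ∃ c ∈ Set.Icc (0 : ℝ) 1, ∀ᵐ z ∂μ, discMass μ z = c) :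
    ∃ δc, discPair μ μ < δc ∧ ∀ δ ∈ Set.Ico (discPair μ μ) δc,
      ∃ ν, IsMinimizer μ δ ν ∧ ∀ ν', IsMinimizer μ δ ν' → ν' = ν := by
  have := hμ.prob
  obtain ⟨τ, hτ, hne, hg, hD⟩ := exists_integral_discMass_tilted_pos hcc
    (s := 1 / 8) (by norm_num)
  set g := discPair μ τ - discPair μ μ with hgdef
  set δ₀ := discPair μ μ with hδ₀
  have hδ₀0 : 0 ≤ δ₀ := discPair_nonneg _ _
  have hδ₀1 : δ₀ ≤ 1 := discPair_le_one _ _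
  have hg1 : g ≤ 1 := by linarith [discPair_le_one μ τ]
  have hs0 : 0 ≤ g ^ 2 / 64 := by positivity
  have hs1 : g ^ 2 / 64 ≤ g / 3 := by nlinarith
  have hs2 : g ^ 2 / 64 ≤ 1 := by linarith
  have hsg : 0 < g ^ 2 / 64 * g := by positivity
  have hsg' : g ^ 2 / 64 * g ≤ g / 4 := by nlinarith
  refine ⟨δ₀ + g ^ 2 / 64 * g, by linarith, fun δ hδ => ?_⟩
  rcases hδ.1.eq_or_lt with h | hlt
  · exact ⟨μ, isMinimizer_self h.ge, fun ν' h' => h'.eq_self h.ge⟩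
  have hPm := isProbabilityMeasure_mixM μ τ hs0 hs2
  obtain ⟨hm1, hm2⟩ := klDiv_mixM μ τ (μ := μ) hs0 hs2 (by simp) hne
  have hmt : δ ≤ discPair (mixM (g ^ 2 / 64) μ τ) (mixM (g ^ 2 / 64) μ τ) := by
    rw [discPair_mixM μ τ hs0 hs2]
    have hT : discPair μ τ = δ₀ + g := by linarith
    rw [hT, ← hδ₀]
    have h3 := mul_nonneg (sq_nonneg (g ^ 2 / 64)) (discPair_nonneg τ τ)
    set t := g ^ 2 / 64
    have h4 : t * (δ₀ * t + 2 * g * t) ≤ t * g := by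
      refine mul_le_mul_of_nonneg_left ?_ hs0
      nlinarith [mul_le_mul_of_nonneg_right hδ₀1 hs0, mul_le_mul_of_nonneg_right hg1 hs0]
    nlinarith [hδ.2]
  have hm3 : (klDiv (mixM (g ^ 2 / 64) μ τ) μ).toReal ≤ (g / 8) ^ 2 := by
    refine hm2.trans ?_
    rw [klDiv_self, ENNReal.toReal_zero, mul_zero, zero_add]
    have : (klDiv τ μ).toReal ≤ 1 := by linarith
    nlinarith
  obtain ⟨ν, hν⟩ := hμ.exists_isMinimizer hPm hm1 hmt
  have hνP := hν.prob
  have hνD := (hν.min _ hPm hm1 hmt).trans hm3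
  have hclose := abs_integral_sub_le_sqrt_klDiv (measurable_discMass τ) (abs_discMass_le_one τ)
    hν.ne_top
  have hsq : √(klDiv ν μ).toReal ≤ g / 8 := Real.sqrt_le_iff.2 ⟨by positivity, hνD⟩
  have hT : g / 2 ≤ discPair ν τ - δ := by
    have h1 := (abs_le.1 hclose).1
    change -_ ≤ discPair τ ν - discPair τ μ at h1
    rw [discPair_comm τ ν, discPair_comm τ μ] at h1
    linarith [hδ.2]
  obtain ⟨θ, hθ, hEL⟩ := hν.exists_tilted hlt hne (by linarith : δ < discPair ν τ)
  refine ⟨ν, hν, fun ν' hν' => hν.eq_of_theta_lt hlt hν' hθ.le ?_ hEL⟩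
  obtain ⟨-, h2⟩ := klDiv_eq_of_eq_tilted hEL hν.ne_top hne
  rw [hν.discPair_self_eq hlt] at h2
  have h3 := ENNReal.toReal_nonneg (a := klDiv τ ν)
  have h4 := ENNReal.toReal_nonneg (a := klDiv ν μ)
  by_contra! hcon
  nlinarith [mul_le_mul hcon hT (by positivity) hθ.le]

lemma IsBase.image_Omap_eq_singleton {μ : Measure Ω2} (hμ : IsBase μ) {δ : ℝ}
    (h : ∃ ν, IsMinimizer μ δ ν ∧ ∀ ν', IsMinimizer μ δ ν' → ν' = ν) :
    ∃ m : Measure Ω2,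
      (fun ν : ProbabilityMeasure Ω2 => Omap (ν : Measure Ω2)) '' Gset inv2 μ δ = {m} := by
  obtain ⟨ν, hν, huniq⟩ := h
  refine ⟨Omap ν, ?_⟩
  have hP := hν.prob
  have hfin := hμ.Gfun_ne_top_of hν.ne_top hν.le
  ext m
  simp only [Set.mem_image, Set.mem_singleton_iff]
  constructor
  · rintro ⟨ν', h', rfl⟩
    rw [huniq _ ((hμ.mem_Gset_iff hfin ν').1 h')]
  · rintro rfl
    exact ⟨_, hν.mem_Gset hμ, rfl⟩

end NearTypical

section UniformTilt

/-- `ν` is a tilt of Lebesgue measure on the unit square satisfying the Euler–Lagrange equation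
with multiplier `θ`. -/
structure IsUnifTilt (θ : ℝ) (ν : Measure Ω2) : Prop where
  prob : IsProbabilityMeasure ν
  cont : Continuous (discMass ν)
  eq : ν = lebSq.tilted (fun z => θ * discMass ν z)

/-- The density of `ν` when `ν` is a tilt as in `IsUnifTilt`. -/
def tiltDensity (θ : ℝ) (ν : Measure Ω2) (z : Ω2) : ℝ :=
  Real.exp (θ * discMass ν z) / ∫ w, Real.exp (θ * discMass ν w) ∂lebSq

/-- The partial integral in the second variable of the density of `ν`. -/
def partialMass (θ : ℝ) (ν : Measure Ω2) (x y : ℝ) : ℝ :=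
  ∫ t in (0 : ℝ)..y, tiltDensity θ ν (x, t)

lemma setIntegral_unif01_Iic (f : ℝ → ℝ) {x : ℝ} (h0 : 0 ≤ x) (h1 : x ≤ 1) :
    ∫ t in Set.Iic x, f t ∂unif01 = ∫ t in (0 : ℝ)..x, f t := by
  have : Set.Iic x ∩ Set.Icc 0 1 = Set.Icc 0 x := by
    ext y; simp only [Set.mem_inter_iff, Set.mem_Iic, Set.mem_Icc]
    constructor
    · rintro ⟨a, b, c⟩; exact ⟨b, a⟩
    · rintro ⟨a, b⟩; exact ⟨b, a, by linarith⟩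
  rw [unif01, Measure.restrict_restrict measurableSet_Iic, this, integral_Icc_eq_integral_Ioc,
    intervalIntegral.integral_of_le h0]

namespace IsUnifTilt

variable {θ : ℝ} {ν : Measure Ω2}

lemma partition_pos (h : IsUnifTilt θ ν) : 0 < ∫ w, Real.exp (θ * discMass ν w) ∂lebSq := by
  have := h.prob
  exact integral_exp_pos (integrable_exp_of_abs_le ((measurable_discMass ν).const_mul θ)
    (abs_mul_discMass_le ν θ))

lemma density_pos (h : IsUnifTilt θ ν) (z : Ω2) : 0 < tiltDensity θ ν z :=
  div_pos (Real.exp_pos _) h.partition_pos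

lemma continuous_density (h : IsUnifTilt θ ν) : Continuous (tiltDensity θ ν) := by
  have := h.cont
  unfold tiltDensity
  fun_prop

lemma density_le (h : IsUnifTilt θ ν) (z : Ω2) :
    tiltDensity θ ν z ≤ Real.exp |θ| / ∫ w, Real.exp (θ * discMass ν w) ∂lebSq := by
  have := h.prob
  exact div_le_div_of_nonneg_right
    (Real.exp_le_exp.2 ((le_abs_self _).trans (abs_mul_discMass_le ν θ z))) h.partition_pos.le

lemma integrable_density (h : IsUnifTilt θ ν) : Integrable (tiltDensity θ ν) lebSq :=
  h.continuous_density.continuousOn.integrableOn_compact (isCompact_Icc.prod isCompact_Icc)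

lemma real_eq (h : IsUnifTilt θ ν) {s : Set Ω2} (hs : MeasurableSet s) :
    ν.real s = ∫ z in s, tiltDensity θ ν z ∂lebSq := by
  conv_lhs => rw [h.eq]
  rw [Measure.real, tilted_apply_eq_ofReal_integral' _ hs]
  exact ENNReal.toReal_ofReal (integral_nonneg fun z => (h.density_pos z).le)

lemma real_prod (h : IsUnifTilt θ ν) {A B : Set ℝ} (hA : MeasurableSet A) (hB : MeasurableSet B) :
    ν.real (A ×ˢ B) = ∫ s in A, ∫ t in B, tiltDensity θ ν (s, t) ∂unif01 ∂unif01 := by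
  rw [h.real_eq (hA.prod hB), lebSq_eq_prod, setIntegral_prod]
  have := h.integrable_density
  rw [lebSq_eq_prod] at this
  exact this.integrableOn

lemma continuous_partialMass_left (h : IsUnifTilt θ ν) (y : ℝ) :
    Continuous fun x => partialMass θ ν x y :=
  intervalIntegral.continuous_parametric_intervalIntegral_of_continuous'
    (f := fun x t => tiltDensity θ ν (x, t)) h.continuous_density 0 y

lemma hasDerivAt_partialMass_right (h : IsUnifTilt θ ν) (x y : ℝ) :
    HasDerivAt (fun y => partialMass θ ν x y) (tiltDensity θ ν (x, y)) y := by
  have hc : Continuous fun t => tiltDensity θ ν (x, t) :=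
    h.continuous_density.comp (by fun_prop)
  exact (hc.integral_hasStrictDerivAt 0 y).hasDerivAt

lemma real_Iic_prod_Iic (h : IsUnifTilt θ ν) {x y : ℝ} (hx0 : 0 ≤ x) (hx1 : x ≤ 1) (hy0 : 0 ≤ y)
    (hy1 : y ≤ 1) :
    ν.real (Set.Iic x ×ˢ Set.Iic y) = ∫ s in (0 : ℝ)..x, partialMass θ ν s y := by
  rw [h.real_prod measurableSet_Iic measurableSet_Iic, setIntegral_unif01_Iic _ hx0 hx1]
  simp only [setIntegral_unif01_Iic _ hy0 hy1, partialMass]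

lemma ae_mem_unitSq (h : IsUnifTilt θ ν) : ∀ᵐ p ∂ν, p ∈ unitSq := by
  have hac : ν ≪ lebSq := h.eq ▸ tilted_absolutelyContinuous _ _
  exact hac lebSq_compl

lemma ae_ne_fst (h : IsUnifTilt θ ν) (x : ℝ) : ∀ᵐ p ∂ν, p.1 ≠ x := by
  have hac : ν ≪ lebSq := h.eq ▸ tilted_absolutelyContinuous _ _
  have hB := muL_zero ▸ isBase_muL (ℓ := 0) le_rfl zero_le_one
  refine hac (measure_mono_null (fun p hp => ?_) (le_antisymm ((hB.stripX x x).trans ?_) zero_le))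
  · have : p.1 = x := not_not.1 hp
    exact ⟨this.ge, this.le⟩
  · simp

lemma ae_ne_snd (h : IsUnifTilt θ ν) (y : ℝ) : ∀ᵐ p ∂ν, p.2 ≠ y := by
  have hac : ν ≪ lebSq := h.eq ▸ tilted_absolutelyContinuous _ _
  have hB := muL_zero ▸ isBase_muL (ℓ := 0) le_rfl zero_le_one
  refine hac (measure_mono_null (fun p hp => ?_) (le_antisymm ((hB.stripY y y).trans ?_) zero_le))
  · have : p.2 = y := not_not.1 hp
    exact ⟨this.ge, this.le⟩
  · simp

lemma discMass_eq_real (h : IsUnifTilt θ ν) {x y : ℝ} (hx1 : x ≤ 1) (hy1 : y ≤ 1) :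
    discMass ν (x, y) = ν.real (Set.Iic x ×ˢ Set.Iic 1) + ν.real (Set.Iic 1 ×ˢ Set.Iic y) -
      2 * ν.real (Set.Iic x ×ˢ Set.Iic y) := by
  have := h.prob
  have m : ∀ a b : ℝ, MeasurableSet (Set.Iic a ×ˢ Set.Iic b : Set Ω2) := fun a b =>
    measurableSet_Iic.prod measurableSet_Iic
  have e1 : ν.real (Set.Ioi x ×ˢ Set.Iio y) =
      ν.real ((Set.Iic 1 ×ˢ Set.Iic y) \ (Set.Iic x ×ˢ Set.Iic y)) := by
    refine measureReal_congr ?_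
    filter_upwards [h.ae_mem_unitSq, h.ae_ne_snd y] with p hp hp2
    have hp1 : p.1 ≤ 1 := hp.1.2
    refine propext ?_
    change (x < p.1 ∧ p.2 < y) ↔ ((p.1 ≤ 1 ∧ p.2 ≤ y) ∧ ¬ (p.1 ≤ x ∧ p.2 ≤ y))
    rw [lt_iff_le_and_ne (a := p.2), and_iff_left hp2]
    constructor
    · rintro ⟨a, b⟩; exact ⟨⟨hp1, b⟩, fun c => absurd c.1 (not_le.2 a)⟩
    · rintro ⟨⟨-, b⟩, c⟩; exact ⟨not_le.1 fun d => c ⟨d, b⟩, b⟩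
  have e2 : ν.real (Set.Iio x ×ˢ Set.Ioi y) =
      ν.real ((Set.Iic x ×ˢ Set.Iic 1) \ (Set.Iic x ×ˢ Set.Iic y)) := by
    refine measureReal_congr ?_
    filter_upwards [h.ae_mem_unitSq, h.ae_ne_fst x] with p hp hp2
    have hp1 : p.2 ≤ 1 := hp.2.2
    refine propext ?_
    change (p.1 < x ∧ y < p.2) ↔ ((p.1 ≤ x ∧ p.2 ≤ 1) ∧ ¬ (p.1 ≤ x ∧ p.2 ≤ y))
    rw [lt_iff_le_and_ne, and_iff_left hp2]
    constructor
    · rintro ⟨a, b⟩; exact ⟨⟨a, hp1⟩, fun c => absurd c.2 (not_le.2 b)⟩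
    · rintro ⟨⟨b, -⟩, c⟩; exact ⟨b, not_le.1 fun d => c ⟨b, d⟩⟩
  rw [discMass_eq, e1, e2, measureReal_sdiff (Set.prod_mono (Set.Iic_subset_Iic.2 hx1) le_rfl)
    (m _ _), measureReal_sdiff (Set.prod_mono le_rfl (Set.Iic_subset_Iic.2 hy1)) (m _ _)]
  ring

lemma discMass_eq_integral (h : IsUnifTilt θ ν) {x y : ℝ} (hx0 : 0 ≤ x) (hx1 : x ≤ 1)
    (hy0 : 0 ≤ y) (hy1 : y ≤ 1) :
    discMass ν (x, y) = ν.real (Set.Iic 1 ×ˢ Set.Iic y) +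
      ∫ s in (0 : ℝ)..x, (partialMass θ ν s 1 - 2 * partialMass θ ν s y) := by
  rw [h.discMass_eq_real hx1 hy1, h.real_Iic_prod_Iic hx0 hx1 zero_le_one le_rfl,
    h.real_Iic_prod_Iic hx0 hx1 hy0 hy1, intervalIntegral.integral_sub
      ((h.continuous_partialMass_left 1).intervalIntegrable _ _)
      (((h.continuous_partialMass_left y).const_mul 2).intervalIntegrable _ _),
    intervalIntegral.integral_const_mul]
  ring

lemma hasDerivAt_density (h : IsUnifTilt θ ν) {x y : ℝ} (hx : x ∈ Set.Ioo (0 : ℝ) 1)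
    (hy0 : 0 ≤ y) (hy1 : y ≤ 1) :
    HasDerivAt (fun x => tiltDensity θ ν (x, y))
      (tiltDensity θ ν (x, y) * (θ * (partialMass θ ν x 1 - 2 * partialMass θ ν x y))) x := by
  have hc : Continuous fun s => partialMass θ ν s 1 - 2 * partialMass θ ν s y :=
    (h.continuous_partialMass_left 1).sub ((h.continuous_partialMass_left y).const_mul 2)
  have hk : HasDerivAt (fun x => discMass ν (x, y))
      (partialMass θ ν x 1 - 2 * partialMass θ ν x y) x := by
    refine ((hc.integral_hasStrictDerivAt 0 x).hasDerivAt.const_add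
      (ν.real (Set.Iic 1 ×ˢ Set.Iic y))).congr_of_eventuallyEq ?_
    filter_upwards [isOpen_Ioo.mem_nhds hx] with s hs
    exact h.discMass_eq_integral hs.1.le hs.2.le hy0 hy1
  have := ((hk.const_mul θ).exp).div_const (∫ w, Real.exp (θ * discMass ν w) ∂lebSq)
  refine this.congr_deriv ?_
  rw [tiltDensity]
  ring

lemma partialMass_nonneg (h : IsUnifTilt θ ν) {x y : ℝ} (hy0 : 0 ≤ y) : 0 ≤ partialMass θ ν x y :=
  intervalIntegral.integral_nonneg hy0 fun _ _ => (h.density_pos _).le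

lemma partialMass_mono (h : IsUnifTilt θ ν) {x y y' : ℝ} (hy : y ≤ y') :
    partialMass θ ν x y ≤ partialMass θ ν x y' :=
  monotone_of_hasDerivAt_nonneg (fun y => h.hasDerivAt_partialMass_right x y)
    (fun _ => (h.density_pos _).le) hy

lemma partialMass_strictMono (h : IsUnifTilt θ ν) {x y y' : ℝ} (hy : y < y') :
    partialMass θ ν x y < partialMass θ ν x y' :=
  strictMono_of_hasDerivAt_pos (fun y => h.hasDerivAt_partialMass_right x y)
    (fun _ => h.density_pos _) hy

lemma partialMass_zero (x : ℝ) : partialMass θ ν x 0 = 0 := by simp [partialMass]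

/-- The partial masses of a tilt solve a logistic differential equation. -/
lemma hasDerivAt_partialMass (h : IsUnifTilt θ ν) {x y : ℝ} (hx : x ∈ Set.Ioo (0 : ℝ) 1)
    (hy0 : 0 ≤ y) (hy1 : y ≤ 1) :
    HasDerivAt (fun x => partialMass θ ν x y)
      (θ * (partialMass θ ν x 1 * partialMass θ ν x y - partialMass θ ν x y ^ 2)) x := by
  set C := Real.exp |θ| / ∫ w, Real.exp (θ * discMass ν w) ∂lebSq with hC
  have hcx : ∀ x, Continuous fun t => tiltDensity θ ν (x, t) := fun x =>
    h.continuous_density.comp (by fun_prop)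
  have hcp : ∀ x, Continuous fun t => partialMass θ ν x t := fun x =>
    continuous_iff_continuousAt.2 fun t => (h.hasDerivAt_partialMass_right x t).continuousAt
  have hF' : Continuous fun t => tiltDensity θ ν (x, t) *
      (θ * (partialMass θ ν x 1 - 2 * partialMass θ ν x t)) :=
    (hcx x).mul (continuous_const.mul (continuous_const.sub (continuous_const.mul (hcp x))))
  have hp1 : ∀ x, partialMass θ ν x 1 ≤ C := fun x => by
    have := intervalIntegral.integral_mono_on (μ := volume) (zero_le_one (α := ℝ)) ((hcx x).intervalIntegrable _ _)
      ((continuous_const (y := C)).intervalIntegrable _ _) fun t _ => h.density_le (x, t)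
    simpa [partialMass] using this
  have hC0 : 0 ≤ C := (h.density_pos (0, 0)).le.trans (h.density_le _)
  have key := (intervalIntegral.hasDerivAt_integral_of_dominated_loc_of_deriv_le (μ := volume)
    (𝕜 := ℝ) (a := 0) (b := y) (x₀ := x) (F := fun x t => tiltDensity θ ν (x, t))
    (F' := fun x t => tiltDensity θ ν (x, t) *
      (θ * (partialMass θ ν x 1 - 2 * partialMass θ ν x t)))
    (bound := fun _ => C * (|θ| * C)) (isOpen_Ioo.mem_nhds hx)
    (Eventually.of_forall fun x => (hcx x).aestronglyMeasurable)
    ((hcx x).intervalIntegrable _ _) hF'.aestronglyMeasurable ?_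
    (continuous_const.intervalIntegrable _ _) ?_).2
  · refine key.congr_deriv ?_
    have hd : ∀ t, HasDerivAt (fun t => θ * (partialMass θ ν x 1 * partialMass θ ν x t -
        partialMass θ ν x t ^ 2)) (tiltDensity θ ν (x, t) *
        (θ * (partialMass θ ν x 1 - 2 * partialMass θ ν x t))) t := fun t => by
      have h1 := h.hasDerivAt_partialMass_right x t
      refine (((h1.const_mul (partialMass θ ν x 1)).sub (h1.pow 2)).const_mul θ).congr_deriv ?_
      push_cast
      ring
    rw [intervalIntegral.integral_eq_sub_of_hasDerivAt (fun t _ => hd t)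
      (hF'.intervalIntegrable _ _), partialMass_zero]
    ring
  · refine ae_of_all _ fun t ht s hs => ?_
    rw [Set.uIoc_of_le hy0] at ht
    have a1 := h.partialMass_nonneg (x := s) ht.1.le
    have a2 := h.partialMass_mono (x := s) (ht.2.trans hy1)
    have a3 := hp1 s
    rw [Real.norm_eq_abs, abs_mul, abs_mul, abs_of_pos (h.density_pos _)]
    refine mul_le_mul (h.density_le _) (mul_le_mul_of_nonneg_left ?_ (abs_nonneg _))
      (by positivity) hC0
    rw [abs_le]
    constructor <;> linarith
  · refine ae_of_all _ fun t ht s hs => ?_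
    rw [Set.uIoc_of_le hy0] at ht
    exact h.hasDerivAt_density hs ht.1.le (ht.2.trans hy1)

lemma partialMass_one (h : IsUnifTilt θ ν) {x : ℝ} (hx0 : 0 ≤ x) (hx1 : x ≤ 1) :
    partialMass θ ν x 1 = 1 := by
  have := h.prob
  have hconst : ∀ x ∈ Set.Icc (0 : ℝ) 1, partialMass θ ν x 1 = partialMass θ ν 0 1 := by
    intro x hx
    have hd : ∀ x ∈ Set.Ioo (0 : ℝ) 1, HasDerivAt (fun x => partialMass θ ν x 1) 0 x :=
      fun x hx => (h.hasDerivAt_partialMass hx zero_le_one le_rfl).congr_deriv (by ring)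
    have hc := (h.continuous_partialMass_left 1).continuousOn (s := Set.Icc (0 : ℝ) 1)
    have hm : MonotoneOn (fun x => partialMass θ ν x 1) (Set.Icc 0 1) := by
      refine monotoneOn_of_deriv_nonneg (convex_Icc _ _) hc ?_ ?_ <;> rw [interior_Icc]
      · exact fun x hx => (hd x hx).differentiableAt.differentiableWithinAt
      · exact fun x hx => (hd x hx).deriv.ge
    have ha : AntitoneOn (fun x => partialMass θ ν x 1) (Set.Icc 0 1) := by
      refine antitoneOn_of_deriv_nonpos (convex_Icc _ _) hc ?_ ?_ <;> rw [interior_Icc]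
      · exact fun x hx => (hd x hx).differentiableAt.differentiableWithinAt
      · exact fun x hx => (hd x hx).deriv.le
    have h0 : (0 : ℝ) ∈ Set.Icc (0 : ℝ) 1 := ⟨le_rfl, zero_le_one⟩
    exact le_antisymm (ha h0 hx hx.1) (hm h0 hx hx.1)
  have htot : ν.real (Set.Iic 1 ×ˢ Set.Iic 1) = 1 := by
    rw [Measure.real, (mem_ae_iff_prob_eq_one (measurableSet_Iic.prod measurableSet_Iic)).1,
      ENNReal.toReal_one]
    filter_upwards [h.ae_mem_unitSq] with p hp
    exact ⟨hp.1.2, hp.2.2⟩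
  rw [h.real_Iic_prod_Iic zero_le_one le_rfl zero_le_one le_rfl,
    intervalIntegral.integral_congr (g := fun _ => partialMass θ ν 0 1)
      (fun x hx => hconst x (by rwa [Set.uIcc_of_le zero_le_one] at hx))] at htot
  rw [hconst x ⟨hx0, hx1⟩]
  simpa using htot

lemma real_Iic_prod_one (h : IsUnifTilt θ ν) {x : ℝ} (hx0 : 0 ≤ x) (hx1 : x ≤ 1) :
    ν.real (Set.Iic x ×ˢ Set.Iic 1) = x := by
  rw [h.real_Iic_prod_Iic hx0 hx1 zero_le_one le_rfl,
    intervalIntegral.integral_congr (g := fun _ => 1) (fun s hs => ?_)]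
  · simp
  · rw [Set.uIcc_of_le hx0] at hs
    exact h.partialMass_one hs.1 (hs.2.trans hx1)

lemma hasDerivAt_logit (h : IsUnifTilt θ ν) {x y : ℝ} (hx : x ∈ Set.Ioo (0 : ℝ) 1)
    (hy0 : 0 < y) (hy1 : y < 1) :
    HasDerivAt (fun x => Real.log (partialMass θ ν x y) - Real.log (1 - partialMass θ ν x y))
      θ x := by
  have h1 := h.partialMass_strictMono (x := x) hy0
  have h2 := h.partialMass_strictMono (x := x) hy1
  rw [partialMass_zero] at h1
  rw [h.partialMass_one hx.1.le hx.2.le] at h2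
  have hd := h.hasDerivAt_partialMass hx hy0.le hy1.le
  rw [h.partialMass_one hx.1.le hx.2.le] at hd
  refine ((hd.log h1.ne').sub ((hd.const_sub 1).log (by linarith))).congr_deriv ?_
  have h3 : 1 - partialMass θ ν x y ≠ 0 := by linarith
  field_simp
  ring

end IsUnifTilt

lemma integral_nonneg_of_sign_change {f : ℝ → ℝ} (hf : Continuous f) (hint : ∫ t in (0 : ℝ)..1, f t = 0)
    (hsign : ∀ s ∈ Set.Icc (0 : ℝ) 1, ∀ t ∈ Set.Icc (0 : ℝ) 1, s ≤ t → 0 ≤ f t → 0 ≤ f s)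
    {x : ℝ} (hx0 : 0 ≤ x) (hx1 : x ≤ 1) : 0 ≤ ∫ t in (0 : ℝ)..x, f t := by
  rcases le_total 0 (f x) with h | h
  · exact intervalIntegral.integral_nonneg hx0 fun t ht =>
      hsign t ⟨ht.1, ht.2.trans hx1⟩ x ⟨hx0, hx1⟩ ht.2 h
  · have hsplit := intervalIntegral.integral_add_adjacent_intervals (hf.intervalIntegrable 0 x)
      (hf.intervalIntegrable x 1) (μ := volume)
    by_cases h0 : f x = 0
    · exact intervalIntegral.integral_nonneg hx0 fun t ht =>
        hsign t ⟨ht.1, ht.2.trans hx1⟩ x ⟨hx0, hx1⟩ ht.2 h0.ge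
    have hneg : ∫ t in x..1, f t ≤ 0 := by
      rw [← neg_nonneg, ← intervalIntegral.integral_neg]
      refine intervalIntegral.integral_nonneg hx1 fun t ht => neg_nonneg.2 ?_
      by_contra! hcon
      have := hsign x ⟨hx0, hx1⟩ t ⟨hx0.trans ht.1, ht.2⟩ ht.1 hcon.le
      exact h0 (le_antisymm h this)
    linarith

theorem IsUnifTilt.discMass_le {θ θ' : ℝ} {ν ν' : Measure Ω2} (h : IsUnifTilt θ ν)
    (h' : IsUnifTilt θ' ν') (hθ : θ ≤ θ')
    (hY : ∀ y, 0 ≤ y → y ≤ 1 → ν.real (Set.Iic 1 ×ˢ Set.Iic y) = y)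
    (hY' : ∀ y, 0 ≤ y → y ≤ 1 → ν'.real (Set.Iic 1 ×ˢ Set.Iic y) = y) {z : Ω2}
    (hz : z ∈ unitSq) : discMass ν z ≤ discMass ν' z := by
  obtain ⟨x, y⟩ := z
  obtain ⟨⟨hx0, hx1⟩, hy0, hy1⟩ := hz
  simp only at hx0 hx1 hy0 hy1
  rw [h.discMass_eq_real hx1 hy1, h'.discMass_eq_real hx1 hy1, h.real_Iic_prod_one hx0 hx1,
    h'.real_Iic_prod_one hx0 hx1, hY y hy0 hy1, hY' y hy0 hy1]
  suffices ν'.real (Set.Iic x ×ˢ Set.Iic y) ≤ ν.real (Set.Iic x ×ˢ Set.Iic y) by linarith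
  have hE := h.real_Iic_prod_Iic hx0 hx1 hy0 hy1
  have hE' := h'.real_Iic_prod_Iic hx0 hx1 hy0 hy1
  have hi := fun a b => (h.continuous_partialMass_left y).intervalIntegrable (μ := volume) a b
  have hi' := fun a b => (h'.continuous_partialMass_left y).intervalIntegrable (μ := volume) a b
  rw [hE, hE', ← sub_nonneg, ← intervalIntegral.integral_sub (hi _ _) (hi' _ _)]
  refine integral_nonneg_of_sign_change
    (f := fun t => partialMass θ ν t y - partialMass θ' ν' t y) ((h.continuous_partialMass_left y).sub
    (h'.continuous_partialMass_left y)) ?_ ?_ hx0 hx1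
  · rw [intervalIntegral.integral_sub (hi _ _) (hi' _ _),
      ← h.real_Iic_prod_Iic zero_le_one le_rfl hy0 hy1,
      ← h'.real_Iic_prod_Iic zero_le_one le_rfl hy0 hy1, hY y hy0 hy1, hY' y hy0 hy1, sub_self]
  intro s hs t ht hst hft
  rcases hy0.eq_or_lt with h0 | hy0
  · rw [← h0, IsUnifTilt.partialMass_zero, IsUnifTilt.partialMass_zero, sub_self]
  rcases hy1.eq_or_lt with h1 | hy1
  · rw [h1, h.partialMass_one hs.1 hs.2, h'.partialMass_one hs.1 hs.2, sub_self]
  have hp : ∀ x ∈ Set.Icc (0 : ℝ) 1, partialMass θ ν x y ∈ Set.Ioo (0 : ℝ) 1 := fun x hx => by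
    have h1 := h.partialMass_strictMono (x := x) hy0
    have h2 := h.partialMass_strictMono (x := x) hy1
    rw [IsUnifTilt.partialMass_zero] at h1
    rw [h.partialMass_one hx.1 hx.2] at h2
    exact ⟨h1, h2⟩
  have hp' : ∀ x ∈ Set.Icc (0 : ℝ) 1, partialMass θ' ν' x y ∈ Set.Ioo (0 : ℝ) 1 := fun x hx => by
    have h1 := h'.partialMass_strictMono (x := x) hy0
    have h2 := h'.partialMass_strictMono (x := x) hy1
    rw [IsUnifTilt.partialMass_zero] at h1
    rw [h'.partialMass_one hx.1 hx.2] at h2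
    exact ⟨h1, h2⟩
  set q := fun x => partialMass θ ν x y with hq
  set q' := fun x => partialMass θ' ν' x y with hq'
  change 0 ≤ q s - q' s
  change 0 ≤ q t - q' t at hft
  have hm : MonotoneOn (fun x => (Real.log (q' x) - Real.log (1 - q' x)) -
      (Real.log (q x) - Real.log (1 - q x))) (Set.Icc 0 1) := by
    refine monotoneOn_of_deriv_nonneg (convex_Icc _ _) ?_ ?_ ?_
    · have c1 := (h.continuous_partialMass_left y).continuousOn (s := Set.Icc (0 : ℝ) 1)
      have c2 := (h'.continuous_partialMass_left y).continuousOn (s := Set.Icc (0 : ℝ) 1)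
      refine ContinuousOn.sub (ContinuousOn.sub (c2.log fun x hx => (hp' x hx).1.ne')
        ((continuousOn_const.sub c2).log fun x hx => (sub_pos.2 (hp' x hx).2).ne'))
        (ContinuousOn.sub (c1.log fun x hx => (hp x hx).1.ne')
        ((continuousOn_const.sub c1).log fun x hx => (sub_pos.2 (hp x hx).2).ne'))
    all_goals rw [interior_Icc]; intro x hx
    all_goals have hd := (h'.hasDerivAt_logit hx hy0 hy1).sub (h.hasDerivAt_logit hx hy0 hy1)
    · exact hd.differentiableAt.differentiableWithinAt
    · exact (sub_nonneg.2 hθ).trans hd.deriv.ge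
  have hle := hm hs ht hst
  simp only at hle
  obtain ⟨a1, a2⟩ := hp t ht
  obtain ⟨a3, a4⟩ := hp' t ht
  obtain ⟨b1, b2⟩ := hp s hs
  obtain ⟨b3, b4⟩ := hp' s hs
  by_contra! hcon
  have c1 := Real.log_le_log a3 (by linarith : q' t ≤ q t)
  have c2 := Real.log_le_log (sub_pos.2 a2) (by linarith : 1 - q t ≤ 1 - q' t)
  have c3 := Real.log_lt_log b1 (by linarith : q s < q' s)
  have c4 := Real.log_lt_log (sub_pos.2 b4) (by linarith : 1 - q' s < 1 - q s)
  linarith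

end UniformTilt

section Uniform

variable {μ ν : Measure Ω2} {δ : ℝ}

lemma IsMinimizer.absolutelyContinuous (h : IsMinimizer μ δ ν) : ν ≪ μ :=
  (klDiv_ne_top_iff.1 h.ne_top).1

lemma IsBase.ae_fst_ne (hμ : IsBase μ) (x : ℝ) : ∀ᵐ p ∂μ, p.1 ≠ x := by
  refine measure_mono_null (fun p hp => ?_) (le_antisymm ((hμ.stripX x x).trans ?_) zero_le)
  · have : p.1 = x := not_not.1 hp
    exact ⟨this.ge, this.le⟩
  · simp

lemma IsBase.ae_snd_ne (hμ : IsBase μ) (y : ℝ) : ∀ᵐ p ∂μ, p.2 ≠ y := by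
  refine measure_mono_null (fun p hp => ?_) (le_antisymm ((hμ.stripY y y).trans ?_) zero_le)
  · have : p.2 = y := not_not.1 hp
    exact ⟨this.ge, this.le⟩
  · simp

lemma mem_msupport_of_restrict_le {O : Set Ω2} (hO : IsOpen O) {c : ℝ≥0∞} (hc : c ≠ 0)
    (hle : c • volume.restrict O ≤ μ) {z : Ω2} (hz : z ∈ closure O) : z ∈ msupport μ := by
  intro U hU hzU
  refine lt_of_lt_of_le ?_ (hle U)
  rw [Measure.smul_apply, smul_eq_mul, Measure.restrict_apply hU.measurableSet]
  exact ENNReal.mul_pos hc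
    ((hU.inter hO).measure_pos volume (mem_closure_iff.1 hz U hU hzU)).ne'

lemma mem_msupport_of_restrict_box_le {a b c d : ℝ} (hab : a < b) (hcd : c < d) {r : ℝ≥0∞}
    (hr : r ≠ 0) (hle : r • volume.restrict (Set.Icc a b ×ˢ Set.Icc c d) ≤ μ) {z : Ω2}
    (hz : z ∈ Set.Icc a b ×ˢ Set.Icc c d) : z ∈ msupport μ := by
  refine mem_msupport_of_restrict_le (isOpen_Ioo.prod isOpen_Ioo) hr
    ((measure_smul_mono r (Measure.restrict_mono
      (Set.prod_mono Set.Ioo_subset_Icc_self Set.Ioo_subset_Icc_self) le_rfl)).trans hle) ?_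
  rwa [closure_prod_eq, closure_Ioo hab.ne, closure_Ioo hcd.ne]

lemma unitSq_subset_msupport {ℓ : ℝ} (h1 : ℓ < 1) : unitSq ⊆ msupport (muL ℓ) := fun z hz =>
  mem_msupport_of_restrict_box_le zero_lt_one zero_lt_one (r := ENNReal.ofReal (1 - ℓ))
    (by simpa using h1) (Measure.le_add_right le_rfl) hz

/-- The Euler–Lagrange equation holds as soon as some support point forms inversions with
probability larger than the constraint level. -/
lemma IsMinimizer.exists_tilted_of_mem_msupport (hμ : IsBase μ) (h : IsMinimizer μ δ ν)
    (hδ : discPair μ μ < δ) {z : Ω2} (hz : z ∈ msupport μ) (hlt : δ < discMass ν z) :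
    ∃ θ : ℝ, 0 < θ ∧ ν = μ.tilted (fun z => θ * discMass ν z) := by
  have := hμ.prob
  have := h.prob
  obtain ⟨c, hc, hcz⟩ := exists_between hlt
  have hO : IsOpen {w | c < discMass ν w} :=
    isOpen_lt continuous_const (hμ.continuous_discMass h.ne_top)
  exact h.exists_tilted_of_set hδ hO.measurableSet (hz _ hO hcz).ne' hc fun w hw => hw.le

lemma discMass_zero_one (hμ : IsBase μ) [IsProbabilityMeasure ν] (hν : ν ≪ μ) :
    discMass ν (0, 1) = 1 := by
  have := hμ.prob
  rw [discMass, Measure.real, (mem_ae_iff_prob_eq_one (measurableSet_discordant _)).1,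
    ENNReal.toReal_one]
  filter_upwards [hν (ae_mem_unitSq hμ), hν (hμ.ae_fst_ne 0), hν (hμ.ae_snd_ne 1)] with p h1 h2 h3
  exact Or.inl ⟨lt_of_le_of_ne h1.1.1 (Ne.symm h2), lt_of_le_of_ne h1.2.2 h3⟩

lemma discPair_map_map (ν ρ : Measure Ω2) [IsProbabilityMeasure ν] {f : Ω2 → Ω2}
    (hf : Measurable f) (hd : ∀ z w, f w ∈ discordant (f z) ↔ w ∈ discordant z) :
    discPair (ν.map f) (ρ.map f) = discPair ν ρ := by
  have := Measure.isProbabilityMeasure_map (μ := ν) hf.aemeasurable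
  rw [discPair_map _ _ hf]
  refine integral_congr_ae (ae_of_all _ fun z => ?_)
  simp only [discMass]
  rw [map_measureReal_apply hf (measurableSet_discordant _)]
  congr 1
  exact Set.ext fun w => hd z w

lemma IsMinimizer.map [IsProbabilityMeasure μ] (h : IsMinimizer μ δ ν) {f : Ω2 → Ω2}
    (hf : Measurable f) (hμf : μ.map f = μ)
    (hd : ∀ z w, f w ∈ discordant (f z) ↔ w ∈ discordant z) : IsMinimizer μ δ (ν.map f) := by
  have := h.prob
  have hle : klDiv (ν.map f) μ ≤ klDiv ν μ := by
    conv_lhs => rw [← hμf]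
    exact klDiv_map_le ν μ hf
  exact ⟨Measure.isProbabilityMeasure_map hf.aemeasurable, ne_top_of_le_ne_top h.ne_top hle,
    (discPair_map_map ν ν hf hd).symm ▸ h.le, fun ρ hρ hne hρδ =>
    (ENNReal.toReal_mono h.ne_top hle).trans (h.min ρ hρ hne hρδ)⟩

lemma isBase_lebSq : IsBase lebSq := muL_zero ▸ isBase_muL le_rfl zero_le_one

lemma discPair_lebSq : discPair lebSq lebSq = 1 / 2 := by
  have := discPair_muL le_rfl zero_le_one
  rw [muL_zero] at this
  rw [this]
  norm_num

lemma IsMinimizer.exists_isUnifTilt (h : IsMinimizer lebSq δ ν) (h0 : 1 / 2 < δ) (h1 : δ < 1) :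
    ∃ θ : ℝ, 0 < θ ∧ IsUnifTilt θ ν := by
  have := h.prob
  obtain ⟨θ, hθ, he⟩ := h.exists_tilted_of_mem_msupport isBase_lebSq (by rwa [discPair_lebSq])
    (z := (0, 1)) (muL_zero ▸ unitSq_subset_msupport zero_lt_one (by simp [unitSq]))
    (by rwa [discMass_zero_one isBase_lebSq h.absolutelyContinuous])
  exact ⟨θ, hθ, h.prob, isBase_lebSq.continuous_discMass h.ne_top, he⟩

lemma IsMinimizer.real_Iic_one_prod (h : IsMinimizer lebSq δ ν) (h0 : 1 / 2 < δ) (h1 : δ < 1)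
    {y : ℝ} (hy0 : 0 ≤ y) (hy1 : y ≤ 1) : ν.real (Set.Iic 1 ×ˢ Set.Iic y) = y := by
  have hs : IsMinimizer lebSq δ (ν.map Prod.swap) := by
    refine h.map measurable_swap ?_ fun z w => ?_
    · rw [lebSq_eq_prod, Measure.prod_swap]
    · simp only [discordant, Set.mem_ofPred_eq, Prod.fst_swap, Prod.snd_swap]
      tauto
  obtain ⟨θ, -, hT⟩ := hs.exists_isUnifTilt h0 h1
  have h2 := hT.real_Iic_prod_one hy0 hy1
  rw [map_measureReal_apply measurable_swap (measurableSet_Iic.prod measurableSet_Iic),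
    Set.preimage_swap_prod] at h2
  exact h2

lemma exists_unique_isMinimizer_lebSq (h0 : 1 / 2 ≤ δ) (h1 : δ < 1) :
    ∃ ν, IsMinimizer lebSq δ ν ∧ ∀ ν', IsMinimizer lebSq δ ν' → ν' = ν := by
  rcases h0.eq_or_lt with h0 | h0
  · have hle : δ ≤ discPair lebSq lebSq := by rw [discPair_lebSq, h0]
    exact ⟨lebSq, isMinimizer_self hle, fun ν' h' => h'.eq_self hle⟩
  obtain ⟨ρ, hρ, hne, ht⟩ := exists_klDiv_ne_top le_rfl zero_le_one h1
  rw [muL_zero] at hne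
  obtain ⟨ν, hν⟩ := isBase_lebSq.exists_isMinimizer hρ hne ht.le
  have key : ∀ ν ν' : Measure Ω2, IsMinimizer lebSq δ ν → IsMinimizer lebSq δ ν' → ∀ θ θ' : ℝ,
      0 < θ → IsUnifTilt θ ν → IsUnifTilt θ' ν' → θ ≤ θ' → ν' = ν := by
    intro ν ν' hν hν' θ θ' hθ hT hT' hle
    refine hν.eq_of_discMass_le hν' hθ.le hT.eq ?_
    filter_upwards [ae_mem_unitSq isBase_lebSq] with z hz
    exact hT.discMass_le hT' hle (fun y a b => hν.real_Iic_one_prod h0 h1 a b)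
      (fun y a b => hν'.real_Iic_one_prod h0 h1 a b) hz
  refine ⟨ν, hν, fun ν' hν' => ?_⟩
  obtain ⟨θ, hθ, hT⟩ := hν.exists_isUnifTilt h0 h1
  obtain ⟨θ', hθ', hT'⟩ := hν'.exists_isUnifTilt h0 h1
  rcases le_total θ θ' with hle | hle
  · exact key _ _ hν hν' _ _ hθ hT hT' hle
  · exact (key _ _ hν' hν _ _ hθ' hT' hT hle).symm

end Uniform

section Blocks

variable {ν : Measure Ω2} {δ ℓ : ℝ}

/-- The lower of the two diagonal blocks of the unit square, on which `muL ℓ` has density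
`1 + ℓ`. -/
def lowerBlock : Set Ω2 := Set.Iic (1 / 2) ×ˢ Set.Iic (1 / 2)

/-- The upper diagonal block, see `lowerBlock`. -/
def upperBlock : Set Ω2 := Set.Ioi (1 / 2) ×ˢ Set.Ioi (1 / 2)

lemma measurableSet_lowerBlock : MeasurableSet lowerBlock := measurableSet_Iic.prod measurableSet_Iic

lemma measurableSet_upperBlock : MeasurableSet upperBlock := measurableSet_Ioi.prod measurableSet_Ioi

lemma disjoint_blocks : Disjoint lowerBlock upperBlock :=
  Set.disjoint_left.2 fun _ h h' => (Set.mem_Iic.1 h.1).not_gt (Set.mem_Ioi.1 h'.1)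

lemma muLDensity_eq_indicator (ℓ : ℝ) (p : Ω2) : muLDensity ℓ p =
    1 - ℓ + (lowerBlock ∪ upperBlock).indicator (fun _ => 2 * ℓ) p := by
  rcases le_or_gt p.1 (1 / 2) with h1 | h1 <;> rcases le_or_gt p.2 (1 / 2) with h2 | h2
  · rw [Set.indicator_of_mem (Set.mem_union_left _ (show p ∈ lowerBlock from ⟨h1, h2⟩)),
      muLDensity, halfSign_of_le h1, halfSign_of_le h2]
    ring
  · rw [Set.indicator_of_notMem, muLDensity, halfSign_of_le h1, halfSign_of_lt h2]
    · ring
    · rintro (h | h)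
      · exact (Set.mem_Iic.1 h.2).not_gt h2
      · exact (Set.mem_Ioi.1 h.1).not_ge h1
  · rw [Set.indicator_of_notMem, muLDensity, halfSign_of_lt h1, halfSign_of_le h2]
    · ring
    · rintro (h | h)
      · exact (Set.mem_Iic.1 h.1).not_gt h1
      · exact (Set.mem_Ioi.1 h.2).not_ge h2
  · rw [Set.indicator_of_mem (Set.mem_union_right _ (show p ∈ upperBlock from ⟨h1, h2⟩)),
      muLDensity, halfSign_of_lt h1, halfSign_of_lt h2]
    ring

lemma measurableSet_blocks : MeasurableSet (lowerBlock ∪ upperBlock) :=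
  measurableSet_lowerBlock.union measurableSet_upperBlock

lemma ae_mem_blocks : ∀ᵐ p ∂muL 1, p ∈ lowerBlock ∪ upperBlock := by
  change muL 1 (lowerBlock ∪ upperBlock)ᶜ = 0
  rw [muL_eq_withDensity zero_le_one le_rfl, withDensity_apply _ measurableSet_blocks.compl,
    setLIntegral_congr_fun (g := fun _ => 0) measurableSet_blocks.compl fun p hp => ?_]
  · simp
  · simp only [muLDensity_eq_indicator, Set.indicator_of_notMem hp]
    simp

lemma discPair_self_le_blocks (ν : Measure Ω2) [IsProbabilityMeasure ν] :
    discPair ν ν ≤ 1 - 2 * (ν.real lowerBlock * ν.real upperBlock) := by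
  have hpt : ∀ z, discMass ν z ≤ 1 - (lowerBlock.indicator (fun _ => ν.real upperBlock) z +
      upperBlock.indicator (fun _ => ν.real lowerBlock) z) := by
    intro z
    have key : ∀ {A B : Set Ω2}, MeasurableSet B → (∀ w ∈ B, z ∈ A → w ∉ discordant z) → z ∈ A →
        discMass ν z ≤ 1 - ν.real B := fun {A B} hB h hz => by
      rw [← probReal_compl_eq_one_sub hB]
      exact measureReal_mono fun w hw hwB => h w hwB hz hw
    by_cases h1 : z ∈ lowerBlock
    · rw [Set.indicator_of_mem h1, Set.indicator_of_notMem (Set.disjoint_left.1 disjoint_blocks h1),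
        add_zero]
      refine key (A := lowerBlock) measurableSet_upperBlock (fun w hw hz hd => ?_) h1
      rcases hd with ⟨-, hd⟩ | ⟨hd, -⟩
      · exact absurd (hd.trans_le hz.2) (not_lt.2 (le_of_lt hw.2))
      · exact absurd (hd.trans_le hz.1) (not_lt.2 (le_of_lt hw.1))
    · rw [Set.indicator_of_notMem h1, zero_add]
      by_cases h2 : z ∈ upperBlock
      · rw [Set.indicator_of_mem h2]
        refine key (A := upperBlock) measurableSet_lowerBlock (fun w hw hz hd => ?_) h2
        rcases hd with ⟨hd, -⟩ | ⟨-, hd⟩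
        · exact absurd (hd.trans_le hw.1) (not_lt.2 (le_of_lt hz.1))
        · exact absurd (hd.trans_le hw.2) (not_lt.2 (le_of_lt hz.2))
      · rw [Set.indicator_of_notMem h2, sub_zero]
        exact discMass_le_one ν z
  have i1 : Integrable (lowerBlock.indicator (fun _ => ν.real upperBlock)) ν :=
    (integrable_const _).indicator measurableSet_lowerBlock
  have i2 : Integrable (upperBlock.indicator (fun _ => ν.real lowerBlock)) ν :=
    (integrable_const _).indicator measurableSet_upperBlock
  have i12 : Integrable (fun z => lowerBlock.indicator (fun _ => ν.real upperBlock) z +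
      upperBlock.indicator (fun _ => ν.real lowerBlock) z) ν := i1.add i2
  have h := integral_mono (integrable_discMass ν ν)
    ((integrable_const (1 : ℝ)).sub i12) hpt
  refine h.trans_eq ?_
  change ∫ z, (1 - (lowerBlock.indicator (fun _ => ν.real upperBlock) z +
      upperBlock.indicator (fun _ => ν.real lowerBlock) z)) ∂ν = _
  rw [integral_sub (integrable_const _) i12, integral_add i1 i2,
    integral_indicator measurableSet_lowerBlock, integral_indicator measurableSet_upperBlock]
  simp only [integral_const, smul_eq_mul, probReal_univ, measureReal_restrict_apply_univ]
  ring

lemma muL_eq_tilted (h0 : 0 ≤ ℓ) (h1 : ℓ < 1) :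
    muL ℓ = lebSq.tilted fun p => Real.log (muLDensity ℓ p) := by
  have hpos : ∀ p, 0 < muLDensity ℓ p := fun p => by linarith [(muLDensity_mem h0 p).1]
  have hP := isProbabilityMeasure_muL h0 h1.le
  have hint : ∫ p, muLDensity ℓ p ∂lebSq = 1 := by
    have := integral_muL h0 h1.le fun _ => 1
    simpa using this.symm
  rw [muL_eq_withDensity h0 h1.le, Measure.tilted]
  simp only [Real.exp_log (hpos _), hint, div_one]

/-- A minimizer for a base measure close to the degenerate one puts most of its mass on the two
diagonal blocks. -/
lemma IsMinimizer.three_quarters_le (h0 : 255 / 257 < ℓ) (h1 : ℓ ≤ 1)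
    (h : IsMinimizer (muL ℓ) δ ν) : 3 / 4 ≤ ν.real (lowerBlock ∪ upperBlock) := by
  have hl0 : 0 ≤ ℓ := by linarith
  have hP := isProbabilityMeasure_muL hl0 h1
  have := h.prob
  have hm := measurableSet_blocks
  rcases h1.eq_or_lt with rfl | h1
  · rw [Measure.real, (mem_ae_iff_prob_eq_one hm).1 (h.absolutelyContinuous.ae_le ae_mem_blocks)]
    norm_num
  have hpos : ∀ p, 1 - ℓ ≤ muLDensity ℓ p := fun p => (muLDensity_mem hl0 p).1
  have hl : 0 < 1 - ℓ := by linarith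
  set f : Ω2 → ℝ := fun p => Real.log (muLDensity ℓ p) with hf
  have hfm : Measurable f := (measurable_muLDensity ℓ).log
  set L := Real.log (1 + ℓ) - Real.log (1 - ℓ) with hL
  have hfe : ∀ p, f p = Real.log (1 - ℓ) +
      (lowerBlock ∪ upperBlock).indicator (fun _ => L) p := fun p => by
    by_cases hp : p ∈ lowerBlock ∪ upperBlock
    · rw [hf, Set.indicator_of_mem hp]
      simp only [muLDensity_eq_indicator, Set.indicator_of_mem hp, hL]
      ring_nf
    · rw [hf, Set.indicator_of_notMem hp]
      simp only [muLDensity_eq_indicator, Set.indicator_of_notMem hp, add_zero]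
  have hL0 : 4 * Real.log 4 ≤ L := by
    rw [hL, ← Real.log_div (by linarith) hl.ne',
      show 4 * Real.log 4 = Real.log (4 ^ 4) by rw [Real.log_pow]; norm_num]
    refine Real.log_le_log (by norm_num) ?_
    rw [le_div_iff₀ hl]
    linarith
  have h4 : 0 < Real.log 4 := Real.log_pos (by norm_num)
  have hfB : ∀ p, |f p| ≤ |Real.log (1 - ℓ)| + |L| := fun p => by
    rw [hfe]
    refine (abs_add_le _ _).trans (add_le_add le_rfl ?_)
    unfold Set.indicator
    split_ifs <;> simp
  have hint : ∫ p, f p ∂ν = Real.log (1 - ℓ) + L * ν.real (lowerBlock ∪ upperBlock) := by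
    simp only [hfe]
    rw [integral_add (integrable_const _) ((integrable_const _).indicator hm),
      integral_indicator hm]
    simp [mul_comm]
  obtain ⟨hne, -⟩ := klDiv_le_of_le_smul (by linarith : (0 : ℝ) < 1 + ℓ) (muL_le hl0 h1.le) h.ne_top
  obtain ⟨-, h2⟩ := klDiv_tilted_right hfm hfB hne
  rw [← muL_eq_tilted hl0 h1, hint] at h2
  have hexp : ∫ p, Real.exp (f p) ∂lebSq = 1 := by
    have := integral_muL hl0 h1.le fun _ => 1
    simp only [integral_const, probReal_univ, smul_eq_mul, mul_one] at this
    rw [this]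
    exact integral_congr_ae (ae_of_all _ fun p => Real.exp_log (hl.trans_le (hpos p)))
  rw [hexp, Real.log_one, sub_zero] at h2
  have ms := measurable_scaleMap (1 / 2) 0 0
  have p1 := Measure.isProbabilityMeasure_map (μ := ν) ms.aemeasurable
  have p2 := Measure.isProbabilityMeasure_map (μ := lebSq) ms.aemeasurable
  have hle := klDiv_map_le ν lebSq ms
  obtain ⟨h3, h5⟩ := klDiv_le_of_le_smul (by positivity : (0 : ℝ) < 4 / (1 + ℓ))
    (map_lebSq_half_le hl0 h1.le) (ne_top_of_le_ne_top hne hle)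
  have h6 := h.min _ p1 h3 (by rw [discPair_map_scaleMap (by norm_num)]; exact h.le)
  have h7 := ENNReal.toReal_mono hne hle
  rw [Real.log_div (by norm_num) (by linarith)] at h5
  nlinarith

lemma IsMinimizer.real_Iic_half_ne (h0 : 255 / 257 < ℓ) (h1 : ℓ ≤ 1) (hδ : 7 / 8 < δ)
    (h : IsMinimizer (muL ℓ) δ ν) : ν.real {p | p.1 ≤ 1 / 2} ≠ 1 / 2 := by
  have := h.prob
  have hw := h.three_quarters_le h0 h1
  rw [measureReal_union disjoint_blocks measurableSet_upperBlock] at hw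
  have hpq := h.le.trans (discPair_self_le_blocks ν)
  intro he
  have hp : ν.real lowerBlock ≤ 1 / 2 := he ▸ measureReal_mono fun w hw => hw.1
  have hq : ν.real upperBlock ≤ 1 / 2 := by
    have hm : MeasurableSet {p : Ω2 | p.1 ≤ 1 / 2} := measurableSet_le measurable_fst measurable_const
    have : ν.real {p : Ω2 | p.1 ≤ 1 / 2}ᶜ = 1 / 2 := by
      rw [probReal_compl_eq_one_sub hm, he]; norm_num
    rw [← this]
    exact measureReal_mono fun w hw => (not_le.2 (Set.mem_Ioi.1 hw.1) : ¬ w.1 ≤ 1 / 2)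
  nlinarith [mul_nonneg (sub_nonneg.2 hp) (sub_nonneg.2 hq)]

lemma box_subset_msupport (h0 : 0 < ℓ) {z : Ω2}
    (hz : z ∈ Set.Icc (0 : ℝ) (1 / 2) ×ˢ Set.Icc (0 : ℝ) (1 / 2) ∪
      Set.Icc (1 / 2 : ℝ) 1 ×ˢ Set.Icc (1 / 2 : ℝ) 1) : z ∈ msupport (muL ℓ) := by
  have hr : ENNReal.ofReal ℓ * 2 ≠ 0 := by simp [h0]
  have hle : ENNReal.ofReal ℓ • mu1M ≤ muL ℓ := Measure.le_add_left le_rfl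
  rcases hz with hz | hz
  · refine mem_msupport_of_restrict_box_le (by norm_num) (by norm_num) hr (le_trans ?_ hle) hz
    rw [← smul_smul]
    exact measure_smul_mono _ (Measure.le_add_right le_rfl)
  · refine mem_msupport_of_restrict_box_le (by norm_num) (by norm_num) hr (le_trans ?_ hle) hz
    rw [← smul_smul]
    exact measure_smul_mono _ (Measure.le_add_left le_rfl)

lemma IsMinimizer.exists_tilted_muL (h0 : 255 / 257 < ℓ) (h1 : ℓ ≤ 1) (hδ : 7 / 8 < δ) (hδ1 : δ < 1)
    (h : IsMinimizer (muL ℓ) δ ν) :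
    ∃ θ : ℝ, 0 < θ ∧ ν = (muL ℓ).tilted (fun z => θ * discMass ν z) := by
  have hl0 : 0 ≤ ℓ := by linarith
  have hB := isBase_muL hl0 h1
  have hP := isProbabilityMeasure_muL hl0 h1
  have := h.prob
  have hlt : discPair (muL ℓ) (muL ℓ) < δ := by rw [discPair_muL hl0 h1]; linarith
  rcases h1.eq_or_lt with rfl | h1
  swap
  · exact h.exists_tilted_of_mem_msupport hB hlt (z := (0, 1))
      (unitSq_subset_msupport h1 (by simp [unitSq]))
      (by rwa [discMass_zero_one hB h.absolutelyContinuous])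
  have hac := h.absolutelyContinuous
  have hw : ν.real lowerBlock + ν.real upperBlock = 1 := by
    rw [← measureReal_union disjoint_blocks measurableSet_upperBlock, Measure.real,
      (mem_ae_iff_prob_eq_one measurableSet_blocks).1 (hac.ae_le ae_mem_blocks), ENNReal.toReal_one]
  have hpq := h.le.trans (discPair_self_le_blocks ν)
  have hp : ν.real lowerBlock ≤ discMass ν (0, 1 / 2) := by
    refine ENNReal.toReal_mono (measure_ne_top _ _) (measure_mono_ae ?_)
    filter_upwards [hac.ae_le (ae_mem_unitSq hB), hac.ae_le (hB.ae_fst_ne 0),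
      hac.ae_le (hB.ae_snd_ne (1 / 2))] with p h2 h3 h4 h5
    exact Or.inl ⟨lt_of_le_of_ne h2.1.1 (Ne.symm h3), lt_of_le_of_ne h5.2 h4⟩
  have hq : ν.real upperBlock ≤ discMass ν (1 / 2, 1) := by
    refine ENNReal.toReal_mono (measure_ne_top _ _) (measure_mono_ae ?_)
    filter_upwards [hac.ae_le (ae_mem_unitSq hB), hac.ae_le (hB.ae_snd_ne 1)] with p h2 h4 h5
    exact Or.inl ⟨h5.1, lt_of_le_of_ne h2.2.2 h4⟩
  have hmax : δ < ν.real lowerBlock ∨ δ < ν.real upperBlock := by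
    by_contra! hcon
    nlinarith [mul_nonneg (sub_nonneg.2 hcon.1) (sub_nonneg.2 hcon.2)]
  rcases hmax with hm | hm
  · exact h.exists_tilted_of_mem_msupport hB hlt (z := (0, 1 / 2))
      (box_subset_msupport zero_lt_one (Or.inl (by norm_num))) (hm.trans_le hp)
  · exact h.exists_tilted_of_mem_msupport hB hlt (z := (1 / 2, 1))
      (box_subset_msupport zero_lt_one (Or.inr (by norm_num))) (hm.trans_le hq)

end Blocks

section Kink

/-- A tilted measure with continuous bounded exponent is, near a point, comparable to a multiple of
the base measure, with a comparison constant as close to one as desired. -/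
lemma exists_nhds_tilted_le {μ : Measure Ω2} [IsProbabilityMeasure μ] {f : Ω2 → ℝ}
    (hf : Continuous f) {B : ℝ} (hB : ∀ x, |f x| ≤ B) {K : ℝ} (hK : 1 < K) (z₀ : Ω2) :
    ∃ U ∈ 𝓝 z₀, ∃ m : ℝ, 0 < m ∧ ∀ S : Set Ω2, MeasurableSet S → S ⊆ U →
      m * μ.real S ≤ (μ.tilted f).real S ∧ (μ.tilted f).real S ≤ K * (m * μ.real S) := by
  set g : Ω2 → ℝ := fun z => Real.exp (f z) / ∫ x, Real.exp (f x) ∂μ with hg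
  have hint := integrable_exp_of_abs_le (μ := μ) hf.measurable hB
  have hgc : Continuous g := by fun_prop
  have hg0 : 0 < g z₀ := div_pos (Real.exp_pos _) (integral_exp_pos hint)
  have hgi : Integrable g μ := hint.div_const _
  obtain ⟨m, hm1, hm2⟩ := exists_between (div_lt_self hg0 hK)
  have hm : 0 < m := (div_pos hg0 (by linarith)).trans hm1
  refine ⟨{z | m < g z} ∩ {z | g z < K * m}, ((isOpen_lt continuous_const hgc).inter
    (isOpen_lt hgc continuous_const)).mem_nhds ⟨hm2, ?_⟩, m, hm, fun S hS hSU => ?_⟩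
  · rw [div_lt_iff₀ (by linarith)] at hm1
    change g z₀ < K * m
    linarith
  have hreal : (μ.tilted f).real S = ∫ z in S, g z ∂μ := by
    rw [Measure.real, tilted_apply_eq_ofReal_integral f S, ENNReal.toReal_ofReal]
    exact integral_nonneg fun z => by positivity
  have hc : ∀ c : ℝ, ∫ _ in S, c ∂μ = c * μ.real S := fun c => by
    rw [setIntegral_const, smul_eq_mul, mul_comm]
  rw [hreal, ← mul_assoc, ← hc, ← hc]
  exact ⟨setIntegral_mono_on (integrable_const _) hgi.integrableOn hS fun z hz => (hSU hz).1.le,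
    setIntegral_mono_on hgi.integrableOn (integrable_const _) hS fun z hz => (hSU hz).2.le⟩

lemma eventually_exists_eq {F G : ℝ → ℝ} (hF : Continuous F) (hG : Continuous G) {x₀ a b : ℝ}
    (hab : a ≤ b) (ha : G a < F x₀) (hb : F x₀ < G b) :
    ∀ᶠ t in 𝓝 x₀, ∃ s ∈ Set.Icc a b, G s = F t := by
  filter_upwards [hF.continuousAt.eventually (lt_mem_nhds ha),
    hF.continuousAt.eventually (gt_mem_nhds hb)] with t h1 h2
  exact intermediate_value_Icc hab hG.continuousOn ⟨h1.le, h2.le⟩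

/-- Probability measures equivalent to `μ` whose inversion mass is continuous. -/
structure IsRegularFor (μ ν : Measure Ω2) : Prop where
  prob : IsProbabilityMeasure ν
  ac : ν ≪ μ
  ac_base : μ ≪ ν
  cont : Continuous (discMass ν)

variable {ν ν' : Measure Ω2} {ℓ δ : ℝ}

lemma muL_real_strip_fst (h0 : 0 ≤ ℓ) (h1 : ℓ ≤ 1) {A : Set ℝ} (hA : MeasurableSet A) :
    (muL ℓ).real (A ×ˢ Set.univ) = unif01.real A := by
  have : unif01.real Set.univ = 1 := by simp [unif01, Measure.real]
  rw [muL_real_prod h0 h1 hA MeasurableSet.univ, Measure.restrict_univ, integral_halfSign, this]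
  ring

lemma muL_real_strip_snd (h0 : 0 ≤ ℓ) (h1 : ℓ ≤ 1) {A : Set ℝ} (hA : MeasurableSet A) :
    (muL ℓ).real (Set.univ ×ˢ A) = unif01.real A := by
  have : unif01.real Set.univ = 1 := by simp [unif01, Measure.real]
  rw [muL_real_prod h0 h1 MeasurableSet.univ hA, Measure.restrict_univ, integral_halfSign, this]
  ring

lemma unif01_real_Ioc {a b : ℝ} (ha : 0 ≤ a) (hab : a ≤ b) (hb : b ≤ 1) :
    unif01.real (Set.Ioc a b) = b - a := by
  rw [Measure.real, unif01, Measure.restrict_apply measurableSet_Ioc, Set.inter_eq_left.2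
    (show Set.Ioc a b ⊆ Set.Icc 0 1 from fun x hx => ⟨ha.trans hx.1.le, hx.2.trans hb⟩), Real.volume_Ioc,
    ENNReal.toReal_ofReal (sub_nonneg.2 hab)]

/-- The properties of a distribution function on `[0,1]` used to transport points. -/
structure IsUnitCdf (F : ℝ → ℝ) : Prop where
  cont : Continuous F
  strictMonoOn : StrictMonoOn F (Set.Icc 0 1)
  zero : F 0 = 0
  one : F 1 = 1

lemma IsUnitCdf.exists_eq {F G : ℝ → ℝ} (hF : IsUnitCdf F) (hG : IsUnitCdf G) {x : ℝ}
    (hx : x ∈ Set.Ioo (0 : ℝ) 1) : ∃ y ∈ Set.Ioo (0 : ℝ) 1, G y = F x := by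
  have h0 : 0 < F x := hF.zero ▸ hF.strictMonoOn (by simp) (Set.Ioo_subset_Icc_self hx) hx.1
  have h1 : F x < 1 := by
    have := hF.strictMonoOn (Set.Ioo_subset_Icc_self hx) (by simp) hx.2
    rwa [hF.one] at this
  have := intermediate_value_Ioo zero_le_one hG.cont.continuousOn
  rw [hG.zero, hG.one] at this
  exact this ⟨h0, h1⟩

lemma cdfX_eq (h0 : 0 ≤ ℓ) (h1 : ℓ ≤ 1) [IsProbabilityMeasure ν] (hν : ν ≪ muL ℓ) (x : ℝ) :
    cdfX ν x = 1 - discMass ν (x, 1) := by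
  have hm : MeasurableSet {p : Ω2 | p.1 ≤ x} := measurableSet_le measurable_fst measurable_const
  have hB := isBase_muL h0 h1
  rw [discMass, ← probReal_compl_eq_one_sub (measurableSet_discordant _)]
  refine congrArg ENNReal.toReal (measure_congr ?_)
  filter_upwards [hν.ae_le (ae_mem_unitSq hB), hν.ae_le (hB.ae_snd_ne 1)] with p h2 h3
  have h4 : p.2 < 1 := lt_of_le_of_ne h2.2.2 h3
  refine propext ⟨fun (h : p.1 ≤ x) hd => ?_, fun hd => not_lt.1 fun h => hd (Or.inl ⟨h, h4⟩)⟩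
  rcases hd with hd | hd
  · exact h.not_gt hd.1
  · exact hd.2.not_ge h4.le

lemma cdfY_eq (h0 : 0 ≤ ℓ) (h1 : ℓ ≤ 1) [IsProbabilityMeasure ν] (hν : ν ≪ muL ℓ) (y : ℝ) :
    cdfY ν y = 1 - discMass ν (1, y) := by
  have hm : MeasurableSet {p : Ω2 | p.2 ≤ y} := measurableSet_le measurable_snd measurable_const
  have hB := isBase_muL h0 h1
  rw [discMass, ← probReal_compl_eq_one_sub (measurableSet_discordant _)]
  refine congrArg ENNReal.toReal (measure_congr ?_)
  filter_upwards [hν.ae_le (ae_mem_unitSq hB), hν.ae_le (hB.ae_fst_ne 1)] with p h2 h3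
  have h4 : p.1 < 1 := lt_of_le_of_ne h2.1.2 h3
  refine propext ⟨fun (h : p.2 ≤ y) hd => ?_, fun hd => not_lt.1 fun h => hd (Or.inr ⟨h4, h⟩)⟩
  rcases hd with hd | hd
  · exact hd.1.not_ge h4.le
  · exact h.not_gt hd.2

lemma IsRegularFor.real_pos (h : IsRegularFor (muL ℓ) ν) {S : Set Ω2} (hS : 0 < (muL ℓ).real S) :
    0 < ν.real S := by
  have := h.prob
  refine ENNReal.toReal_pos (fun h' => hS.ne' ?_) (by simp)
  rw [Measure.real, h.ac_base h', ENNReal.toReal_zero]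

lemma IsRegularFor.isUnitCdf_cdfX (h0 : 0 ≤ ℓ) (h1 : ℓ ≤ 1) (h : IsRegularFor (muL ℓ) ν) :
    IsUnitCdf (cdfX ν) := by
  have := h.prob
  have hB := isBase_muL h0 h1
  have hm : ∀ x, MeasurableSet {p : Ω2 | p.1 ≤ x} := fun x =>
    measurableSet_le measurable_fst measurable_const
  refine ⟨?_, fun a ha b hb hab => ?_, ?_, ?_⟩
  · simp only [funext (cdfX_eq h0 h1 h.ac)]
    exact continuous_const.sub (h.cont.comp (by fun_prop))
  · have hpos := h.real_pos (S := Set.Ioc a b ×ˢ Set.univ) (by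
      rw [muL_real_strip_fst h0 h1 measurableSet_Ioc, unif01_real_Ioc ha.1 hab.le hb.2]
      exact sub_pos.2 hab)
    have e : {p : Ω2 | p.1 ≤ b} \ {p : Ω2 | p.1 ≤ a} = Set.Ioc a b ×ˢ Set.univ := by
      ext p; simp [and_comm]
    rw [← e, measureReal_sdiff (show {p : Ω2 | p.1 ≤ a} ⊆ {p | p.1 ≤ b} from
      fun p (hp : p.1 ≤ a) => hp.trans hab.le) (hm a)] at hpos
    exact sub_pos.1 hpos
  · rw [cdfX, measure_mono_null_ae (t := ∅) _ measure_empty, ENNReal.toReal_zero]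
    filter_upwards [h.ac.ae_le (ae_mem_unitSq hB), h.ac.ae_le (hB.ae_fst_ne 0)] with p h2 h3 h4
    exact h3 (le_antisymm h4 h2.1.1)
  · rw [cdfX, (mem_ae_iff_prob_eq_one (hm 1)).1, ENNReal.toReal_one]
    filter_upwards [h.ac.ae_le (ae_mem_unitSq hB)] with p h2
    exact h2.1.2

lemma IsRegularFor.isUnitCdf_cdfY (h0 : 0 ≤ ℓ) (h1 : ℓ ≤ 1) (h : IsRegularFor (muL ℓ) ν) :
    IsUnitCdf (cdfY ν) := by
  have := h.prob
  have hB := isBase_muL h0 h1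
  have hm : ∀ x, MeasurableSet {p : Ω2 | p.2 ≤ x} := fun x =>
    measurableSet_le measurable_snd measurable_const
  refine ⟨?_, fun a ha b hb hab => ?_, ?_, ?_⟩
  · simp only [funext (cdfY_eq h0 h1 h.ac)]
    exact continuous_const.sub (h.cont.comp (by fun_prop))
  · have hpos := h.real_pos (S := Set.univ ×ˢ Set.Ioc a b) (by
      rw [muL_real_strip_snd h0 h1 measurableSet_Ioc, unif01_real_Ioc ha.1 hab.le hb.2]
      exact sub_pos.2 hab)
    have e : {p : Ω2 | p.2 ≤ b} \ {p : Ω2 | p.2 ≤ a} = Set.univ ×ˢ Set.Ioc a b := by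
      ext p; simp [and_comm]
    rw [← e, measureReal_sdiff (show {p : Ω2 | p.2 ≤ a} ⊆ {p | p.2 ≤ b} from
      fun p (hp : p.2 ≤ a) => hp.trans hab.le) (hm a)] at hpos
    exact sub_pos.1 hpos
  · rw [cdfY, measure_mono_null_ae (t := ∅) _ measure_empty, ENNReal.toReal_zero]
    filter_upwards [h.ac.ae_le (ae_mem_unitSq hB), h.ac.ae_le (hB.ae_snd_ne 0)] with p h2 h3 h4
    exact h3 (le_antisymm h4 h2.2.1)
  · rw [cdfY, (mem_ae_iff_prob_eq_one (hm 1)).1, ENNReal.toReal_one]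
    filter_upwards [h.ac.ae_le (ae_mem_unitSq hB)] with p h2
    exact h2.2.2

lemma IsUnitCdf.mem_Ioc_iff {F : ℝ → ℝ} (hF : IsUnitCdf F) {a b x : ℝ} (ha : a ∈ Set.Icc (0 : ℝ) 1)
    (hb : b ∈ Set.Icc (0 : ℝ) 1) (hx : x ∈ Set.Icc (0 : ℝ) 1) :
    F x ∈ Set.Ioc (F a) (F b) ↔ x ∈ Set.Ioc a b := by
  rw [Set.mem_Ioc, Set.mem_Ioc, hF.strictMonoOn.lt_iff_lt ha hx, hF.strictMonoOn.le_iff_le hx hb]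

lemma IsRegularFor.Omap_real_Ioc (h0 : 0 ≤ ℓ) (h1 : ℓ ≤ 1) (h : IsRegularFor (muL ℓ) ν) {a b c d : ℝ}
    (ha : a ∈ Set.Icc (0 : ℝ) 1) (hb : b ∈ Set.Icc (0 : ℝ) 1) (hc : c ∈ Set.Icc (0 : ℝ) 1)
    (hd : d ∈ Set.Icc (0 : ℝ) 1) :
    (Omap ν).real (Set.Ioc (cdfX ν a) (cdfX ν b) ×ˢ Set.Ioc (cdfY ν c) (cdfY ν d)) =
      ν.real (Set.Ioc a b ×ˢ Set.Ioc c d) := by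
  have hX := h.isUnitCdf_cdfX h0 h1
  have hY := h.isUnitCdf_cdfY h0 h1
  have hXm := hX.cont
  have hYm := hY.cont
  rw [Omap, map_measureReal_apply (by fun_prop) (measurableSet_Ioc.prod measurableSet_Ioc)]
  refine congrArg ENNReal.toReal (measure_congr ?_)
  filter_upwards [h.ac.ae_le (ae_mem_unitSq (isBase_muL h0 h1))] with p hp
  exact propext (and_congr (hX.mem_Ioc_iff ha hb hp.1) (hY.mem_Ioc_iff hc hd hp.2))

lemma IsRegularFor.real_Ioc_eq (h0 : 0 ≤ ℓ) (h1 : ℓ ≤ 1) (h : IsRegularFor (muL ℓ) ν)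
    (h' : IsRegularFor (muL ℓ) ν') (he : Omap ν = Omap ν') {a b c d a' b' c' d' : ℝ}
    (ha : a ∈ Set.Icc (0 : ℝ) 1) (hb : b ∈ Set.Icc (0 : ℝ) 1) (hc : c ∈ Set.Icc (0 : ℝ) 1)
    (hd : d ∈ Set.Icc (0 : ℝ) 1) (ha' : a' ∈ Set.Icc (0 : ℝ) 1) (hb' : b' ∈ Set.Icc (0 : ℝ) 1)
    (hc' : c' ∈ Set.Icc (0 : ℝ) 1) (hd' : d' ∈ Set.Icc (0 : ℝ) 1)
    (ea : cdfX ν' a' = cdfX ν a) (eb : cdfX ν' b' = cdfX ν b) (ec : cdfY ν' c' = cdfY ν c)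
    (ed : cdfY ν' d' = cdfY ν d) :
    ν'.real (Set.Ioc a' b' ×ˢ Set.Ioc c' d') = ν.real (Set.Ioc a b ×ˢ Set.Ioc c d) := by
  rw [← h.Omap_real_Ioc h0 h1 ha hb hc hd, ← h'.Omap_real_Ioc h0 h1 ha' hb' hc' hd', he, ea, eb,
    ec, ed]

lemma muL_real_prod_mul_comm (h0 : 0 ≤ ℓ) (h1 : ℓ ≤ 1) {A A' B B' : Set ℝ} (hA : MeasurableSet A)
    (hA' : MeasurableSet A') (hB : MeasurableSet B) (hB' : MeasurableSet B')
    (hs : (A ⊆ Set.Iic (1 / 2) ∧ A' ⊆ Set.Iic (1 / 2)) ∨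
      (A ⊆ Set.Ioi (1 / 2) ∧ A' ⊆ Set.Ioi (1 / 2))) :
    (muL ℓ).real (A ×ˢ B) * (muL ℓ).real (A' ×ˢ B') =
      (muL ℓ).real (A ×ˢ B') * (muL ℓ).real (A' ×ˢ B) := by
  rw [muL_real_prod h0 h1 hA hB, muL_real_prod h0 h1 hA' hB', muL_real_prod h0 h1 hA hB',
    muL_real_prod h0 h1 hA' hB]
  rcases hs with ⟨h, h'⟩ | ⟨h, h'⟩
  · rw [integral_halfSign_of_subset h hA, integral_halfSign_of_subset h' hA']
    ring
  · rw [integral_halfSign_of_subset' h hA, integral_halfSign_of_subset' h' hA']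
    ring

/-- Two equivalent tilts of `muL ℓ` with the same permuton place the discontinuity of the base
density at the same quantile. -/
lemma cdfX_half_eq_of_Omap_eq (h0 : 1 / 2 ≤ ℓ) (h1 : ℓ ≤ 1) (h : IsRegularFor (muL ℓ) ν)
    (h' : IsRegularFor (muL ℓ) ν') {θ θ' : ℝ} (hEL : ν = (muL ℓ).tilted fun z => θ * discMass ν z)
    (hEL' : ν' = (muL ℓ).tilted fun z => θ' * discMass ν' z) (he : Omap ν = Omap ν') :
    cdfX ν (1 / 2) = cdfX ν' (1 / 2) := by
  have hl : 0 ≤ ℓ := by linarith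
  have hP := isProbabilityMeasure_muL hl h1
  have := h.prob
  have := h'.prob
  have hX := h.isUnitCdf_cdfX hl h1
  have hY := h.isUnitCdf_cdfY hl h1
  have hX' := h'.isUnitCdf_cdfX hl h1
  have hY' := h'.isUnitCdf_cdfY hl h1
  have hhalf : (1 / 2 : ℝ) ∈ Set.Ioo (0 : ℝ) 1 := by norm_num
  obtain ⟨x, hx, hxe⟩ := hX.exists_eq hX' hhalf
  obtain ⟨y, hy, hye⟩ := hY.exists_eq hY' hhalf
  by_contra hne
  have hx2 : x ≠ 1 / 2 := fun h => hne (by rw [← hxe, h])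
  obtain ⟨U, hU, m, hm, hUm⟩ := exists_nhds_tilted_le (μ := muL ℓ)
    (f := fun z => θ * discMass ν z) (continuous_const.mul h.cont)
    (fun z => abs_mul_discMass_le ν θ z) (K := 11 / 10) (by norm_num) (1 / 2, 1 / 2)
  obtain ⟨U', hU', m', hm', hUm'⟩ := exists_nhds_tilted_le (μ := muL ℓ)
    (f := fun z => θ' * discMass ν' z) (continuous_const.mul h'.cont)
    (fun z => abs_mul_discMass_le ν' θ' z) (K := 11 / 10) (by norm_num) (x, y)
  rw [← hEL] at hUm
  rw [← hEL'] at hUm'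
  obtain ⟨A', hA', B', hB', hAB'⟩ := mem_nhds_prod_iff.1 hU'
  have hside : ∃ A ∈ 𝓝 x, A ⊆ A' ∧ (A ⊆ Set.Iic (1 / 2) ∨ A ⊆ Set.Ioi (1 / 2)) := by
    rcases hx2.lt_or_gt with hlt | hlt
    · exact ⟨A' ∩ Set.Iic (1 / 2), inter_mem hA' (Iic_mem_nhds hlt), Set.inter_subset_left,
        Or.inl Set.inter_subset_right⟩
    · exact ⟨A' ∩ Set.Ioi (1 / 2), inter_mem hA' (Ioi_mem_nhds hlt), Set.inter_subset_left,
        Or.inr Set.inter_subset_right⟩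
  obtain ⟨A, hA, hAA', hAs⟩ := hside
  have key : ∀ {F G : ℝ → ℝ} {s : ℝ} {C : Set ℝ}, IsUnitCdf F → IsUnitCdf G → s ∈ Set.Ioo (0 : ℝ) 1 →
      G s = F (1 / 2) → C ∈ 𝓝 s → ∃ a b : ℝ, Set.Icc a b ⊆ C ∧ 0 ≤ a ∧ b ≤ 1 ∧ s ∈ Set.Icc a b ∧
        ∀ᶠ t in 𝓝 (1 / 2), ∃ r ∈ Set.Icc a b, G r = F t := by
    intro F G s C hF hG hs hFG hC
    obtain ⟨ε, hε, hεC⟩ := Metric.nhds_basis_closedBall.mem_iff.1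
      (inter_mem hC (Icc_mem_nhds hs.1 hs.2))
    rw [Real.closedBall_eq_Icc] at hεC
    have ha := (hεC ⟨le_rfl, by linarith⟩).2
    have hb := (hεC ⟨by linarith, le_rfl⟩).2
    refine ⟨s - ε, s + ε, fun r hr => (hεC hr).1, ha.1, hb.2, ⟨by linarith, by linarith⟩,
      eventually_exists_eq hF.cont hG.cont (by linarith) ?_ ?_⟩
    · rw [← hFG]
      exact hG.strictMonoOn ha (Set.Ioo_subset_Icc_self hs) (by linarith)
    · rw [← hFG]
      exact hG.strictMonoOn (Set.Ioo_subset_Icc_self hs) hb (by linarith)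
  obtain ⟨a, b, habA, ha, hb, hxab, hx'⟩ := key hX hX' hx hxe hA
  obtain ⟨c, d, hcdB, hc, hd, hycd, hy'⟩ := key hY hY' hy hye hB'
  obtain ⟨A₀, hA₀, B₀, hB₀, hAB₀⟩ := mem_nhds_prod_iff.1 hU
  obtain ⟨η, hη, hηs⟩ := Metric.nhds_basis_closedBall.mem_iff.1 (inter_mem
    (inter_mem hx' hy') (inter_mem (inter_mem hA₀ hB₀) (Icc_mem_nhds hhalf.1 hhalf.2)))
  rw [Real.closedBall_eq_Icc] at hηs
  have hlo := hηs ⟨le_rfl, by linarith⟩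
  have hhi := hηs ⟨by linarith, le_rfl⟩
  obtain ⟨⟨⟨x₁, hx₁, ex₁⟩, ⟨y₁, hy₁, ey₁⟩⟩, -, hl01⟩ := hlo
  obtain ⟨⟨⟨x₂, hx₂, ex₂⟩, ⟨y₂, hy₂, ey₂⟩⟩, -, hh01⟩ := hhi
  have hab01 : Set.Icc a b ⊆ Set.Icc 0 1 := Set.Icc_subset_Icc ha hb
  have hcd01 : Set.Icc c d ⊆ Set.Icc 0 1 := Set.Icc_subset_Icc hc hd
  have hhalf' := Set.Ioo_subset_Icc_self hhalf
  have hrect : ∀ {p q r s p' q' r' s' : ℝ}, p ∈ Set.Icc (0 : ℝ) 1 → q ∈ Set.Icc (0 : ℝ) 1 →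
      r ∈ Set.Icc (0 : ℝ) 1 → s ∈ Set.Icc (0 : ℝ) 1 → p' ∈ Set.Icc a b → q' ∈ Set.Icc a b →
      r' ∈ Set.Icc c d → s' ∈ Set.Icc c d → cdfX ν' p' = cdfX ν p → cdfX ν' q' = cdfX ν q →
      cdfY ν' r' = cdfY ν r → cdfY ν' s' = cdfY ν s →
      m' * (muL ℓ).real (Set.Ioc p' q' ×ˢ Set.Ioc r' s') ≤
        ν.real (Set.Ioc p q ×ˢ Set.Ioc r s) ∧ ν.real (Set.Ioc p q ×ˢ Set.Ioc r s) ≤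
        11 / 10 * (m' * (muL ℓ).real (Set.Ioc p' q' ×ˢ Set.Ioc r' s')) := by
    intro p q r s p' q' r' s' hp hq hr hs hp' hq' hr' hs' ep eq er es
    rw [← h.real_Ioc_eq hl h1 h' he hp hq hr hs (hab01 hp') (hab01 hq') (hcd01 hr') (hcd01 hs') ep
      eq er es]
    refine hUm' _ (measurableSet_Ioc.prod measurableSet_Ioc)
      ((Set.prod_mono (fun t ht => ?_) fun t ht => ?_).trans hAB')
    · exact hAA' (habA ⟨hp'.1.trans ht.1.le, ht.2.trans hq'.2⟩)
    · exact hcdB ⟨hr'.1.trans ht.1.le, ht.2.trans hs'.2⟩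
  have SW := (hrect hl01 hhalf' hl01 hhalf' hx₁ hxab hy₁ hycd ex₁ hxe ey₁ hye).2
  have NE := (hrect hhalf' hh01 hhalf' hh01 hxab hx₂ hycd hy₂ hxe ex₂ hye ey₂).2
  have NW := (hrect hl01 hhalf' hhalf' hh01 hx₁ hxab hycd hy₂ ex₁ hxe hye ey₂).1
  have SE := (hrect hhalf' hh01 hl01 hhalf' hxab hx₂ hy₁ hycd hxe ex₂ ey₁ hye).1
  have hbox : ∀ {p q r s : ℝ}, p ∈ Set.Icc (1 / 2 - η) (1 / 2 + η) →
      q ∈ Set.Icc (1 / 2 - η) (1 / 2 + η) → r ∈ Set.Icc (1 / 2 - η) (1 / 2 + η) →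
      s ∈ Set.Icc (1 / 2 - η) (1 / 2 + η) → m * (muL ℓ).real (Set.Ioc p q ×ˢ Set.Ioc r s) ≤
        ν.real (Set.Ioc p q ×ˢ Set.Ioc r s) ∧ ν.real (Set.Ioc p q ×ˢ Set.Ioc r s) ≤
        11 / 10 * (m * (muL ℓ).real (Set.Ioc p q ×ˢ Set.Ioc r s)) := by
    intro p q r s hp hq hr hs
    refine hUm _ (measurableSet_Ioc.prod measurableSet_Ioc)
      ((Set.prod_mono (fun t ht => ?_) fun t ht => ?_).trans hAB₀)
    · exact (hηs ⟨hp.1.trans ht.1.le, ht.2.trans hq.2⟩).2.1.1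
    · exact (hηs ⟨hr.1.trans ht.1.le, ht.2.trans hs.2⟩).2.1.2
  have i1 : (1 / 2 - η : ℝ) ∈ Set.Icc (1 / 2 - η) (1 / 2 + η) := ⟨le_rfl, by linarith⟩
  have i2 : (1 / 2 : ℝ) ∈ Set.Icc (1 / 2 - η) (1 / 2 + η) := ⟨by linarith, by linarith⟩
  have i3 : (1 / 2 + η : ℝ) ∈ Set.Icc (1 / 2 - η) (1 / 2 + η) := ⟨by linarith, le_rfl⟩
  have SW₀ := (hbox i1 i2 i1 i2).1
  have NE₀ := (hbox i2 i3 i2 i3).1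
  have NW₀ := (hbox i1 i2 i2 i3).2
  have SE₀ := (hbox i2 i3 i1 i2).2
  have sL : Set.Ioc (1 / 2 - η) (1 / 2) ⊆ Set.Iic (1 / 2 : ℝ) := fun t ht => ht.2
  have sU : Set.Ioc (1 / 2) (1 / 2 + η) ⊆ Set.Ioi (1 / 2 : ℝ) := fun t ht => ht.1
  have uL : unif01.real (Set.Ioc (1 / 2 - η) (1 / 2)) = η := by
    rw [unif01_real_Ioc hl01.1 (by linarith) hhalf.2.le]; ring
  have uU : unif01.real (Set.Ioc (1 / 2) (1 / 2 + η)) = η := by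
    rw [unif01_real_Ioc hhalf.1.le (by linarith) hh01.2]; ring
  simp only [muL_real_prod hl h1 measurableSet_Ioc measurableSet_Ioc,
    integral_halfSign_of_subset sL measurableSet_Ioc,
    integral_halfSign_of_subset' sU measurableSet_Ioc, uL, uU] at SW₀ NE₀ NW₀ SE₀
  have hcomm := muL_real_prod_mul_comm hl h1 (A := Set.Ioc x₁ x) (A' := Set.Ioc x x₂)
    (B := Set.Ioc y₁ y) (B' := Set.Ioc y y₂) measurableSet_Ioc measurableSet_Ioc measurableSet_Ioc
    measurableSet_Ioc (hAs.imp
      (fun hs => ⟨fun t ht => hs (habA ⟨hx₁.1.trans ht.1.le, ht.2.trans hxab.2⟩),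
        fun t ht => hs (habA ⟨hxab.1.trans ht.1.le, ht.2.trans hx₂.2⟩)⟩)
      (fun hs => ⟨fun t ht => hs (habA ⟨hx₁.1.trans ht.1.le, ht.2.trans hxab.2⟩),
        fun t ht => hs (habA ⟨hxab.1.trans ht.1.le, ht.2.trans hx₂.2⟩)⟩))
  have pos : ∀ S : Set Ω2, 0 ≤ (muL ℓ).real S := fun S => measureReal_nonneg
  have e1 := mul_le_mul SW₀ NE₀ (by rw [mul_neg, neg_mul, neg_neg]; positivity) measureReal_nonneg
  have e2 := mul_le_mul SW NE measureReal_nonneg (measureReal_nonneg.trans SW)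
  have e3 := mul_le_mul NW SE (mul_nonneg hm'.le (pos _)) measureReal_nonneg
  have e4 := mul_le_mul NW₀ SE₀ measureReal_nonneg (measureReal_nonneg.trans NW₀)
  have hD : 0 < (m * η ^ 2) ^ 2 := by positivity
  have hfin : (m * η ^ 2) ^ 2 * (1 + ℓ) ^ 2 ≤ (m * η ^ 2) ^ 2 * ((11 / 10) ^ 4 * (1 - ℓ) ^ 2) := by
    have e5 := congrArg (fun t => (11 / 10) ^ 2 * m' ^ 2 * t) hcomm
    nlinarith
  have := le_of_mul_le_mul_left hfin hD
  nlinarith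

end Kink

section Reflection

variable {ν : Measure Ω2} {ℓ δ : ℝ}

/-- The point reflection of the plane at the centre of the unit square. -/
def pointReflection (z : Ω2) : Ω2 := (1 - z.1, 1 - z.2)

lemma measurable_pointReflection : Measurable pointReflection := by
  unfold pointReflection; fun_prop

lemma map_pointReflection_box {a b c d : ℝ} :
    (volume.restrict (Set.Icc a b ×ˢ Set.Icc c d)).map pointReflection =
      volume.restrict (Set.Icc (1 - b) (1 - a) ×ˢ Set.Icc (1 - d) (1 - c)) := by
  have hp : MeasurePreserving pointReflection (volume : Measure Ω2) volume :=
    (Measure.measurePreserving_sub_left volume (1 : ℝ)).prod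
      (Measure.measurePreserving_sub_left volume (1 : ℝ))
  have he : pointReflection ⁻¹' (Set.Icc (1 - b) (1 - a) ×ˢ Set.Icc (1 - d) (1 - c)) =
      Set.Icc a b ×ˢ Set.Icc c d := by
    ext z
    simp only [pointReflection, Set.mem_preimage, Set.mem_prod, Set.mem_Icc, sub_le_sub_iff_left]
    tauto
  rw [← he]
  exact (hp.restrict_preimage (measurableSet_Icc.prod measurableSet_Icc)).map_eq

lemma map_pointReflection_muL (ℓ : ℝ) : (muL ℓ).map pointReflection = muL ℓ := by
  have hm := measurable_pointReflection
  simp only [muL, mu1M, lebSq, unitSq, Measure.map_add _ _ hm, Measure.map_smul,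
    map_pointReflection_box]
  norm_num
  congr 1
  exact add_comm _ _

lemma IsMinimizer.map_pointReflection (h0 : 0 ≤ ℓ) (h1 : ℓ ≤ 1) (h : IsMinimizer (muL ℓ) δ ν) :
    IsMinimizer (muL ℓ) δ (ν.map pointReflection) := by
  have := isProbabilityMeasure_muL h0 h1
  refine h.map measurable_pointReflection (map_pointReflection_muL ℓ) fun z w => ?_
  simp only [discordant, pointReflection, Set.mem_ofPred_eq, sub_lt_sub_iff_left]
  tauto

lemma cdfX_map_pointReflection (h0 : 0 ≤ ℓ) (h1 : ℓ ≤ 1) [IsProbabilityMeasure ν]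
    (hν : ν ≪ muL ℓ) : cdfX (ν.map pointReflection) (1 / 2) = 1 - cdfX ν (1 / 2) := by
  have hm : MeasurableSet {p : Ω2 | p.1 ≤ 1 / 2} := measurableSet_le measurable_fst measurable_const
  change (ν.map pointReflection).real _ = 1 - ν.real _
  rw [map_measureReal_apply measurable_pointReflection hm, ← probReal_compl_eq_one_sub hm]
  refine congrArg ENNReal.toReal (measure_congr ?_)
  filter_upwards [hν.ae_le ((isBase_muL h0 h1).ae_fst_ne (1 / 2))] with p hp
  refine propext ⟨fun (h : 1 - p.1 ≤ 1 / 2) (h' : p.1 ≤ 1 / 2) => hp (by linarith),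
    fun h => (?_ : 1 - p.1 ≤ 1 / 2)⟩
  have : 1 / 2 < p.1 := not_le.1 h
  linarith

lemma IsMinimizer.isRegularFor (h0 : 255 / 257 < ℓ) (h1 : ℓ ≤ 1) (hδ : 7 / 8 < δ) (hδ1 : δ < 1)
    (h : IsMinimizer (muL ℓ) δ ν) : IsRegularFor (muL ℓ) ν := by
  have hl : 0 ≤ ℓ := by linarith
  have := isProbabilityMeasure_muL hl h1
  have := h.prob
  obtain ⟨θ, -, hθ⟩ := h.exists_tilted_muL h0 h1 hδ hδ1
  refine ⟨h.prob, h.absolutelyContinuous, ?_, (isBase_muL hl h1).continuous_discMass h.ne_top⟩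
  rw [hθ]
  exact absolutelyContinuous_tilted (integrable_exp_of_abs_le
    ((measurable_discMass ν).const_mul θ) (abs_mul_discMass_le ν θ))

/-- Near the maximal inversion density, minimizers for nearly degenerate base measures come in
pairs related by the point reflection. -/
lemma exists_Omap_ne (h0 : 255 / 257 < ℓ) (h1 : ℓ ≤ 1) (hδ : 7 / 8 < δ) (hδ1 : δ < 1) :
    ∃ ν ν' : Measure Ω2, IsMinimizer (muL ℓ) δ ν ∧ IsMinimizer (muL ℓ) δ ν' ∧ Omap ν ≠ Omap ν' := by
  have hl : 0 ≤ ℓ := by linarith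
  obtain ⟨ρ, hρ, hne, ht⟩ := exists_klDiv_ne_top hl h1 hδ1
  obtain ⟨ν, hν⟩ := (isBase_muL hl h1).exists_isMinimizer hρ hne ht.le
  have hν' := hν.map_pointReflection hl h1
  have := hν.prob
  refine ⟨ν, _, hν, hν', fun he => hν.real_Iic_half_ne h0 h1 hδ ?_⟩
  obtain ⟨θ, -, hθ⟩ := hν.exists_tilted_muL h0 h1 hδ hδ1
  obtain ⟨θ', -, hθ'⟩ := hν'.exists_tilted_muL h0 h1 hδ hδ1
  have hc := cdfX_half_eq_of_Omap_eq (by linarith) h1 (hν.isRegularFor h0 h1 hδ hδ1)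
    (hν'.isRegularFor h0 h1 hδ hδ1) hθ hθ' he
  rw [cdfX_map_pointReflection hl h1 hν.absolutelyContinuous] at hc
  change cdfX ν (1 / 2) = 1 / 2
  linarith

end Reflection

/-- Theorem 1.20: (i) each `μ_ℓ` is CNC w.r.t. `21`, with
`t_{21}(μ_ℓ) = (2−ℓ)/4` and `α_{21}(μ_ℓ) = 1`; (ii) `𝒪(𝒢(21,μ₀,δ))` is a singleton for all
`δ ∈ [1/2,1)`; (iii) for each `ℓ` there is `δ_c(ℓ) > (2−ℓ)/4` below which `𝒪(𝒢(21,μ_ℓ,δ))`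
is a singleton; (iv) there is `ℓ_c < 1` such that for `ℓ ∈ (ℓ_c,1]` there is `δ'_c(ℓ) < 1`
above which `𝒪(𝒢(21,μ_ℓ,δ))` has at least two elements. -/
theorem phase_transition_generalized_mallows :
    (∀ ℓ ∈ Set.Icc (0 : ℝ) 1,
        ¬ IsCC (k := 1) inv2 (muL ℓ) ∧ tPat inv2 (muL ℓ) = (2 - ℓ)/4 ∧
          alphaSig inv2 (muL ℓ) = 1) ∧
    (∀ δ ∈ Set.Ico (1/2 : ℝ) 1,
        ∃ m : Measure Ω2,
          (fun ν : ProbabilityMeasure Ω2 => Omap (↑ν)) '' Gset inv2 (muL 0) δ = {m}) ∧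
    (∀ ℓ ∈ Set.Icc (0 : ℝ) 1, ∃ δc : ℝ, (2 - ℓ)/4 < δc ∧
        ∀ δ ∈ Set.Ico ((2 - ℓ)/4) δc,
          ∃ m : Measure Ω2,
            (fun ν : ProbabilityMeasure Ω2 => Omap (↑ν)) '' Gset inv2 (muL ℓ) δ = {m}) ∧
    (∃ ℓc : ℝ, ℓc < 1 ∧ ∀ ℓ ∈ Set.Ioc ℓc 1, ∃ δc' : ℝ, δc' < 1 ∧
        ∀ δ ∈ Set.Ioo δc' 1,
          ∃ m₁ m₂ : Measure Ω2, m₁ ≠ m₂ ∧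
            m₁ ∈ (fun ν : ProbabilityMeasure Ω2 => Omap (↑ν)) '' Gset inv2 (muL ℓ) δ ∧
            m₂ ∈ (fun ν : ProbabilityMeasure Ω2 => Omap (↑ν)) '' Gset inv2 (muL ℓ) δ) := by
  refine ⟨fun ℓ hℓ => ?_, fun δ hδ => ?_, fun ℓ hℓ => ?_, 255 / 257, by norm_num, fun ℓ hℓ =>
    ⟨7 / 8, by norm_num, fun δ hδ => ?_⟩⟩
  · have := isProbabilityMeasure_muL hℓ.1 hℓ.2
    exact ⟨not_isCC_muL hℓ.1 hℓ.2, (tPat_inv2 _).trans (discPair_muL hℓ.1 hℓ.2),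
      alphaSig_muL hℓ.1 hℓ.2⟩
  · rw [muL_zero]
    exact isBase_lebSq.image_Omap_eq_singleton (exists_unique_isMinimizer_lebSq hδ.1 hδ.2)
  · have := isProbabilityMeasure_muL hℓ.1 hℓ.2
    have hB := isBase_muL hℓ.1 hℓ.2
    obtain ⟨δc, hδc, h⟩ := hB.exists_unique_isMinimizer_near
      ((isCC_inv2_iff _).not.1 (not_isCC_muL hℓ.1 hℓ.2))
    rw [discPair_muL hℓ.1 hℓ.2] at hδc h
    exact ⟨δc, hδc, fun δ hδ => hB.image_Omap_eq_singleton (h δ hδ)⟩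
  · have hB := isBase_muL (by linarith [hℓ.1]) hℓ.2
    obtain ⟨ν, ν', hν, hν', hne⟩ := exists_Omap_ne hℓ.1 hℓ.2 hδ.1 hδ.2
    exact ⟨_, _, hne, ⟨_, hν.mem_Gset hB, rfl⟩, ⟨_, hν'.mem_Gset hB, rfl⟩⟩

end
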